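/- Key estimate for the interior case (Proposition 3.1): Let Ω ⊂ ℝⁿ be a bounded open set and A a continuous map from the closure of Ω to symmetric positive definite n×n matrices. Assume there are a point x₀ ∈ Ω, constants C₀ > 0, σ > 2s and r₀ > 0 such that A(x) ≤ A(x₀) + C₀ |x − x₀|^σ I_n in the sense of bilinear forms for all x in the closure of Ω with |x − x₀| < r₀. If n ≥ 4s, then for every λ > 0 one has the strict inequality S_λ^A < c_s · det(A(x₀))^{s/n} · K_s(n)⁻¹. -/

import Mathlib

open MeasureTheory Filter Set Topology

noncomputable section

abbrev Euc (n : ℕ) := EuclideanSpace ℝ (Fin n)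

/-- Partial derivative of `w` in the `i`-th horizontal direction. -/
noncomputable def pdX (n : ℕ) (w : Euc n → ℝ → ℝ) (i : Fin n) (x : Euc n) (y : ℝ) : ℝ :=
  fderiv ℝ (fun x' => w x' y) x (EuclideanSpace.single i 1)

/-- Partial derivative of `w` in the vertical direction. -/
noncomputable def pdY (n : ℕ) (w : Euc n → ℝ → ℝ) (x : Euc n) (y : ℝ) : ℝ :=
  deriv (fun y' => w x y') y

/-- `(∇ₓ w)ᵀ M (∇ₓ w)`. -/
noncomputable def quadA (n : ℕ) (M : Matrix (Fin n) (Fin n) ℝ) (w : Euc n → ℝ → ℝ)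
    (x : Euc n) (y : ℝ) : ℝ :=
  ∑ i, ∑ j, M i j * pdX n w i x y * pdX n w j x y

/-- `(∇ w)ᵀ diag(M,1) (∇ w)`. -/
noncomputable def quadB (n : ℕ) (M : Matrix (Fin n) (Fin n) ℝ) (w : Euc n → ℝ → ℝ)
    (x : Euc n) (y : ℝ) : ℝ :=
  quadA n M w x y + (pdY n w x y) ^ 2

/-- The set of Rayleigh quotients over smooth test functions compactly supported in
`Ω × [0,∞)` with nontrivial trace; `S_λ^A` is its infimum. -/
noncomputable def SQuotSet (n : ℕ) (s cs lam : ℝ) (Ω : Set (Euc n))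
    (A : Euc n → Matrix (Fin n) (Fin n) ℝ) : Set ℝ :=
  { r | ∃ f : Euc n → ℝ → ℝ,
      ContDiff ℝ (⊤ : ℕ∞) (fun p : Euc n × ℝ => f p.1 p.2) ∧
      IsCompact (closure {p : Euc n × ℝ | 0 ≤ p.2 ∧ f p.1 p.2 ≠ 0}) ∧
      closure {p : Euc n × ℝ | 0 ≤ p.2 ∧ f p.1 p.2 ≠ 0} ⊆ Ω ×ˢ Ici (0:ℝ) ∧
      (∃ x, f x 0 ≠ 0) ∧
      r = (cs * (∫ x in Ω, ∫ y in Ioi (0:ℝ), y ^ (1 - 2*s) * quadB n (A x) f x y)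
              - lam * (∫ x in Ω, (f x 0) ^ 2))
            / (∫ x in Ω, |f x 0| ^ (2*(n:ℝ) / ((n:ℝ) - 2*s))) ^ (((n:ℝ) - 2*s) / (n:ℝ)) }

/-- The set of Rayleigh quotients defining the best trace constant; `K_s(n)⁻¹` is its
infimum. -/
noncomputable def KQuotSet (n : ℕ) (s : ℝ) : Set ℝ :=
  { r | ∃ g : Euc n → ℝ → ℝ,
      ContDiff ℝ (⊤ : ℕ∞) (fun p : Euc n × ℝ => g p.1 p.2) ∧
      IsCompact (closure {p : Euc n × ℝ | 0 ≤ p.2 ∧ g p.1 p.2 ≠ 0}) ∧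
      (∃ x, g x 0 ≠ 0) ∧
      r = (∫ x : Euc n, ∫ y in Ioi (0:ℝ),
              y ^ (1 - 2*s) * ((∑ i, (pdX n g i x y) ^ 2) + (pdY n g x y) ^ 2))
            / (∫ x : Euc n, |g x 0| ^ (2*(n:ℝ) / ((n:ℝ) - 2*s))) ^ (((n:ℝ) - 2*s) / (n:ℝ)) }

set_option linter.all false

namespace IEE

/-- Japanese bracket powers are integrable. -/
lemma integrable_jb (n : ℕ) {γ : ℝ} (h : (n:ℝ) / 2 < γ) :
    Integrable (fun x : Euc n => (1 + ‖x‖^2) ^ (-γ)) := by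
  have := integrable_rpow_neg_one_add_norm_sq (E := Euc n) (μ := volume) (r := 2*γ)
    (by simp; linarith)
  convert this using 3
  ring

lemma integrableOn_ball_rpow (n : ℕ) (hn : 1 ≤ n) {α : ℝ} (h : α < n) (r : ℝ) :
    IntegrableOn (fun x : Euc n => ‖x‖ ^ (-α)) (Metric.ball 0 r) := by
  have : Nonempty (Fin n) := ⟨⟨0, hn⟩⟩
  rw [integrableOn_fun_norm_addHaar (E := Euc n) (μ := volume) (f := fun y => y ^ (-α))]
  simp only [finrank_euclideanSpace, Fintype.card_fin, smul_eq_mul]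
  rcases le_or_gt r 0 with hr | hr
  · simp [Ioo_eq_empty_of_le hr]
  have h1 : IntegrableOn (fun y : ℝ => y ^ ((n:ℝ) - 1 - α)) (Ioo 0 r) := by
    have := (intervalIntegral.intervalIntegrable_rpow' (a := 0) (b := r)
      (r := (n:ℝ) - 1 - α) (by linarith))
    rw [intervalIntegrable_iff_integrableOn_Ioo_of_le hr.le] at this
    exact this
  refine h1.congr_fun (fun y hy => ?_) measurableSet_Ioo
  have hy0 : 0 < y := hy.1
  have : (y ^ (n-1) : ℝ) = y ^ ((n:ℝ) - 1) := by
    rw [← Real.rpow_natCast]; congr 1; push_cast [hn]; ring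
  simp only [this]
  rw [← Real.rpow_add hy0]; congr 1

/-- Scaling of the integral of a homogeneous function over a ball. -/
lemma integral_ball_rpow (n : ℕ) (α : ℝ) {r : ℝ} (hr : 0 < r) :
    ∫ x in Metric.ball (0 : Euc n) r, ‖x‖ ^ (-α)
      = r ^ ((n:ℝ) - α) * ∫ x in Metric.ball (0 : Euc n) 1, ‖x‖ ^ (-α) := by
  have key := Measure.integral_comp_smul (μ := (volume : Measure (Euc n)))
    (fun x => (Metric.ball (0 : Euc n) r).indicator (fun x => ‖x‖ ^ (-α)) x) r
  rw [integral_indicator measurableSet_ball] at key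
  have h2 : (fun x : Euc n => (Metric.ball (0 : Euc n) r).indicator (fun x => ‖x‖ ^ (-α)) (r • x))
      = fun x => r ^ (-α) * (Metric.ball (0 : Euc n) 1).indicator (fun x => ‖x‖ ^ (-α)) x := by
    ext x
    by_cases hx : ‖x‖ < 1
    · have hx2 : r * ‖x‖ < r := by nlinarith
      rw [indicator_of_mem (a := r • x) (by simpa [norm_smul, abs_of_pos hr] using hx2),
        indicator_of_mem (by simpa using hx)]
      simp [norm_smul, abs_of_pos hr, Real.mul_rpow hr.le (norm_nonneg x)]
    · have hx2 : r ≤ r * ‖x‖ := by push Not at hx; nlinarith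
      rw [indicator_of_notMem (a := r • x) (by simpa [norm_smul, abs_of_pos hr] using hx2),
        indicator_of_notMem (by simpa using hx)]
      simp
  rw [h2, integral_const_mul, integral_indicator measurableSet_ball] at key
  simp only [finrank_euclideanSpace, Fintype.card_fin, smul_eq_mul] at key
  rw [abs_of_pos (by positivity)] at key
  rw [Real.rpow_sub hr, Real.rpow_natCast]
  rw [Real.rpow_neg hr.le] at key
  have h3 : 0 < r ^ α := Real.rpow_pos_of_pos hr _
  have h4 : 0 < r ^ n := by positivity
  field_simp at key ⊢
  linarith

lemma integral_compl_ball_rpow (n : ℕ) (α : ℝ) {r : ℝ} (hr : 0 < r) :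
    ∫ x in (Metric.ball (0 : Euc n) r)ᶜ, ‖x‖ ^ (-α)
      = r ^ ((n:ℝ) - α) * ∫ x in (Metric.ball (0 : Euc n) 1)ᶜ, ‖x‖ ^ (-α) := by
  have key := Measure.integral_comp_smul (μ := (volume : Measure (Euc n)))
    (fun x => (Metric.ball (0 : Euc n) r)ᶜ.indicator (fun x => ‖x‖ ^ (-α)) x) r
  rw [integral_indicator measurableSet_ball.compl] at key
  have h2 : (fun x : Euc n => (Metric.ball (0 : Euc n) r)ᶜ.indicator (fun x => ‖x‖ ^ (-α)) (r • x))
      = fun x => r ^ (-α) * (Metric.ball (0 : Euc n) 1)ᶜ.indicator (fun x => ‖x‖ ^ (-α)) x := by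
    ext x
    by_cases hx : ‖x‖ < 1
    · have hx2 : r * ‖x‖ < r := by nlinarith
      rw [indicator_of_notMem (a := r • x) (by simpa [norm_smul, abs_of_pos hr] using hx2),
        indicator_of_notMem (by simpa using hx)]
      simp
    · have hx2 : r ≤ r * ‖x‖ := by push Not at hx; nlinarith
      rw [indicator_of_mem (a := r • x) (by simpa [norm_smul, abs_of_pos hr] using hx2),
        indicator_of_mem (by simpa using hx)]
      simp [norm_smul, abs_of_pos hr, Real.mul_rpow hr.le (norm_nonneg x)]
  rw [h2, integral_const_mul, integral_indicator measurableSet_ball.compl] at key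
  simp only [finrank_euclideanSpace, Fintype.card_fin, smul_eq_mul] at key
  rw [abs_of_pos (by positivity)] at key
  rw [Real.rpow_sub hr, Real.rpow_natCast]
  rw [Real.rpow_neg hr.le] at key
  have h3 : 0 < r ^ α := Real.rpow_pos_of_pos hr _
  have h4 : 0 < r ^ n := by positivity
  field_simp at key ⊢
  linarith

lemma integrableOn_compl_ball_rpow (n : ℕ) {α : ℝ} (h : (n:ℝ) < α) {r : ℝ} (hr : 0 < r) :
    IntegrableOn (fun x : Euc n => ‖x‖ ^ (-α)) (Metric.ball 0 r)ᶜ := by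
  have h1 := (integrable_jb n (γ := α/2) (by linarith)).integrableOn (s := (Metric.ball 0 r)ᶜ)
  have h2 := h1.const_mul ((1/r^2 + 1) ^ (α/2))
  refine h2.mono' ?_ ?_
  · exact (by fun_prop : Measurable (fun x : Euc n => ‖x‖ ^ (-α))).aestronglyMeasurable
  · refine (ae_restrict_mem measurableSet_ball.compl).mono (fun x hx => ?_)
    have hx' : r ≤ ‖x‖ := by simpa using hx
    have hx0 : 0 < ‖x‖ := hr.trans_le hx'
    rw [Real.norm_of_nonneg (by positivity)]
    have hα : 0 < α := lt_of_le_of_lt (by positivity) h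
    have e1 : ‖x‖ ^ (-α) = (‖x‖^2) ^ (-(α/2)) := by
      rw [← Real.rpow_natCast, ← Real.rpow_mul (norm_nonneg _)]; congr 1; push_cast; ring
    rw [e1, Real.rpow_neg (by positivity), Real.rpow_neg (by positivity), ← div_eq_mul_inv,
      le_div_iff₀ (by positivity), inv_mul_le_iff₀ (by positivity),
      ← Real.mul_rpow (by positivity) (by positivity)]
    apply Real.rpow_le_rpow (by positivity) _ (by positivity)
    have : r^2 ≤ ‖x‖^2 := by gcongr
    have : 1 ≤ ‖x‖^2 * (1/r^2) := by rw [mul_one_div, le_div_iff₀ (by positivity)]; linarith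
    nlinarith

/-- the extremal density -/
def h0 (n : ℕ) (β : ℝ) (x : Euc n) : ℝ := (1 + ‖x‖^2) ^ (-((n:ℝ) - β))

lemma h0_pos (n : ℕ) (β : ℝ) (x : Euc n) : 0 < h0 n β x := by unfold h0; positivity

lemma h0_meas (n : ℕ) (β : ℝ) : Measurable (h0 n β) := by unfold h0; fun_prop

lemma h0_cont (n : ℕ) (β : ℝ) : Continuous (h0 n β) := by
  unfold h0
  refine Continuous.rpow_const (by fun_prop) (fun x => Or.inl (by positivity))

lemma h0_le_one (n : ℕ) (β : ℝ) (h : β ≤ n) (x : Euc n) : h0 n β x ≤ 1 := by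
  unfold h0
  apply Real.rpow_le_one_of_one_le_of_nonpos
  · nlinarith [sq_nonneg ‖x‖]
  · linarith

lemma h0_int (n : ℕ) {β : ℝ} (hβ : β < (n:ℝ)/2) : Integrable (h0 n β) :=
  integrable_jb n (by linarith)

/-- the Riesz type kernel `(|x|^2+t)^{-β}` -/
def ker (n : ℕ) (β : ℝ) (t : ℝ) (x : Euc n) : ℝ := (‖x‖^2 + t) ^ (-β)

lemma ker_meas (n : ℕ) (β t : ℝ) : Measurable (ker n β t) := by unfold ker; fun_prop

lemma ker_nonneg (n : ℕ) (β : ℝ) {t : ℝ} (ht : 0 ≤ t) (x : Euc n) : 0 ≤ ker n β t x := by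
  unfold ker; positivity

lemma ker_zero (n : ℕ) (β : ℝ) (x : Euc n) : ker n β 0 x = ‖x‖ ^ (-(2*β)) := by
  unfold ker
  rw [add_zero, ← Real.rpow_natCast, ← Real.rpow_mul (norm_nonneg _)]; congr 1; push_cast; ring

lemma ker_le_ker0 (n : ℕ) {β : ℝ} (hβ : 0 < β) {t : ℝ} (ht : 0 ≤ t) (x : Euc n) (hx : x ≠ 0) :
    ker n β t x ≤ ker n β 0 x := by
  unfold ker
  have : 0 < ‖x‖ := norm_pos_iff.mpr hx
  apply Real.rpow_le_rpow_of_nonpos (by positivity) (by linarith) (by linarith)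

lemma pot_pointwise (n : ℕ) {β : ℝ} (hβ : 0 < β) (hβ2 : β < (n:ℝ)/2) (x z : Euc n) (hxz : x ≠ z) {t : ℝ}
    (ht : 0 ≤ t) :
    h0 n β z * ker n β t (x - z) ≤ ((1 + ‖x‖^2 + t)/16) ^ (-β) * h0 n β z
      + ((1 + ‖x‖^2 + t)/4) ^ (-((n:ℝ) - β)) *
        (Metric.ball (0:Euc n) (Real.sqrt (1 + ‖x‖^2 + t))).indicator
          (fun w => ‖w‖ ^ (-(2*β))) (x - z) := by
  set P := 1 + ‖x‖^2 + t with hP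
  have hP1 : 1 ≤ P := by nlinarith [sq_nonneg ‖x‖]
  have hind : 0 ≤ (Metric.ball (0:Euc n) (Real.sqrt P)).indicator
          (fun w => ‖w‖ ^ (-(2*β))) (x - z) := indicator_nonneg (fun _ _ => by positivity) _
  have hh := h0_pos n β z
  by_cases hc : P ≤ 16 * (‖x - z‖^2 + t)
  · have : ker n β t (x - z) ≤ (P/16) ^ (-β) := by
      unfold ker
      apply Real.rpow_le_rpow_of_nonpos (by positivity) (by linarith) (by linarith)
    have h2 : 0 ≤ (P/4) ^ (-((n:ℝ) - β)) := by positivity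
    have := mul_le_mul_of_nonneg_left this hh.le
    have := mul_nonneg h2 hind
    linarith
  · push Not at hc
    have hz : P / 4 ≤ 1 + ‖z‖^2 := by
      have h1 : ‖x‖ ≤ ‖z‖ + ‖x - z‖ := by
        have := norm_add_le z (x - z); simpa using this
      have h2 : ‖x‖^2 ≤ 2*‖z‖^2 + 2*‖x-z‖^2 := by
        nlinarith [norm_nonneg x, norm_nonneg z, norm_nonneg (x-z), sq_nonneg (‖z‖ - ‖x-z‖)]
      nlinarith [sq_nonneg ‖x - z‖, sq_nonneg ‖z‖]
    have hb : x - z ∈ Metric.ball (0:Euc n) (Real.sqrt P) := by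
      rw [mem_ball_zero_iff]
      apply Real.lt_sqrt_of_sq_lt
      nlinarith [sq_nonneg ‖x - z‖]
    rw [indicator_of_mem hb]
    have h3 : h0 n β z ≤ (P/4) ^ (-((n:ℝ) - β)) := by
      unfold h0
      apply Real.rpow_le_rpow_of_nonpos (by positivity) hz (by linarith)
    have h5 : 0 ≤ (P/16) ^ (-β) * h0 n β z := by positivity
    have h4 := ker_le_ker0 n hβ ht (x - z) (sub_ne_zero.mpr hxz)
    rw [ker_zero] at h4
    have : 0 ≤ (P/4) ^ (-((n:ℝ) - β)) := by positivity
    have := mul_le_mul h3 h4 (ker_nonneg n β ht _) this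
    linarith

lemma ae_ne (n : ℕ) (hn : 1 ≤ n) (x : Euc n) : ∀ᵐ z : Euc n, x ≠ z := by
  have : Nonempty (Fin n) := ⟨⟨0, hn⟩⟩
  have : ∀ᵐ z : Euc n, z ∈ ({x}ᶜ : Set (Euc n)) := by
    exact (countable_singleton x).ae_notMem volume
  filter_upwards [this] with z hz h
  exact hz h.symm

lemma pot_bound (n : ℕ) (hn : 1 ≤ n) {β : ℝ} (hβ : 0 < β) (hβ2 : β < (n:ℝ)/2) :
    ∃ C : ℝ, 0 < C ∧ ∀ (x : Euc n) (t : ℝ), 0 ≤ t →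
      Integrable (fun z => h0 n β z * ker n β t (x - z)) ∧
      ∫ z, h0 n β z * ker n β t (x - z) ≤ C * (1 + ‖x‖^2 + t) ^ (-β) := by
  set J1 := ∫ z, h0 n β z with hJ1
  set J2 := ∫ x in Metric.ball (0 : Euc n) 1, ‖x‖ ^ (-(2*β)) with hJ2
  have hJ1p : 0 ≤ J1 := integral_nonneg (fun z => (h0_pos n β z).le)
  have hJ2p : 0 ≤ J2 := integral_nonneg (fun z => by positivity)
  refine ⟨(1/16 : ℝ) ^ (-β) * J1 + (1/4 : ℝ) ^ (-((n:ℝ) - β)) * J2 + 1, by positivity, ?_⟩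
  intro x t ht
  set P := 1 + ‖x‖^2 + t with hP
  have hP1 : 1 ≤ P := by nlinarith [sq_nonneg ‖x‖]
  have hP0 : 0 < P := by linarith
  have hsq : 0 < Real.sqrt P := Real.sqrt_pos.mpr hP0
  set ind := (Metric.ball (0:Euc n) (Real.sqrt P)).indicator
          (fun w : Euc n => ‖w‖ ^ (-(2*β))) with hind
  have hi1 : Integrable ind := by
    rw [hind, integrable_indicator_iff measurableSet_ball]
    exact integrableOn_ball_rpow n hn (by linarith) _
  have hi2 : Integrable (fun z => ind (x - z)) := hi1.comp_sub_left x
  have hi3 : Integrable (fun z => (P/16) ^ (-β) * h0 n β z + (P/4) ^ (-((n:ℝ) - β)) * ind (x - z)) :=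
    ((h0_int n hβ2).const_mul _).add (hi2.const_mul _)
  have hle : ∀ᵐ z, h0 n β z * ker n β t (x - z) ≤
      (P/16) ^ (-β) * h0 n β z + (P/4) ^ (-((n:ℝ) - β)) * ind (x - z) := by
    filter_upwards [ae_ne n hn x] with z hz
    exact pot_pointwise n hβ hβ2 x z hz ht
  have hIntg : Integrable (fun z => h0 n β z * ker n β t (x - z)) := by
    refine hi3.mono' ?_ ?_
    · exact ((h0_meas n β).mul ((ker_meas n β t).comp (measurable_const.sub measurable_id))).aestronglyMeasurable
    · filter_upwards [hle] with z hz
      rwa [Real.norm_of_nonneg (mul_nonneg (h0_pos n β z).le (ker_nonneg n β ht _))]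
  refine ⟨hIntg, (integral_mono_ae hIntg hi3 hle).trans ?_⟩
  rw [integral_add ((h0_int n hβ2).const_mul _) (hi2.const_mul _), integral_const_mul,
    integral_const_mul, integral_sub_left_eq_self (fun z => ind z) volume x, hind,
    integral_indicator measurableSet_ball, integral_ball_rpow n (2*β) hsq, ← hJ1, ← hJ2]
  have e1 : (P/16) ^ (-β) = (1/16:ℝ)^(-β) * P ^ (-β) := by
    rw [← Real.mul_rpow (by positivity) hP0.le]; congr 1; ring
  have e2 : (P/4) ^ (-((n:ℝ) - β)) = (1/4:ℝ)^(-((n:ℝ) - β)) * P ^ (-((n:ℝ) - β)) := by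
    rw [← Real.mul_rpow (by positivity) hP0.le]; congr 1; ring
  have e3 : P ^ (-((n:ℝ) - β)) * Real.sqrt P ^ ((n:ℝ) - 2*β) ≤ P ^ (-β) := by
    rw [Real.sqrt_eq_rpow, ← Real.rpow_mul hP0.le, ← Real.rpow_add hP0]
    apply Real.rpow_le_rpow_of_exponent_le hP1
    linarith
  have e4 : 0 ≤ P ^ (-β) := by positivity
  rw [e1, e2]
  calc _ = (1/16:ℝ)^(-β) * J1 * P ^ (-β) + ((1/4:ℝ)^(-((n:ℝ) - β)) * J2) *
        (P ^ (-((n:ℝ) - β)) * Real.sqrt P ^ ((n:ℝ) - 2*β)) := by ring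
    _ ≤ (1/16:ℝ)^(-β) * J1 * P ^ (-β) + ((1/4:ℝ)^(-((n:ℝ) - β)) * J2) * P ^ (-β) := by
        gcongr
    _ ≤ _ := by nlinarith
end IEE

namespace IEE

/-- Admissible densities. -/
def Adm (n : ℕ) (β : ℝ) (f : Euc n → ℝ) : Prop :=
  Measurable f ∧ ∃ C : ℝ, 0 ≤ C ∧ ∀ x, |f x| ≤ C * h0 n β x

variable {n : ℕ} {β : ℝ}

lemma Adm.h0 : Adm n β (h0 n β) :=
  ⟨h0_meas n β, 1, zero_le_one, fun x => by rw [one_mul, abs_of_pos (h0_pos n β x)]⟩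

lemma Adm.bdd_mul {f g : Euc n → ℝ} (hf : Adm n β f) (hg : Measurable g) {M : ℝ}
    (hM : ∀ x, |g x| ≤ M) : Adm n β (fun x => g x * f x) := by
  obtain ⟨hm, C, hC, hb⟩ := hf
  refine ⟨hg.mul hm, M * C, mul_nonneg ((abs_nonneg _).trans (hM 0)) hC, fun x => ?_⟩
  rw [abs_mul, mul_assoc]
  exact mul_le_mul (hM x) (hb x) (abs_nonneg _) ((abs_nonneg _).trans (hM 0))

lemma Adm.mul_bdd {f g : Euc n → ℝ} (hf : Adm n β f) (hg : Measurable g) {M : ℝ}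
    (hM : ∀ x, |g x| ≤ M) : Adm n β (fun x => f x * g x) := by
  simpa only [mul_comm] using hf.bdd_mul hg hM

lemma Adm.add {f g : Euc n → ℝ} (hf : Adm n β f) (hg : Adm n β g) :
    Adm n β (fun x => f x + g x) := by
  obtain ⟨hm, C, hC, hb⟩ := hf
  obtain ⟨hm', C', hC', hb'⟩ := hg
  refine ⟨hm.add hm', C + C', by positivity, fun x => ?_⟩
  have := abs_add_le (f x) (g x)
  have := hb x
  have := hb' x
  nlinarith

lemma Adm.const_mul {f : Euc n → ℝ} (hf : Adm n β f) (c : ℝ) :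
    Adm n β (fun x => c * f x) := hf.bdd_mul measurable_const (M := |c|) (fun _ => le_rfl)

lemma Adm.integrable {f : Euc n → ℝ} (hf : Adm n β f) (hβ2 : β < (n:ℝ)/2) : Integrable f := by
  obtain ⟨hm, C, hC, hb⟩ := hf
  exact ((h0_int n hβ2).const_mul C).mono' hm.aestronglyMeasurable (Eventually.of_forall hb)

lemma Adm.bounded {f : Euc n → ℝ} (hf : Adm n β f) (hβ2 : β ≤ n) :
    ∃ M, 0 ≤ M ∧ ∀ x, |f x| ≤ M := by
  obtain ⟨hm, C, hC, hb⟩ := hf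
  refine ⟨C, hC, fun x => (hb x).trans ?_⟩
  have := h0_le_one n β hβ2 x
  nlinarith

lemma ker_prod_meas (n : ℕ) (β t : ℝ) :
    Measurable (fun p : Euc n × Euc n => ker n β t (p.1 - p.2)) :=
  (ker_meas n β t).comp (measurable_fst.sub measurable_snd)

lemma h0_prod_int (hn : 1 ≤ n) (hβ : 0 < β) (hβ2 : β < (n:ℝ)/2) {t : ℝ} (ht : 0 ≤ t) :
    Integrable (fun p : Euc n × Euc n => h0 n β p.1 * h0 n β p.2 * ker n β t (p.1 - p.2))
      (volume.prod volume) := by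
  obtain ⟨C, hC, hb⟩ := pot_bound n hn hβ hβ2
  have hmeas : Measurable (fun p : Euc n × Euc n =>
      h0 n β p.1 * h0 n β p.2 * ker n β t (p.1 - p.2)) :=
    (((h0_meas n β).comp measurable_fst).mul ((h0_meas n β).comp measurable_snd)).mul
      (ker_prod_meas n β t)
  rw [integrable_prod_iff hmeas.aestronglyMeasurable]
  constructor
  · refine Eventually.of_forall (fun x => ?_)
    have := ((hb x t ht).1.const_mul (h0 n β x))
    simpa only [mul_assoc] using this
  · refine ((h0_int n hβ2).const_mul C).mono' ?_ ?_
    · exact (hmeas.norm.aestronglyMeasurable).integral_prod_right'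
    · refine Eventually.of_forall (fun x => ?_)
      rw [Real.norm_of_nonneg (integral_nonneg (fun _ => norm_nonneg _))]
      have e : ∀ z, ‖h0 n β x * h0 n β z * ker n β t (x - z)‖
          = h0 n β x * (h0 n β z * ker n β t (x - z)) := fun z => by
        rw [Real.norm_of_nonneg (mul_nonneg (mul_nonneg (h0_pos n β x).le (h0_pos n β z).le)
          (ker_nonneg n β ht _)), mul_assoc]
      simp only [e]
      rw [integral_const_mul, mul_comm C]
      refine mul_le_mul_of_nonneg_left ((hb x t ht).2.trans ?_) (h0_pos n β x).le
      have : (1 + ‖x‖^2 + t) ^ (-β) ≤ 1 :=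
        Real.rpow_le_one_of_one_le_of_nonpos (by nlinarith [sq_nonneg ‖x‖]) (by linarith)
      nlinarith

lemma adm_prod_int (hn : 1 ≤ n) (hβ : 0 < β) (hβ2 : β < (n:ℝ)/2) {t : ℝ} (ht : 0 ≤ t)
    {f g : Euc n → ℝ} (hf : Adm n β f) (hg : Adm n β g) :
    Integrable (fun p : Euc n × Euc n => f p.1 * g p.2 * ker n β t (p.1 - p.2))
      (volume.prod volume) := by
  obtain ⟨hm, C, hC, hb⟩ := hf
  obtain ⟨hm', C', hC', hb'⟩ := hg
  refine ((h0_prod_int hn hβ hβ2 ht).const_mul (C * C')).mono' ?_ ?_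
  · exact (((hm.comp measurable_fst).mul (hm'.comp measurable_snd)).mul
      (ker_prod_meas n β t)).aestronglyMeasurable
  · refine Eventually.of_forall (fun p => ?_)
    rw [Real.norm_eq_abs, abs_mul, abs_mul, abs_of_nonneg (ker_nonneg n β ht _)]
    calc _ ≤ (C * h0 n β p.1) * (C' * h0 n β p.2) * ker n β t (p.1 - p.2) := by
          have := ker_nonneg n β ht (p.1 - p.2)
          have := hb p.1
          have := hb' p.2
          have := h0_pos n β p.1
          gcongr
      _ = _ := by ring

lemma adm_prod_int' (hβ2 : β < (n:ℝ)/2)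
    {f g : Euc n → ℝ} (hf : Adm n β f) (hg : Adm n β g) :
    Integrable (fun p : Euc n × Euc n => f p.1 * g p.2) (volume.prod volume) :=
  (hf.integrable hβ2).mul_prod (hg.integrable hβ2)

lemma adm_pot_int (hn : 1 ≤ n) (hβ : 0 < β) (hβ2 : β < (n:ℝ)/2) {t : ℝ} (ht : 0 ≤ t)
    {f : Euc n → ℝ} (hf : Adm n β f) (x : Euc n) :
    Integrable (fun z => f z * ker n β t (x - z)) := by
  obtain ⟨hm, C, hC, hb⟩ := hf
  obtain ⟨C', hC', hb'⟩ := pot_bound n hn hβ hβ2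
  refine ((hb' x t ht).1.const_mul C).mono' ?_ ?_
  · exact (hm.mul ((ker_meas n β t).comp (measurable_const.sub measurable_id))).aestronglyMeasurable
  · refine Eventually.of_forall (fun z => ?_)
    rw [Real.norm_eq_abs, abs_mul, abs_of_nonneg (ker_nonneg n β ht _), ← mul_assoc]
    exact mul_le_mul_of_nonneg_right (hb z) (ker_nonneg n β ht _)

/-- The Riesz energy (bilinear). -/
def RI (n : ℕ) (β : ℝ) (f g : Euc n → ℝ) : ℝ :=
  ∫ p : Euc n × Euc n, f p.1 * g p.2 * ker n β 0 (p.1 - p.2) ∂(volume.prod volume)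

/-- The potential. -/
def pot (n : ℕ) (β : ℝ) (f : Euc n → ℝ) (t : ℝ) (x : Euc n) : ℝ :=
  ∫ z, f z * ker n β t (x - z)

lemma RI_eq (hn : 1 ≤ n) (hβ : 0 < β) (hβ2 : β < (n:ℝ)/2)
    {f g : Euc n → ℝ} (hf : Adm n β f) (hg : Adm n β g) :
    RI n β f g = ∫ x, f x * pot n β g 0 x := by
  unfold RI pot
  rw [integral_prod _ (adm_prod_int hn hβ hβ2 le_rfl hf hg)]
  simp only [mul_assoc, integral_const_mul]

end IEE

namespace IEE

/-- binomial coefficients of `(1-u)^{-a}` -/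
def cc (a : ℝ) : ℕ → ℝ
  | 0 => 1
  | (k+1) => cc a k * (a + k) / (k + 1)

lemma cc_succ (a : ℝ) (k : ℕ) : cc a (k+1) * (k+1) = cc a k * (a + k) := by
  rw [cc]; field_simp

lemma cc_pos {a : ℝ} (ha : 0 < a) (k : ℕ) : 0 < cc a k := by
  induction k with
  | zero => simp [cc]
  | succ k ih => rw [cc]; positivity

lemma cc_shift (a : ℝ) (k : ℕ) : cc a (k+1) * (k+1) = a * cc (a+1) k := by
  induction k with
  | zero => simp [cc]
  | succ k ih =>
    have h1 := cc_succ a (k+1)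
    have h2 := cc_succ (a+1) k
    rw [h1]
    have h3 : cc a (k+1) = a * cc (a+1) k / (k+1) := by
      rw [eq_div_iff (by positivity), ih]
    rw [h3]
    have h4 : cc (a+1) (k+1) = cc (a+1) k * (a + 1 + k) / (k+1) := by
      rw [eq_div_iff (by positivity), h2]
    rw [h4]; push_cast; ring

lemma cc_eq_choose (a : ℝ) (k : ℕ) : cc a k = Ring.choose (a + k - 1) k := by
  have h1 : Ring.choose (a + k - 1) k = Ring.multichoose a k := by
    rw [Ring.choose]; congr 1; ring
  rw [h1]
  have h2 : ∀ k : ℕ, (Nat.factorial k : ℝ) * cc a k = (ascPochhammer ℝ k).eval a := by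
    intro k
    induction k with
    | zero => simp [cc]
    | succ k ih =>
      rw [ascPochhammer_succ_right, Polynomial.eval_mul, ← ih, Nat.factorial_succ]
      have := cc_succ a k
      push_cast
      simp only [Polynomial.eval_add, Polynomial.eval_X, Polynomial.eval_natCast]
      linear_combination (Nat.factorial k : ℝ) * this
  have h3 := Ring.factorial_nsmul_multichoose_eq_ascPochhammer a k
  rw [nsmul_eq_mul, Polynomial.ascPochhammer_smeval_eq_eval, ← h2] at h3
  have : (Nat.factorial k : ℝ) ≠ 0 := by positivity
  exact (mul_left_cancel₀ this h3).symm

lemma HS {f g : ℕ → ℝ} {a b : ℝ} (h : HasSum f a) (h1 : ∀ k, f k = g k) (h2 : a = b) :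
    HasSum g b := by
  rw [← h2, ← funext h1]; exact h

lemma cc_hasSum (a : ℝ) {u : ℝ} (hu : |u| < 1) :
    HasSum (fun k => cc a k * u ^ k) ((1 - u) ^ (-a)) := by
  have h := (Real.one_div_one_sub_rpow_hasFPowerSeriesOnBall_zero a).hasSum (y := u)
    (by simp [Metric.mem_eball, edist_dist, hu])
  have hu1 : 0 ≤ 1 - u := by linarith [(abs_lt.mp hu).2]
  rw [Real.rpow_neg hu1, ← one_div]
  refine HS h (fun k => ?_) (by simp)
  simp [FormalMultilinearSeries.ofScalars_apply_eq, cc_eq_choose, mul_comm]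

lemma cc_hasSum_deriv (a : ℝ) {r t : ℝ} (hu : |r * t| < 1) :
    HasSum (fun k : ℕ => cc a k * k * r ^ (k+1) * t ^ (k-1)) (r^2 * (a * (1 - r*t) ^ (-(a+1)))) := by
  rw [← hasSum_nat_add_iff' 1]
  have h := ((cc_hasSum (a+1) hu).mul_left a).mul_left (r^2)
  refine HS h (fun k => ?_) (by simp)
  have := cc_shift a k
  push_cast
  rw [this, mul_pow]; ring_nf

/-- the pointwise kernel identity -/
lemma kernel_hasSum (N β : ℝ) {r t : ℝ} (hu : |r * t| < 1) :
    HasSum (fun k : ℕ => cc β k * r^(k+1) * ((k + N) * t^(k+1) - k * t^(k-1)))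
      ((1 - r*t)^(-β) * ((N - β) * (r*t) - β) + (1 - r^2) * (β * (1 - r*t)^(-(β+1)))) := by
  have h1 := (cc_hasSum β hu).mul_left (N * (r*t))
  have h2 := cc_hasSum_deriv β hu
  have h3 := h2.mul_left (t^2)
  have h4 := (h1.add h3).sub h2
  have hu1 : 0 < 1 - r*t := by linarith [(abs_lt.mp hu).2]
  have e : (1 - r*t)^(-β) = (1 - r*t) * (1 - r*t)^(-(β+1)) := by
    nth_rewrite 2 [← Real.rpow_one (1 - r*t)]
    rw [← Real.rpow_add hu1]
    congr 1; ring
  refine HS h4 (fun k => ?_) ?_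
  · rcases k with _ | k
    · simp; ring
    · simp; ring
  · rw [e]; ring


lemma rpow_r_bound {β r t : ℝ} (hβ : 0 < β) (hr : r ∈ Ioo (0:ℝ) 1) (ht : |t| ≤ 1) (ht1 : t < 1) :
    (1 - r*t)^(-β) ≤ (1 - t)^(-β) + 1 := by
  have h0 : 0 < 1 - t := by linarith
  have h1 : 0 ≤ (1 - t)^(-β) := by positivity
  obtain ⟨hr0, hr1⟩ := hr
  rcases le_or_gt 0 t with h | h
  · have : (1 - r*t)^(-β) ≤ (1 - t)^(-β) :=
      Real.rpow_le_rpow_of_nonpos h0 (by nlinarith) (by linarith)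
    linarith
  · have : (1 - r*t)^(-β) ≤ 1 :=
      Real.rpow_le_one_of_one_le_of_nonpos (by nlinarith) (by linarith)
    linarith

section abstract_series
variable {Z : Type*} [MeasurableSpace Z] {μ : Measure Z} {w t : Z → ℝ}

lemma rt_lt {r t : ℝ} (hr : r ∈ Ioo (0:ℝ) 1) (ht : |t| ≤ 1) : |r * t| < 1 := by
  rw [abs_mul, abs_of_pos hr.1]
  nlinarith [hr.1, hr.2, abs_nonneg t]

lemma pow_int (hw : Integrable w μ) (ht : Measurable t) (htb : ∀ z, |t z| ≤ 1) (k : ℕ) :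
    Integrable (fun z => w z * t z ^ k) μ := by
  refine hw.mul_bdd (c := 1) (ht.pow_const k).aestronglyMeasurable ?_
  refine Eventually.of_forall (fun z => ?_)
  rw [norm_pow]; exact pow_le_one₀ (norm_nonneg _) (htb z)

lemma meas_rpow_rt (ht : Measurable t) (r β : ℝ) : Measurable (fun z => (1 - r * t z)^(-β)) := by
  fun_prop

lemma I_limit {β : ℝ} (hβ : 0 < β) (hw : Integrable w μ)
    (ht : Measurable t) (htb : ∀ z, |t z| ≤ 1) (ht1 : ∀ᵐ z ∂μ, t z < 1)
    (hI : Integrable (fun z => w z * (1 - t z)^(-β)) μ) :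
    Tendsto (fun r => ∫ z, w z * (1 - r * t z)^(-β) ∂μ) (𝓝[<] 1)
      (𝓝 (∫ z, w z * (1 - t z)^(-β) ∂μ)) := by
  refine tendsto_integral_filter_of_dominated_convergence
    (fun z => |w z * (1 - t z)^(-β)| + |w z|) ?_ ?_ (hI.abs.add hw.abs) ?_
  · exact Eventually.of_forall (fun r => hw.aestronglyMeasurable.mul
      (meas_rpow_rt ht r β).aestronglyMeasurable)
  · filter_upwards [Ioo_mem_nhdsLT (zero_lt_one (α := ℝ))] with r hr
    filter_upwards [ht1] with z hz
    have h1 := rpow_r_bound hβ hr (htb z) hz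
    have h2 : 0 < 1 - r * t z := by linarith [(abs_lt.mp (rt_lt hr (htb z))).2]
    have h3 : 0 < 1 - t z := by linarith
    rw [Real.norm_eq_abs, abs_mul, abs_mul, abs_of_pos (Real.rpow_pos_of_pos h2 _),
      abs_of_pos (Real.rpow_pos_of_pos h3 _)]
    nlinarith [abs_nonneg (w z)]
  · filter_upwards [ht1] with z hz
    refine tendsto_const_nhds.mul ?_
    have h3 : 0 < 1 - t z := by linarith
    have : ContinuousAt (fun r : ℝ => (1 - r * t z)^(-β)) 1 := by
      refine ContinuousAt.rpow_const (by fun_prop) (Or.inl ?_)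
      simp; linarith
    simpa using this.tendsto.mono_left nhdsWithin_le_nhds

lemma D_limit {N β : ℝ} (hβ : 0 < β) (hw : Integrable w μ)
    (ht : Measurable t) (htb : ∀ z, |t z| ≤ 1) (ht1 : ∀ᵐ z ∂μ, t z < 1)
    (hI : Integrable (fun z => w z * (1 - t z)^(-β)) μ) :
    Tendsto (fun r => ∫ z, w z * ((1 - r*t z)^(-β) * ((N - β) * (r*t z) - β)
        + (1 - r^2) * (β * (1 - r*t z)^(-(β+1)))) ∂μ) (𝓝[<] 1)
      (𝓝 (∫ z, w z * ((1 - t z)^(-β) * ((N - β) * t z - β)) ∂μ)) := by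
  set K := |N - β| + 3 * β with hK
  refine tendsto_integral_filter_of_dominated_convergence
    (fun z => K * (|w z * (1 - t z)^(-β)| + |w z|)) ?_ ?_ ((hI.abs.add hw.abs).const_mul _) ?_
  · refine Eventually.of_forall (fun r => hw.aestronglyMeasurable.mul
      (Measurable.aestronglyMeasurable ?_))
    fun_prop
  · filter_upwards [Ioo_mem_nhdsLT (zero_lt_one (α := ℝ))] with r hr
    filter_upwards [ht1] with z hz
    have h1 := rpow_r_bound hβ hr (htb z) hz
    have h4 := rt_lt hr (htb z)
    have h2 : 0 < 1 - r * t z := by linarith [(abs_lt.mp h4).2]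
    have h3 : 0 < 1 - t z := by linarith
    set Q := (1 - r * t z)^(-β) with hQ
    have hQ0 : 0 < Q := Real.rpow_pos_of_pos h2 _
    have e : (1 - r*t z)^(-(β+1)) = Q / (1 - r * t z) := by
      rw [hQ, neg_add, ← sub_eq_add_neg, Real.rpow_sub h2, Real.rpow_one]
    rw [Real.norm_eq_abs, abs_mul, abs_mul, abs_of_pos (Real.rpow_pos_of_pos h3 _)]
    have hr2 : 0 < 1 - r^2 := by nlinarith [hr.1, hr.2]
    have h5 : (1 - r^2) * (β * (1 - r*t z)^(-(β+1))) ≤ 2 * β * Q := by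
      rw [e, mul_div_assoc', mul_div_assoc', div_le_iff₀ h2]
      have : t z ≤ 1 := hz.le
      have h6 : 1 - r^2 ≤ 2 * (1 - r * t z) := by nlinarith [hr.1, hr.2]
      nlinarith [mul_pos hβ hQ0]
    have h5' : 0 ≤ (1 - r^2) * (β * (1 - r*t z)^(-(β+1))) := by positivity
    have h7 : |(N - β) * (r*t z) - β| ≤ |N - β| + β := by
      calc _ ≤ |(N - β) * (r*t z)| + |β| := abs_sub _ _
        _ ≤ _ := by
          rw [abs_mul, abs_of_pos hβ]; nlinarith [abs_nonneg (N - β)]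
    have h8 : |Q * ((N - β) * (r*t z) - β) + (1 - r^2) * (β * (1 - r*t z)^(-(β+1)))| ≤ K * Q := by
      calc _ ≤ |Q * ((N - β) * (r*t z) - β)| + |(1 - r^2) * (β * (1 - r*t z)^(-(β+1)))| :=
            abs_add_le _ _
        _ ≤ _ := by
          rw [abs_mul, abs_of_pos hQ0, abs_of_nonneg h5', hK]; nlinarith
    have hK0 : 0 ≤ K := by positivity
    calc _ ≤ |w z| * (K * Q) := by gcongr
      _ ≤ |w z| * (K * ((1 - t z)^(-β) + 1)) := by gcongr
      _ = _ := by ring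
  · filter_upwards [ht1] with z hz
    refine tendsto_const_nhds.mul ?_
    have h3 : 0 < 1 - t z := by linarith
    have : ContinuousAt (fun r : ℝ => (1 - r*t z)^(-β) * ((N - β) * (r*t z) - β)
        + (1 - r^2) * (β * (1 - r*t z)^(-(β+1)))) 1 := by
      refine ContinuousAt.add (ContinuousAt.mul ?_ (by fun_prop))
        (ContinuousAt.mul (by fun_prop) (ContinuousAt.mul (by fun_prop) ?_)) <;>
      · refine ContinuousAt.rpow_const (by fun_prop) (Or.inl ?_)
        simp; linarith
    simpa using this.tendsto.mono_left nhdsWithin_le_nhds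

/-- Partial sums of the `U`-series are bounded by `D`. -/
lemma D_ge {N β : ℝ} (hN : 0 ≤ N) (hβ : 0 < β) (hw : Integrable w μ)
    (ht : Measurable t) (htb : ∀ z, |t z| ≤ 1) (ht1 : ∀ᵐ z ∂μ, t z < 1)
    (hI : Integrable (fun z => w z * (1 - t z)^(-β)) μ)
    (hU : ∀ k : ℕ, 0 ≤ (k + N) * (∫ z, w z * t z ^ (k+1) ∂μ) - k * (∫ z, w z * t z ^ (k-1) ∂μ))
    (M : ℕ) :
    ∑ k ∈ Finset.range M, cc β k *
      ((k + N) * (∫ z, w z * t z ^ (k+1) ∂μ) - k * (∫ z, w z * t z ^ (k-1) ∂μ)) ≤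
      ∫ z, w z * ((1 - t z)^(-β) * ((N - β) * t z - β)) ∂μ := by
  set U : ℕ → ℝ := fun k =>
    (k + N) * (∫ z, w z * t z ^ (k+1) ∂μ) - k * (∫ z, w z * t z ^ (k-1) ∂μ) with hUdef
  have hlim := D_limit (N := N) hβ hw ht htb ht1 hI
  have hlim2 : Tendsto (fun r : ℝ => ∑ k ∈ Finset.range M, cc β k * r^(k+1) * U k) (𝓝[<] 1)
      (𝓝 (∑ k ∈ Finset.range M, cc β k * U k)) := by
    have : Continuous (fun r : ℝ => ∑ k ∈ Finset.range M, cc β k * r^(k+1) * U k) := by fun_prop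
    have := this.tendsto 1
    simp only [one_pow, mul_one] at this
    exact this.mono_left nhdsWithin_le_nhds
  refine le_of_tendsto_of_tendsto hlim2 hlim ?_
  filter_upwards [Ioo_mem_nhdsLT (zero_lt_one (α := ℝ))] with r hr
  have hFint : ∀ k : ℕ, Integrable (fun z => w z *
      (cc β k * r^(k+1) * ((k + N) * t z^(k+1) - k * t z^(k-1)))) μ := by
    intro k
    have := (((pow_int hw ht htb (k+1)).const_mul ((k:ℝ) + N)).sub
      ((pow_int hw ht htb (k-1)).const_mul (k:ℝ))).const_mul (cc β k * r^(k+1))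
    refine this.congr (Eventually.of_forall (fun z => ?_))
    simp only [Pi.sub_apply]; ring
  have hFval : ∀ k : ℕ, ∫ z, w z *
      (cc β k * r^(k+1) * ((k + N) * t z^(k+1) - k * t z^(k-1))) ∂μ = cc β k * r^(k+1) * U k := by
    intro k
    rw [hUdef]; simp only
    rw [← integral_const_mul, ← integral_const_mul, ← integral_sub
      ((pow_int hw ht htb (k+1)).const_mul ((k:ℝ) + N))
      ((pow_int hw ht htb (k-1)).const_mul (k:ℝ)), ← integral_const_mul]
    congr 1; funext z; ring
  have hsum1 : Summable (fun k : ℕ => cc β k * r^(k+1) * (2 * k + N)) := by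
    have hr1 : |r * 1| < 1 := rt_lt hr (by simp)
    have a1 := ((cc_hasSum_deriv β hr1).mul_left 2).add ((cc_hasSum β hr1).mul_left (N * r))
    refine (HS a1 (fun k => ?_) rfl).summable
    simp; ring
  have hs := hasSum_integral_of_summable_integral_norm (μ := μ) hFint (by
    refine Summable.of_nonneg_of_le (fun k => integral_nonneg (fun _ => norm_nonneg _)) (fun k => ?_)
      (hsum1.mul_left (∫ z, |w z| ∂μ))
    rw [← integral_mul_const]
    refine integral_mono (hFint k).norm (hw.abs.mul_const _) (fun z => ?_)
    simp only [norm_mul, Real.norm_eq_abs]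
    have hc := cc_pos hβ k
    have hr0 := hr.1
    rw [abs_of_pos hc, abs_of_pos (pow_pos hr0 _)]
    have : |((k:ℝ) + N) * t z^(k+1) - k * t z^(k-1)| ≤ 2 * k + N := by
      have p1 : |t z^(k+1)| ≤ 1 := by rw [abs_pow]; exact pow_le_one₀ (abs_nonneg _) (htb z)
      have p2 : |t z^(k-1)| ≤ 1 := by rw [abs_pow]; exact pow_le_one₀ (abs_nonneg _) (htb z)
      have hk : (0:ℝ) ≤ k := by positivity
      calc _ ≤ |((k:ℝ) + N) * t z^(k+1)| + |k * t z^(k-1)| := abs_sub _ _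
        _ ≤ _ := by
          rw [abs_mul, abs_mul, abs_of_nonneg hk, abs_of_nonneg (by linarith : 0 ≤ (k:ℝ) + N)]
          nlinarith
    gcongr)
  simp only [hFval] at hs
  have hval : ∫ z, ∑' k : ℕ, w z * (cc β k * r^(k+1) * ((k + N) * t z^(k+1) - k * t z^(k-1))) ∂μ
      = ∫ z, w z * ((1 - r*t z)^(-β) * ((N - β) * (r*t z) - β)
        + (1 - r^2) * (β * (1 - r*t z)^(-(β+1)))) ∂μ := by
    congr 1; funext z
    exact ((kernel_hasSum N β (rt_lt hr (htb z))).mul_left (w z)).tsum_eq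
  rw [hval] at hs
  refine sum_le_hasSum _ (fun k _ => ?_) hs
  have hc := cc_pos hβ k
  have hr0 := hr.1
  have := hU k
  positivity

lemma I_series {β : ℝ} (hβ : 0 < β) (hw : Integrable w μ)
    (ht : Measurable t) (htb : ∀ z, |t z| ≤ 1) {r : ℝ} (hr : r ∈ Ioo (0:ℝ) 1) :
    HasSum (fun k => cc β k * r^k * ∫ z, w z * t z ^ k ∂μ) (∫ z, w z * (1 - r * t z)^(-β) ∂μ) := by
  have hFint : ∀ k : ℕ, Integrable (fun z => w z * (cc β k * (r * t z)^k)) μ := by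
    intro k
    refine ((pow_int hw ht htb k).const_mul (cc β k * r^k)).congr (Eventually.of_forall (fun z => ?_))
    simp only [mul_pow]; ring
  have hs := hasSum_integral_of_summable_integral_norm (μ := μ) hFint (by
    refine Summable.of_nonneg_of_le (fun k => integral_nonneg (fun _ => norm_nonneg _)) (fun k => ?_)
      (((cc_hasSum β (u := r) (by rw [abs_of_pos hr.1]; exact hr.2)).summable).mul_left (∫ z, |w z| ∂μ))
    rw [← integral_mul_const]
    refine integral_mono (hFint k).norm (hw.abs.mul_const _) (fun z => ?_)
    simp only [norm_mul, Real.norm_eq_abs, mul_pow]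
    have hc := cc_pos hβ k
    have hr0 := hr.1
    rw [abs_of_pos hc, abs_of_pos (pow_pos hr0 _)]
    have p1 : |t z^k| ≤ 1 := by rw [abs_pow]; exact pow_le_one₀ (abs_nonneg _) (htb z)
    have : r^k * |t z^k| ≤ r^k := mul_le_of_le_one_right (by positivity) p1
    gcongr)
  refine HS hs (fun k => ?_) ?_
  · rw [← integral_const_mul]; congr 1; funext z; rw [mul_pow]; ring
  · congr 1; funext z
    exact ((cc_hasSum β (rt_lt hr (htb z))).mul_left (w z)).tsum_eq

end abstract_series
end IEE

namespace IEE

def Tst (N : ℝ) : ℕ → ℝ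
  | 0 => 1
  | 1 => 0
  | (k+2) => (k+1) / (k+1+N) * Tst N k

def Bst (N β : ℝ) : ℕ → ℝ
  | 0 => 0
  | 1 => 1 / N
  | (k+2) => (1 / cc β (k+1) + (k+1) * Bst N β k) / (k+1+N)

lemma Bst_nonneg {N β : ℝ} (hN : 0 < N) (hβ : 0 < β) : ∀ k, 0 ≤ Bst N β k
  | 0 => le_rfl
  | 1 => by rw [Bst]; positivity
  | (k+2) => by
    have := Bst_nonneg hN hβ k
    have := cc_pos hβ (k+1)
    rw [Bst]; positivity

lemma T_ge {N : ℝ} (hN : 0 < N) {T : ℕ → ℝ}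
    (hU : ∀ k : ℕ, 0 ≤ (k + N) * T (k+1) - k * T (k-1)) : ∀ k, Tst N k * T 0 ≤ T k
  | 0 => by simp [Tst]
  | 1 => by
    have := hU 0
    simp at this
    rw [Tst, zero_mul]
    exact nonneg_of_mul_nonneg_right this hN
  | (k+2) => by
    have h1 := T_ge hN hU k
    have h2 := hU (k+1)
    push_cast at h2
    try simp only [Nat.add_sub_cancel] at h2
    rw [Tst]
    have h3 : (0:ℝ) < k + 1 + N := by positivity
    rw [div_mul_eq_mul_div, div_mul_eq_mul_div, div_le_iff₀ h3]
    have : (0:ℝ) ≤ (k:ℝ) + 1 := by positivity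
    nlinarith

lemma num_bound {N β : ℝ} (hβ : 0 < β) (hN : 2 * β < N) :
    ∃ C : ℝ, 0 ≤ C ∧ ∀ (T : ℕ → ℝ) (D : ℝ),
      (∀ k : ℕ, 0 ≤ (k + N) * T (k+1) - k * T (k-1)) →
      (∀ M, ∑ k ∈ Finset.range M, cc β k * ((k + N) * T (k+1) - k * T (k-1)) ≤ D) →
      ∀ r ∈ Ioo (0:ℝ) 1, ∀ M, ∑ k ∈ Finset.range M, cc β k * r^k * (T k - Tst N k * T 0) ≤ C * D := by
  have hN0 : 0 < N := by linarith
  set κ := (N - 2*β)/2 with hκ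
  have hκ0 : 0 < κ := by rw [hκ]; linarith
  obtain ⟨j0, hj0⟩ := exists_nat_gt (β + |β^2 - β| / κ)
  set L := β + 1 + j0 with hL
  set S := ∑ j ∈ Finset.range j0, cc β (j+1) * Bst N β (j+1) with hS
  have hS0 : 0 ≤ S := Finset.sum_nonneg (fun j _ =>
    mul_nonneg (cc_pos hβ _).le (Bst_nonneg hN0 hβ _))
  have hL0 : 0 < L := by positivity
  refine ⟨(1 + (κ + L) * S) / κ, by positivity, ?_⟩
  intro T D hU hD r hr M
  have hD0 : 0 ≤ D := by simpa using hD 0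
  set e : ℕ → ℝ := fun k => T k - Tst N k * T 0 with he
  have he0 : e 0 = 0 := by simp [he, Tst]
  have hen : ∀ k, 0 ≤ e k := fun k => sub_nonneg.mpr (T_ge hN0 hU k)
  have hUe : ∀ k : ℕ, (k + N) * T (k+1) - k * T (k-1) = (k+N) * e (k+1) - k * e (k-1) := by
    intro k
    rcases k with _ | k
    · simp [he, Tst]
    · simp only [he, Nat.add_sub_cancel, Tst]
      have h3 : (k:ℝ) + 1 + N ≠ 0 := by positivity
      push_cast
      field_simp
      ring
  simp only [hUe] at hU hD
  -- single terms
  have hsing : ∀ k, cc β k * ((k + N) * e (k+1) - k * e (k-1)) ≤ D := by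
    intro k
    refine (Finset.single_le_sum (f := fun k : ℕ => cc β k * ((k + N) * e (k+1) - k * e (k-1)))
      (fun i _ => mul_nonneg (cc_pos hβ i).le (hU i)) (Finset.self_mem_range_succ k)).trans (hD (k+1))
  have heB : ∀ k, e k ≤ Bst N β k * D := by
    intro k
    induction k using Nat.strong_induction_on with
    | _ k ih =>
      rcases k with _ | _ | k
      · simp [he0, Bst]
      · have := hsing 0
        simp [cc] at this
        simp only [Bst, zero_add]
        rw [div_mul_eq_mul_div, le_div_iff₀ hN0]; linarith
      · have h1 := hsing (k+1)
        have h2 := ih k (by omega)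
        simp only [Nat.add_sub_cancel] at h1
        push_cast at h1
        have hc := cc_pos hβ (k+1)
        rw [Bst]
        have h3 : (0:ℝ) < k + 1 + N := by positivity
        rw [div_mul_eq_mul_div, le_div_iff₀ h3]
        have h4 : ((k:ℝ)+1+N) * e (k+2) - (k+1) * e k ≤ D / cc β (k+1) := by
          rw [le_div_iff₀ hc]; linarith
        have h5 : ((k:ℝ)+1) * e k ≤ (k+1) * (Bst N β k * D) := by gcongr
        have : (1 / cc β (k+1) + (k+1) * Bst N β k) * D
          = D / cc β (k+1) + (k+1) * (Bst N β k * D) := by ring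
        rw [this]; linarith
  -- Abel summation
  have habel : ∀ M : ℕ, ∑ k ∈ Finset.range M, cc β k * ((k + N) * e (k+1) - k * e (k-1))
      - ∑ j ∈ Finset.range M, (cc β j * (j + N) - cc β (j+2) * (j+2)) * e (j+1)
      = cc β (M+1) * (M+1) * e M + cc β M * M * e (M-1) := by
    intro M
    induction M with
    | zero => simp [he0]
    | succ M ih =>
      rw [Finset.sum_range_succ, Finset.sum_range_succ, Nat.add_sub_cancel]
      push_cast
      linear_combination ih
  have hpart : ∀ M : ℕ, ∑ j ∈ Finset.range M, (cc β j * (j + N) - cc β (j+2) * (j+2)) * e (j+1) ≤ D := by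
    intro M
    have h1 := habel M
    have h2 := hD M
    have h3 : 0 ≤ cc β (M+1) * (M+1) * e M + cc β M * M * e (M-1) := by
      have := cc_pos hβ (M+1)
      have := cc_pos hβ M
      have := hen M
      have := hen (M-1)
      positivity
    linarith
  have hcoef : ∀ j : ℕ, κ * cc β (j+1) ≤ (cc β j * (j + N) - cc β (j+2) * (j+2))
      + (if j < j0 then (κ + L) * cc β (j+1) else 0) := by
    intro j
    have hc := cc_pos hβ (j+1)
    have h1 := cc_succ β j
    have h2 := cc_succ β (j+1)
    push_cast at h2
    have h2' : cc β (j+2) * (j+2) = cc β (j+1) * (β + j + 1) := by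
      have : ((j:ℝ) + 1 + 1) = j + 2 := by ring
      rw [this] at h2
      rw [show j + 2 = j + 1 + 1 from rfl, h2]; ring
    have hbj : 0 < β + j := by positivity
    have h3 : cc β j = cc β (j+1) * (j+1) / (β + j) := by rw [eq_div_iff hbj.ne', h1]
    rw [h2']
    split_ifs with hj
    · have hj' : (j:ℝ) + 1 ≤ j0 := by exact_mod_cast hj
      have := cc_pos hβ j
      have : 0 ≤ cc β j * (j + N) := by positivity
      nlinarith
    · push Not at hj
      have hj' : (j0:ℝ) ≤ j := by exact_mod_cast hj
      rw [h3, add_zero]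
      have h5 : |β^2 - β| ≤ κ * (j + 2 - β) := by
        have : |β^2 - β| / κ ≤ j + 2 - β := by linarith
        rw [div_le_iff₀ hκ0] at this; linarith
      have h6 : β^2 - β ≤ κ * (j + 2 - β) := (le_abs_self _).trans h5
      have h7 : κ + (β + j + 1) ≤ (j+1) * (j + N) / (β + j) := by
        rw [le_div_iff₀ hbj]
        have hNN : N = 2 * κ + 2 * β := by rw [hκ]; ring
        rw [hNN]; nlinarith
      have h8 : cc β (j+1) * (j+1) / (β + j) * (j + N)
          = cc β (j+1) * ((j+1) * (j + N) / (β + j)) := by ring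
      rw [h8]
      nlinarith
  have hmain : ∀ M : ℕ, κ * ∑ j ∈ Finset.range M, cc β (j+1) * e (j+1) ≤ (1 + (κ + L) * S) * D := by
    intro M
    have h1 : ∑ j ∈ Finset.range M, (if j < j0 then (κ + L) * cc β (j+1) else 0) * e (j+1)
        ≤ (κ + L) * S * D := by
      have : ∀ j, (if j < j0 then (κ + L) * cc β (j+1) else 0) * e (j+1)
          = if j < j0 then (κ + L) * cc β (j+1) * e (j+1) else 0 := fun j => by
        split_ifs <;> simp
      simp only [this]
      rw [← Finset.sum_filter]
      calc _ ≤ ∑ j ∈ Finset.range j0, (κ + L) * cc β (j+1) * e (j+1) := by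
            refine Finset.sum_le_sum_of_subset_of_nonneg ?_ (fun j _ _ => ?_)
            · intro j hj
              simp at hj ⊢; exact hj.2
            · have := cc_pos hβ (j+1)
              have := hen (j+1)
              positivity
        _ ≤ ∑ j ∈ Finset.range j0, (κ + L) * D * (cc β (j+1) * Bst N β (j+1)) := by
            refine Finset.sum_le_sum (fun j _ => ?_)
            have h1 := cc_pos hβ (j+1)
            have h2 := heB (j+1)
            calc _ ≤ (κ + L) * cc β (j+1) * (Bst N β (j+1) * D) := by gcongr
              _ = _ := by ring
        _ = _ := by rw [← Finset.mul_sum]; ring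
    have h2 := hpart M
    rw [Finset.mul_sum]
    calc _ ≤ ∑ j ∈ Finset.range M, ((cc β j * (j + N) - cc β (j+2) * (j+2)) * e (j+1)
          + (if j < j0 then (κ + L) * cc β (j+1) else 0) * e (j+1)) := by
          refine Finset.sum_le_sum (fun j _ => ?_)
          have := mul_le_mul_of_nonneg_right (hcoef j) (hen (j+1))
          linarith
      _ ≤ _ := by rw [Finset.sum_add_distrib]; linarith
  have hfin : ∑ k ∈ Finset.range M, cc β k * r^k * e k ≤ ∑ j ∈ Finset.range M, cc β (j+1) * e (j+1) := by
    calc _ ≤ ∑ k ∈ Finset.range M, cc β k * e k := by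
          refine Finset.sum_le_sum (fun k _ => ?_)
          have h1 := cc_pos hβ k
          have h2 := hen k
          have h3 : r^k ≤ 1 := pow_le_one₀ hr.1.le hr.2.le
          have : cc β k * r^k ≤ cc β k := mul_le_of_le_one_right h1.le h3
          gcongr
      _ ≤ ∑ k ∈ Finset.range (M+1), cc β k * e k := by
          rw [Finset.sum_range_succ]
          have h1 := cc_pos hβ M
          have h2 := hen M
          nlinarith [mul_nonneg h1.le h2]
      _ = _ := by rw [Finset.sum_range_succ']; simp [he0]
  have := hmain M
  rw [div_mul_eq_mul_div, le_div_iff₀ hκ0]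
  nlinarith

/-- abstract stability inequality -/
lemma abstract_bound {N β : ℝ} (hβ : 0 < β) (hN : 2 * β < N) :
    ∃ C : ℝ, 0 ≤ C ∧ ∀ {Z : Type} [MeasurableSpace Z] {μ : Measure Z} {w w0 t : Z → ℝ}
      (hw : Integrable w μ) (hw0 : Integrable w0 μ)
      (ht : Measurable t) (htb : ∀ z, |t z| ≤ 1) (ht1 : ∀ᵐ z ∂μ, t z < 1)
      (hI : Integrable (fun z => w z * (1 - t z)^(-β)) μ)
      (hI0 : Integrable (fun z => w0 z * (1 - t z)^(-β)) μ)
      (hU : ∀ k : ℕ, 0 ≤ (k + N) * (∫ z, w z * t z ^ (k+1) ∂μ) - k * (∫ z, w z * t z ^ (k-1) ∂μ))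
      (hU0 : ∀ k : ℕ, 0 ≤ (k + N) * (∫ z, w0 z * t z ^ (k+1) ∂μ)
        - k * (∫ z, w0 z * t z ^ (k-1) ∂μ))
      (hwp : 0 ≤ ∫ z, w z ∂μ) (hw0p : 0 < ∫ z, w0 z ∂μ),
      ∫ z, w z * (1 - t z)^(-β) ∂μ ≤
        C * (∫ z, w z * ((1 - t z)^(-β) * ((N - β) * t z - β)) ∂μ)
        + (∫ z, w z ∂μ) / (∫ z, w0 z ∂μ) * ∫ z, w0 z * (1 - t z)^(-β) ∂μ := by
  obtain ⟨C, hC, hb⟩ := num_bound hβ hN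
  have hN0 : 0 < N := by linarith
  refine ⟨C, hC, ?_⟩
  intro Z _ μ w w0 t hw hw0 ht htb ht1 hI hI0 hU hU0 hwp hw0p
  have h1 := hb (fun k => ∫ z, w z * t z ^ k ∂μ) _ hU (D_ge hN0.le hβ hw ht htb ht1 hI hU)
  have h2 := T_ge hN0 (T := fun k => ∫ z, w0 z * t z ^ k ∂μ) hU0
  simp only [pow_zero, mul_one] at h1 h2
  set θ := (∫ z, w z ∂μ) / (∫ z, w0 z ∂μ) with hθ
  have hθ0 : 0 ≤ θ := div_nonneg hwp hw0p.le
  have hθe : ∫ z, w z ∂μ = θ * ∫ z, w0 z ∂μ := by rw [hθ]; field_simp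
  set D := ∫ z, w z * ((1 - t z)^(-β) * ((N - β) * t z - β)) ∂μ with hD
  refine le_of_tendsto_of_tendsto (I_limit hβ hw ht htb ht1 hI)
    (tendsto_const_nhds.add ((I_limit hβ hw0 ht htb ht1 hI0).const_mul θ)) ?_
  filter_upwards [Ioo_mem_nhdsLT (zero_lt_one (α := ℝ))] with r hr
  have s1 := (I_series hβ hw ht htb hr).tendsto_sum_nat
  have s2 := (I_series hβ hw0 ht htb hr).tendsto_sum_nat
  refine le_of_tendsto_of_tendsto s1 (tendsto_const_nhds.add (s2.const_mul θ)) ?_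
  refine Eventually.of_forall (fun M => ?_)
  have h3 := h1 r hr M
  simp only [mul_sub, Finset.sum_sub_distrib] at h3
  have h4 : ∑ k ∈ Finset.range M, cc β k * r^k * (Tst N k * ∫ z, w z ∂μ)
      ≤ θ * ∑ k ∈ Finset.range M, cc β k * r^k * ∫ z, w0 z * t z ^ k ∂μ := by
    rw [Finset.mul_sum]
    refine Finset.sum_le_sum (fun k _ => ?_)
    have h5 := mul_le_mul_of_nonneg_left (h2 k)
      (mul_nonneg hθ0 (mul_nonneg (cc_pos hβ k).le (pow_nonneg hr.1.le k)))
    rw [hθe]; linarith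
  linarith

end IEE

namespace IEE

variable {n : ℕ} {β : ℝ}

/-- conformal factor -/
def mm (x : Euc n) : ℝ := 2 / (1 + ‖x‖^2)

/-- stereographic coordinates -/
def xi : Option (Fin n) → Euc n → ℝ
  | none, x => (1 - ‖x‖^2) / (1 + ‖x‖^2)
  | some i, x => 2 * x i / (1 + ‖x‖^2)

def tt (x y : Euc n) : ℝ := ∑ i, xi i x * xi i y

lemma jb_pos (x : Euc n) : 0 < 1 + ‖x‖^2 := by positivity

lemma mm_pos (x : Euc n) : 0 < mm x := by unfold mm; positivity

lemma mm_le (x : Euc n) : mm x ≤ 2 := by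
  unfold mm; rw [div_le_iff₀ (jb_pos x)]; nlinarith [sq_nonneg ‖x‖]

lemma mm_meas : Measurable (mm : Euc n → ℝ) := by unfold mm; fun_prop

lemma xi_meas (i : Option (Fin n)) : Measurable (xi i : Euc n → ℝ) := by
  rcases i with _ | i
  · unfold xi; fun_prop
  · unfold xi
    have : Measurable (fun x : Euc n => x i) := (EuclideanSpace.proj (𝕜 := ℝ) i).continuous.measurable
    fun_prop

lemma norm_sq_sum (x : Euc n) : ‖x‖^2 = ∑ i, x i ^ 2 := by
  rw [EuclideanSpace.norm_sq_eq]; simp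

lemma tt_eq (x y : Euc n) : 1 - tt x y = ‖x - y‖^2 * mm x * mm y / 2 := by
  unfold tt mm
  rw [Fintype.sum_option]
  have h1 : ∑ i, xi (some i) x * xi (some i) y
      = 4 * (∑ i, x i * y i) / ((1 + ‖x‖^2) * (1 + ‖y‖^2)) := by
    rw [Finset.mul_sum, Finset.sum_div]
    refine Finset.sum_congr rfl (fun i _ => ?_)
    simp only [xi]
    have := jb_pos x
    have := jb_pos y
    field_simp; ring
  have h2 : ‖x - y‖^2 = ‖x‖^2 + ‖y‖^2 - 2 * ∑ i, x i * y i := by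
    rw [norm_sq_sum, norm_sq_sum x, norm_sq_sum y, Finset.mul_sum, ← Finset.sum_add_distrib,
      ← Finset.sum_sub_distrib]
    refine Finset.sum_congr rfl (fun i _ => ?_)
    simp; ring
  rw [h1, h2]
  simp only [xi]
  have := jb_pos x
  have := jb_pos y
  field_simp
  ring

lemma tt_self (x : Euc n) : tt x x = 1 := by
  have := tt_eq x x
  simp at this; linarith

lemma tt_comm (x y : Euc n) : tt x y = tt y x := by
  unfold tt; exact Finset.sum_congr rfl (fun i _ => mul_comm _ _)

lemma xi_sq_sum (x : Euc n) : ∑ i, xi i x ^ 2 = 1 := by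
  rw [← tt_self x]; unfold tt; exact Finset.sum_congr rfl (fun i _ => sq _)

lemma xi_abs_le (i : Option (Fin n)) (x : Euc n) : |xi i x| ≤ 1 := by
  rw [← sq_le_one_iff_abs_le_one, ← xi_sq_sum x]
  exact Finset.single_le_sum (f := fun i => xi i x ^ 2) (fun i _ => sq_nonneg _) (Finset.mem_univ i)

lemma tt_abs_le (x y : Euc n) : |tt x y| ≤ 1 := by
  rw [← sq_le_one_iff_abs_le_one]
  have := Finset.sum_mul_sq_le_sq_mul_sq Finset.univ (fun i => xi i x) (fun i => xi i y)
  unfold tt; simpa only [xi_sq_sum, mul_one] using this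

lemma tt_meas : Measurable (fun p : Euc n × Euc n => tt p.1 p.2) := by
  unfold tt
  refine Finset.measurable_sum _ (fun i _ => ?_)
  exact ((xi_meas i).comp measurable_fst).mul ((xi_meas i).comp measurable_snd)

/-- bounded measurable -/
def BM (φ : Euc n → ℝ) : Prop := Measurable φ ∧ ∃ M, ∀ x, |φ x| ≤ M

lemma BM.mul {f g : Euc n → ℝ} (hf : BM f) (hg : BM g) : BM (fun x => f x * g x) := by
  obtain ⟨h1, M, hM⟩ := hf
  obtain ⟨h2, M', hM'⟩ := hg
  refine ⟨h1.mul h2, M * M', fun x => ?_⟩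
  rw [abs_mul]
  exact mul_le_mul (hM x) (hM' x) (abs_nonneg _) ((abs_nonneg _).trans (hM x))

lemma BM.add {f g : Euc n → ℝ} (hf : BM f) (hg : BM g) : BM (fun x => f x + g x) := by
  obtain ⟨h1, M, hM⟩ := hf
  obtain ⟨h2, M', hM'⟩ := hg
  exact ⟨h1.add h2, M + M', fun x => (abs_add_le _ _).trans (add_le_add (hM x) (hM' x))⟩

lemma BM.xi (i : Option (Fin n)) : BM (xi i : Euc n → ℝ) := ⟨xi_meas i, 1, xi_abs_le i⟩

lemma BM.const (c : ℝ) : BM (fun _ : Euc n => c) := ⟨measurable_const, |c|, fun _ => le_rfl⟩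

/-- the features -/
lemma features (d : Option (Fin n) → Euc n → ℝ) (hd : ∀ i, BM (d i)) (k : ℕ) :
    ∃ (J : Type) (_ : Fintype J) (φ ψ : J → Euc n → ℝ), (∀ j, BM (φ j)) ∧ (∀ j, BM (ψ j)) ∧
      (∀ x y, ∑ j, φ j x * φ j y = tt x y ^ (k+1)) ∧
      (∀ x y, ∑ j, ψ j x * φ j y = (k+1) * tt x y ^ k * ∑ i, d i x * xi i y) ∧
      (∀ x y, ∑ j, ψ j x * ψ j y = (k+1) * tt x y ^ k * (∑ i, d i x * d i y)
        + (k+1) * k * tt x y ^ (k-1) * ((∑ i, d i x * xi i y) * (∑ i, d i y * xi i x))) := by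
  induction k with
  | zero =>
    refine ⟨Option (Fin n), inferInstance, xi, d, BM.xi, hd, ?_, ?_, ?_⟩
    · intro x y; simp [tt]
    · intro x y; simp
    · intro x y; simp
  | succ k ih =>
    obtain ⟨J, _, φ, ψ, hφ, hψ, h1, h2, h3⟩ := ih
    refine ⟨J × Option (Fin n), inferInstance, fun q x => φ q.1 x * xi q.2 x,
      fun q x => ψ q.1 x * xi q.2 x + φ q.1 x * d q.2 x, fun q => (hφ _).mul (BM.xi _),
      fun q => ((hψ _).mul (BM.xi _)).add ((hφ _).mul (hd _)), ?_, ?_, ?_⟩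
    · intro x y
      rw [pow_succ, ← h1, Fintype.sum_prod_type]
      conv_rhs => rw [tt, Finset.sum_mul_sum]
      exact Finset.sum_congr rfl (fun j _ => Finset.sum_congr rfl (fun i _ => by ring))
    · intro x y
      have e : ∑ q : J × Option (Fin n), (ψ q.1 x * xi q.2 x + φ q.1 x * d q.2 x) * (φ q.1 y * xi q.2 y)
          = (∑ j, ψ j x * φ j y) * (∑ i, xi i x * xi i y)
            + (∑ j, φ j x * φ j y) * (∑ i, d i x * xi i y) := by
        rw [Fintype.sum_prod_type, Finset.sum_mul_sum, Finset.sum_mul_sum, ← Finset.sum_add_distrib]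
        refine Finset.sum_congr rfl (fun j _ => ?_)
        rw [← Finset.sum_add_distrib]
        exact Finset.sum_congr rfl (fun i _ => by ring)
      rw [e, h1, h2, ← tt]
      push_cast; ring
    · intro x y
      have h2' := h2 y x
      rw [tt_comm y x] at h2'
      have e : ∑ q : J × Option (Fin n), (ψ q.1 x * xi q.2 x + φ q.1 x * d q.2 x) *
            (ψ q.1 y * xi q.2 y + φ q.1 y * d q.2 y)
          = (∑ j, ψ j x * ψ j y) * (∑ i, xi i x * xi i y)
            + (∑ j, ψ j x * φ j y) * (∑ i, d i y * xi i x)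
            + (∑ j, ψ j y * φ j x) * (∑ i, d i x * xi i y)
            + (∑ j, φ j x * φ j y) * (∑ i, d i x * d i y) := by
        rw [Fintype.sum_prod_type, Finset.sum_mul_sum, Finset.sum_mul_sum, Finset.sum_mul_sum,
          Finset.sum_mul_sum, ← Finset.sum_add_distrib, ← Finset.sum_add_distrib,
          ← Finset.sum_add_distrib]
        refine Finset.sum_congr rfl (fun j _ => ?_)
        rw [← Finset.sum_add_distrib, ← Finset.sum_add_distrib, ← Finset.sum_add_distrib]
        exact Finset.sum_congr rfl (fun i _ => by ring)
      rw [e, h1, h2, h2', h3, ← tt]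
      rcases k with _ | k
      · push_cast; simp; ring
      · push_cast; (try simp only [Nat.add_sub_cancel]); ring

/-- the rotation field -/
def rot (i j l : Option (Fin n)) (x : Euc n) : ℝ :=
  (if l = i then 1 else 0) * xi j x + (if l = j then -1 else 0) * xi i x

lemma rot_BM (i j l : Option (Fin n)) : BM (rot i j l) :=
  ((BM.const _).mul (BM.xi j)).add ((BM.const _).mul (BM.xi i))

lemma rot_xi (i j : Option (Fin n)) (x y : Euc n) :
    ∑ l, rot i j l x * xi l y = xi j x * xi i y - xi i x * xi j y := by
  simp only [rot, add_mul, Finset.sum_add_distrib]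
  simp [ite_mul]; ring

lemma rot_rot (x y : Euc n) :
    ∑ i, ∑ j, ∑ l, rot i j l x * rot i j l y = 2 * n * tt x y := by
  have h : ∀ i j : Option (Fin n), ∑ l, rot i j l x * rot i j l y
      = xi j x * xi j y + xi i x * xi i y - (if i = j then 2 * (xi i x * xi j y) else 0) := by
    intro i j
    by_cases hij : i = j
    · subst hij
      simp only [rot, if_true]
      rw [Finset.sum_eq_zero]
      · ring
      · intro l _
        split_ifs <;> ring
    · have : ∀ l, rot i j l x * rot i j l y = (if l = i then xi j x * xi j y else 0)
          + (if l = j then xi i x * xi i y else 0) := by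
        intro l
        simp only [rot]
        by_cases h1 : l = i
        · have h2 : l ≠ j := fun h => hij (h1 ▸ h)
          simp [h1, hij]
        · by_cases h2 : l = j
          · have h3 : j ≠ i := fun h => hij h.symm
            simp [h2, h3]
          · simp [h1, h2]
      simp only [this, Finset.sum_add_distrib]
      simp [hij]
  simp only [h, Finset.sum_sub_distrib, Finset.sum_add_distrib]
  simp only [Finset.sum_ite_eq, Finset.mem_univ, if_true, Finset.sum_const, Finset.card_univ,
    Fintype.card_option, Fintype.card_fin, ← Finset.mul_sum, ← Finset.sum_nsmul, nsmul_eq_mul]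
  rw [← tt]; push_cast; ring

lemma rot_cross (x y : Euc n) :
    ∑ i, ∑ j, (∑ l, rot i j l x * xi l y) * (∑ l, rot i j l y * xi l x)
      = 2 * (tt x y ^ 2 - 1) := by
  simp only [rot_xi]
  have : ∀ i j : Option (Fin n), (xi j x * xi i y - xi i x * xi j y) * (xi j y * xi i x - xi i y * xi j x)
      = 2 * ((xi i x * xi i y) * (xi j x * xi j y)) - (xi i y ^2 * xi j x^2) - (xi i x^2 * xi j y^2) := by
    intro i j; ring
  simp only [this, Finset.sum_sub_distrib, ← Finset.mul_sum, ← Finset.sum_mul]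
  rw [xi_sq_sum, xi_sq_sum, ← tt]; ring

lemma U_nonneg {g : Euc n → ℝ} (hg : Integrable g) (k : ℕ) :
    0 ≤ ((k:ℝ) + n) * (∫ p : Euc n × Euc n, (g p.1 * g p.2) * tt p.1 p.2 ^ (k+1) ∂(volume.prod volume))
      - k * (∫ p : Euc n × Euc n, (g p.1 * g p.2) * tt p.1 p.2 ^ (k-1) ∂(volume.prod volume)) := by
  have hw : Integrable (fun p : Euc n × Euc n => g p.1 * g p.2) (volume.prod volume) := hg.mul_prod hg
  have hp := fun k => pow_int hw tt_meas (fun p => tt_abs_le p.1 p.2) k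
  choose J FJ φ ψ hφ hψ h1 h2 h3 using
    fun i j : Option (Fin n) => features (n := n) (rot i j) (rot_BM i j) k
  have hψi : ∀ i j q, Integrable (fun x => g x * ψ i j q x) := by
    intro i j q
    obtain ⟨hm, M, hM⟩ := hψ i j q
    exact hg.mul_bdd (c := M) hm.aestronglyMeasurable (Eventually.of_forall hM)
  have key : ∫ p : Euc n × Euc n, ∑ i, ∑ j, ∑ q, (g p.1 * ψ i j q p.1) * (g p.2 * ψ i j q p.2)
      ∂(volume.prod volume) = ∑ i, ∑ j, ∑ q, (∫ x, g x * ψ i j q x)^2 := by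
    rw [integral_finset_sum _ (fun i _ => integrable_finset_sum _ (fun j _ =>
      integrable_finset_sum _ (fun q _ => (hψi i j q).mul_prod (hψi i j q))))]
    refine Finset.sum_congr rfl (fun i _ => ?_)
    rw [integral_finset_sum _ (fun j _ =>
      integrable_finset_sum _ (fun q _ => (hψi i j q).mul_prod (hψi i j q)))]
    refine Finset.sum_congr rfl (fun j _ => ?_)
    rw [integral_finset_sum _ (fun q _ => (hψi i j q).mul_prod (hψi i j q))]
    refine Finset.sum_congr rfl (fun q _ => ?_)
    rw [integral_prod_mul (fun x => g x * ψ i j q x) (fun x => g x * ψ i j q x), sq]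
  have key2 : ∀ p : Euc n × Euc n, ∑ i, ∑ j, ∑ q, (g p.1 * ψ i j q p.1) * (g p.2 * ψ i j q p.2)
      = (2 * ((k:ℝ)+1)) * (((k:ℝ) + n) * ((g p.1 * g p.2) * tt p.1 p.2 ^ (k+1))
        - k * ((g p.1 * g p.2) * tt p.1 p.2 ^ (k-1))) := by
    intro p
    have e1 : ∀ i j, ∑ q, (g p.1 * ψ i j q p.1) * (g p.2 * ψ i j q p.2)
        = (g p.1 * g p.2) * ((k+1) * tt p.1 p.2 ^ k) * (∑ l, rot i j l p.1 * rot i j l p.2)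
        + (g p.1 * g p.2) * ((k+1) * k * tt p.1 p.2 ^ (k-1)) *
          ((∑ l, rot i j l p.1 * xi l p.2) * (∑ l, rot i j l p.2 * xi l p.1)) := by
      intro i j
      have := h3 i j p.1 p.2
      calc _ = (g p.1 * g p.2) * ∑ q, ψ i j q p.1 * ψ i j q p.2 := by
            rw [Finset.mul_sum]; exact Finset.sum_congr rfl (fun q _ => by ring)
        _ = _ := by rw [this]; ring
    simp only [e1, Finset.sum_add_distrib, ← Finset.mul_sum]
    rw [rot_rot, rot_cross]
    rcases k with _ | k
    · simp; ring
    · push_cast; (try simp only [Nat.add_sub_cancel]); ring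
  simp only [key2] at key
  rw [integral_const_mul, integral_sub ((hp (k+1)).const_mul _) ((hp (k-1)).const_mul _),
    integral_const_mul, integral_const_mul] at key
  have hpos : 0 ≤ ∑ i, ∑ j, ∑ q, (∫ x, g x * ψ i j q x)^2 :=
    Finset.sum_nonneg (fun i _ => Finset.sum_nonneg (fun j _ => Finset.sum_nonneg (fun q _ => sq_nonneg _)))
  rw [← key] at hpos
  exact nonneg_of_mul_nonneg_right hpos (by positivity)

end IEE

namespace IEE

variable {n : ℕ} {β : ℝ}

/-- the HLS exponent -/
def qq (n : ℕ) (β : ℝ) : ℝ := (n:ℝ) / ((n:ℝ) - β)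

lemma qq_gt_one (hβ : 0 < β) (hβ2 : β < (n:ℝ)/2) : 1 < qq n β := by
  unfold qq
  have : 0 < (n:ℝ) - β := by linarith
  rw [lt_div_iff₀ this]; linarith

lemma qq_lt_two (hβ : 0 < β) (hβ2 : β < (n:ℝ)/2) : qq n β < 2 := by
  unfold qq
  have : 0 < (n:ℝ) - β := by linarith
  rw [div_lt_iff₀ this]; linarith

lemma qq_inv (hβ : 0 < β) (hβ2 : β < (n:ℝ)/2) : 1 / qq n β = 1 - β / n := by
  unfold qq
  have : 0 < (n:ℝ) - β := by linarith
  have : 0 < (n:ℝ) := by linarith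
  field_simp

lemma qq_conj (hβ : 0 < β) (hβ2 : β < (n:ℝ)/2) : (qq n β).HolderConjugate ((n:ℝ)/β) := by
  have h := qq_inv hβ hβ2
  have : 0 < (n:ℝ) := by linarith
  rw [Real.holderConjugate_iff]
  refine ⟨qq_gt_one hβ hβ2, ?_⟩
  rw [← one_div, h, inv_div]; ring

lemma h0_rpow (hβ : 0 < β) (hβ2 : β < (n:ℝ)/2) (x : Euc n) :
    h0 n β x ^ qq n β = (1 + ‖x‖^2) ^ (-(n:ℝ)) := by
  unfold h0 qq
  rw [← Real.rpow_mul (jb_pos x).le]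
  have : 0 < (n:ℝ) - β := by linarith
  congr 1; field_simp

lemma jbn_int (hn : 1 ≤ n) : Integrable (fun x : Euc n => (1 + ‖x‖^2) ^ (-(n:ℝ))) :=
  integrable_jb n (by have : (1:ℝ) ≤ n := by exact_mod_cast hn
                      linarith)

lemma Adm.rpow_int {f : Euc n → ℝ} (hn : 1 ≤ n) (hβ : 0 < β) (hβ2 : β < (n:ℝ)/2)
    (hf : Adm n β f) : Integrable (fun x => |f x| ^ qq n β) := by
  obtain ⟨hm, C, hC, hb⟩ := hf
  refine ((jbn_int hn).const_mul (C ^ qq n β)).mono' ?_ ?_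
  · exact (by fun_prop : Measurable (fun x => |f x| ^ qq n β)).aestronglyMeasurable
  · refine Eventually.of_forall (fun x => ?_)
    rw [Real.norm_of_nonneg (by positivity), ← h0_rpow hβ hβ2, ← Real.mul_rpow hC (h0_pos n β x).le]
    exact Real.rpow_le_rpow (abs_nonneg _) (hb x) (by linarith [qq_gt_one hβ hβ2])

lemma Adm.memLp {f : Euc n → ℝ} (hn : 1 ≤ n) (hβ : 0 < β) (hβ2 : β < (n:ℝ)/2)
    (hf : Adm n β f) : MemLp f (ENNReal.ofReal (qq n β)) := by
  have hq := qq_gt_one hβ hβ2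
  rw [← integrable_norm_rpow_iff hf.1.aestronglyMeasurable (by simp; linarith) (by simp),
    ENNReal.toReal_ofReal (by linarith)]
  exact hf.rpow_int hn hβ hβ2

/-- `‖f‖_q^q` -/
def Lq (n : ℕ) (β : ℝ) (f : Euc n → ℝ) : ℝ := ∫ x, |f x| ^ qq n β

lemma Lq_nonneg (f : Euc n → ℝ) : 0 ≤ Lq n β f := integral_nonneg (fun x => by positivity)

lemma Lq_h0 (hβ : 0 < β) (hβ2 : β < (n:ℝ)/2) :
    Lq n β (h0 n β) = ∫ x : Euc n, (1 + ‖x‖^2) ^ (-(n:ℝ)) := by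
  unfold Lq
  simp only [abs_of_pos (h0_pos n β _), h0_rpow hβ hβ2]

lemma jbn_pos (hn : 1 ≤ n) : 0 < ∫ x : Euc n, (1 + ‖x‖^2) ^ (-(n:ℝ)) := by
  refine (integral_pos_iff_support_of_nonneg (fun x => by positivity) (jbn_int hn)).mpr ?_
  have : Function.support (fun x : Euc n => (1 + ‖x‖^2) ^ (-(n:ℝ))) = univ := by
    ext x; simp only [Function.mem_support, mem_univ, iff_true]; exact (Real.rpow_pos_of_pos (jb_pos x) _).ne'
  rw [this]; exact isOpen_univ.measure_pos volume ⟨0, mem_univ _⟩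

/-- the sharp constant -/
def Hs (n : ℕ) (β : ℝ) : ℝ := RI n β (h0 n β) (h0 n β) / (Lq n β (h0 n β)) ^ (2 / qq n β)

lemma mm_BM (hβ : 0 < β) : BM (fun x : Euc n => mm x ^ β) := by
  refine ⟨mm_meas.pow_const β, 2 ^ β, fun x => ?_⟩
  rw [abs_of_nonneg (Real.rpow_nonneg (mm_pos x).le _)]
  exact Real.rpow_le_rpow (mm_pos x).le (mm_le x) hβ.le

lemma Adm.BM_mul {f g : Euc n → ℝ} (hf : Adm n β f) (hg : BM g) : Adm n β (fun x => f x * g x) := by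
  obtain ⟨h, M, hM⟩ := hg
  exact hf.mul_bdd h hM

lemma kernel_conv (f g : Euc n → ℝ) (x y : Euc n) :
    (f x * mm x ^ β) * (g y * mm y ^ β) * (1 - tt x y) ^ (-β) = 2 ^ β * (f x * g y * ker n β 0 (x - y)) := by
  have hx := mm_pos x
  have hy := mm_pos y
  rw [tt_eq, Real.div_rpow (by positivity) (by norm_num), Real.mul_rpow (by positivity) hy.le,
    Real.mul_rpow (by positivity) hx.le, Real.rpow_neg hx.le, Real.rpow_neg hy.le,
    Real.rpow_neg (by norm_num : (0:ℝ) ≤ 2)]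
  unfold ker
  rw [add_zero]
  have h1 := Real.rpow_pos_of_pos hx β
  have h2 := Real.rpow_pos_of_pos hy β
  field_simp

/-- conformal second variation functional -/
def DDf (n : ℕ) (β : ℝ) (f : Euc n → ℝ) : ℝ :=
  ((n:ℝ) - β) * (∑ i, RI n β (fun x => f x * xi i x) (fun x => f x * xi i x)) - β * RI n β f f

lemma mean_bound {f : Euc n → ℝ} (hn : 1 ≤ n) (hβ : 0 < β) (hβ2 : β < (n:ℝ)/2)
    (hf : Adm n β f) (hf0 : ∀ x, 0 ≤ f x) :
    (∫ x, f x * mm x ^ β)^2 / (∫ x, h0 n β x * mm x ^ β)^2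
      ≤ Lq n β f ^ (2 / qq n β) / (Lq n β (h0 n β)) ^ (2 / qq n β) := by
  have hn0 : 0 < (n:ℝ) := by linarith
  have hq := qq_gt_one hβ hβ2
  set A := ∫ x : Euc n, (1 + ‖x‖^2) ^ (-(n:ℝ)) with hA
  have hA0 : 0 < A := jbn_pos hn
  have e0 : ∫ x, h0 n β x * mm x ^ β = 2 ^ β * A := by
    rw [hA, ← integral_const_mul]
    congr 1; funext x
    unfold h0 mm
    have := jb_pos x
    rw [Real.div_rpow (by norm_num) this.le, div_eq_mul_inv, ← Real.rpow_neg this.le,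
      mul_left_comm, ← Real.rpow_add this]
    congr 2; ring
  have emm : ∀ x : Euc n, (mm x ^ β) ^ ((n:ℝ)/β) = 2 ^ (n:ℝ) * (1 + ‖x‖^2) ^ (-(n:ℝ)) := by
    intro x
    rw [← Real.rpow_mul (mm_pos x).le, mul_div_cancel₀ _ hβ.ne']
    unfold mm
    rw [Real.div_rpow (by norm_num) (jb_pos x).le, Real.rpow_neg (jb_pos x).le, div_eq_mul_inv]
  have hnb : 0 < (n:ℝ)/β := by positivity
  have hmem : MemLp (fun x : Euc n => mm x ^ β) (ENNReal.ofReal ((n:ℝ)/β)) := by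
    rw [← integrable_norm_rpow_iff (mm_meas.pow_const β).aestronglyMeasurable
      (by simpa using hnb) (by simp), ENNReal.toReal_ofReal hnb.le]
    refine ((jbn_int hn).const_mul (2 ^ (n:ℝ))).congr (Eventually.of_forall (fun x => ?_))
    simp only
    rw [Real.norm_of_nonneg (Real.rpow_nonneg (mm_pos x).le _), emm]
  have hh := integral_mul_le_Lp_mul_Lq_of_nonneg (qq_conj hβ hβ2) (μ := volume)
    (Eventually.of_forall hf0)
    (Eventually.of_forall (fun x : Euc n => Real.rpow_nonneg (mm_pos x).le β))
    (hf.memLp hn hβ hβ2) hmem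
  have e1 : ∫ x, f x ^ qq n β = Lq n β f := by
    unfold Lq; congr 1; funext x; rw [abs_of_nonneg (hf0 x)]
  simp only [emm] at hh
  rw [e1, integral_const_mul, ← hA, Real.mul_rpow (by positivity) hA0.le, ← Real.rpow_mul (by norm_num),
    one_div_div, mul_div_cancel₀ _ hn0.ne'] at hh
  have hF := Lq_nonneg (β := β) f
  have hI0 : 0 ≤ ∫ x, f x * mm x ^ β :=
    integral_nonneg (fun x => mul_nonneg (hf0 x) (Real.rpow_nonneg (mm_pos x).le β))
  rw [e0, Lq_h0 hβ hβ2, ← hA]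
  have h2 : (∫ x, f x * mm x ^ β)^2 ≤ (Lq n β f ^ (1 / qq n β) * (2 ^ β * A ^ (β / n)))^2 := by
    gcongr
  have e3 : (Lq n β f ^ (1 / qq n β))^2 = Lq n β f ^ (2 / qq n β) := by
    rw [← Real.rpow_natCast, ← Real.rpow_mul hF]; congr 1; push_cast; ring
  have e4 : A ^ (2 / qq n β) * (A ^ (β / n))^2 = A^2 := by
    rw [← Real.rpow_natCast (A ^ (β / n)), ← Real.rpow_mul hA0.le, ← Real.rpow_add hA0,
      ← Real.rpow_natCast A]
    congr 1
    have := qq_inv hβ hβ2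
    push_cast
    rw [show 2 / qq n β = 2 * (1 / qq n β) by ring, this]; ring
  rw [div_le_div_iff₀ (by positivity) (by positivity)]
  calc _ ≤ (Lq n β f ^ (1 / qq n β) * (2 ^ β * A ^ (β / n)))^2 * A ^ (2 / qq n β) := by gcongr
    _ = Lq n β f ^ (2 / qq n β) * (2 ^ β)^2 * (A ^ (2 / qq n β) * (A ^ (β / n))^2) := by
        rw [mul_pow, e3, mul_pow]; ring
    _ = _ := by rw [e4]; ring

lemma stability (hn : 1 ≤ n) (hβ : 0 < β) (hβ2 : β < (n:ℝ)/2) :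
    ∃ C : ℝ, 0 ≤ C ∧ ∀ f : Euc n → ℝ, Adm n β f → (∀ x, 0 ≤ f x) →
      RI n β f f ≤ Hs n β * Lq n β f ^ (2 / qq n β) + C * DDf n β f := by
  obtain ⟨C, hC, hb⟩ := abstract_bound (N := n) hβ (by linarith)
  refine ⟨C, hC, fun f hf hf0 => ?_⟩
  have h2 : (0:ℝ) < 2 ^ β := by positivity
  have hIntg : ∀ g, Adm n β g → Integrable (fun p : Euc n × Euc n =>
      ((g p.1 * mm p.1 ^ β) * (g p.2 * mm p.2 ^ β)) * (1 - tt p.1 p.2) ^ (-β)) (volume.prod volume) := by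
    intro g hg
    simp only [kernel_conv]
    exact (adm_prod_int hn hβ hβ2 le_rfl hg hg).const_mul _
  have hval : ∀ g, ∫ p : Euc n × Euc n,
      ((g p.1 * mm p.1 ^ β) * (g p.2 * mm p.2 ^ β)) * (1 - tt p.1 p.2) ^ (-β) ∂(volume.prod volume)
        = 2 ^ β * RI n β g g := by
    intro g
    simp only [kernel_conv]
    rw [integral_const_mul, RI]
  have hGi : ∀ g, Adm n β g → Integrable (fun x => g x * mm x ^ β) :=
    fun g hg => (hg.BM_mul (mm_BM hβ)).integrable hβ2
  have hm : ∀ g : Euc n → ℝ, ∫ p : Euc n × Euc n, (g p.1 * mm p.1 ^ β) * (g p.2 * mm p.2 ^ β)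
      ∂(volume.prod volume) = (∫ x, g x * mm x ^ β)^2 := by
    intro g
    rw [integral_prod_mul (fun x => g x * mm x ^ β) (fun x => g x * mm x ^ β), sq]
  have hDD : ∫ p : Euc n × Euc n, ((f p.1 * mm p.1 ^ β) * (f p.2 * mm p.2 ^ β)) *
      ((1 - tt p.1 p.2) ^ (-β) * (((n:ℝ) - β) * tt p.1 p.2 - β)) ∂(volume.prod volume)
      = 2 ^ β * DDf n β f := by
    have e : ∀ p : Euc n × Euc n, ((f p.1 * mm p.1 ^ β) * (f p.2 * mm p.2 ^ β)) *
      ((1 - tt p.1 p.2) ^ (-β) * (((n:ℝ) - β) * tt p.1 p.2 - β))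
      = 2 ^ β * (((n:ℝ) - β) * (∑ i, (f p.1 * xi i p.1) * (f p.2 * xi i p.2) * ker n β 0 (p.1 - p.2))
        - β * (f p.1 * f p.2 * ker n β 0 (p.1 - p.2))) := by
      intro p
      rw [← mul_assoc, kernel_conv]
      have : ∑ i, (f p.1 * xi i p.1) * (f p.2 * xi i p.2) * ker n β 0 (p.1 - p.2)
          = f p.1 * f p.2 * ker n β 0 (p.1 - p.2) * tt p.1 p.2 := by
        unfold tt
        rw [Finset.mul_sum]; exact Finset.sum_congr rfl (fun i _ => by ring)
      rw [this]; ring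
    have hi : ∀ i ∈ (Finset.univ : Finset (Option (Fin n))), Integrable (fun p : Euc n × Euc n =>
        (f p.1 * xi i p.1) * (f p.2 * xi i p.2) * ker n β 0 (p.1 - p.2)) (volume.prod volume) :=
      fun i _ => adm_prod_int hn hβ hβ2 le_rfl (hf.BM_mul (BM.xi i)) (hf.BM_mul (BM.xi i))
    simp only [e]
    rw [integral_const_mul, integral_sub ((integrable_finset_sum _ hi).const_mul _)
      ((adm_prod_int hn hβ hβ2 le_rfl hf hf).const_mul _), integral_const_mul, integral_const_mul,
      integral_finset_sum _ hi]
    rfl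
  have hpos : 0 < ∫ x, h0 n β x * mm x ^ β := by
    refine (integral_pos_iff_support_of_nonneg (fun x => ?_) (hGi _ Adm.h0)).mpr ?_
    · exact mul_nonneg (h0_pos n β x).le (Real.rpow_nonneg (mm_pos x).le β)
    · have : Function.support (fun x : Euc n => h0 n β x * mm x ^ β) = univ := by
        ext x; simp [(h0_pos n β x).ne', (Real.rpow_pos_of_pos (mm_pos x) β).ne']
      rw [this]; exact isOpen_univ.measure_pos volume ⟨0, mem_univ _⟩
  have hae : ∀ᵐ p : Euc n × Euc n ∂(volume.prod volume), tt p.1 p.2 < 1 := by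
    have hne : ∀ᵐ p : Euc n × Euc n ∂(volume.prod volume), p.1 ≠ p.2 := by
      rw [Measure.ae_prod_iff_ae_ae]
      · exact Eventually.of_forall (fun x => ae_ne n hn x)
      · exact (measurableSet_eq_fun measurable_fst measurable_snd).compl
    filter_upwards [hne] with p hp
    have h1 := tt_eq p.1 p.2
    have h3 : 0 < ‖p.1 - p.2‖ := norm_pos_iff.mpr (sub_ne_zero.mpr hp)
    have := mm_pos p.1
    have := mm_pos p.2
    have : 0 < ‖p.1 - p.2‖^2 * mm p.1 * mm p.2 / 2 := by positivity
    linarith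
  have := hb (Z := Euc n × Euc n) (μ := volume.prod volume)
    ((hGi f hf).mul_prod (hGi f hf)) ((hGi _ Adm.h0).mul_prod (hGi _ Adm.h0))
    tt_meas (fun p => tt_abs_le p.1 p.2) hae (hIntg f hf) (hIntg _ Adm.h0)
    (U_nonneg (hGi f hf)) (U_nonneg (hGi _ Adm.h0))
    (by rw [hm]; positivity) (by rw [hm]; positivity)
  rw [hval, hval, hDD, hm, hm] at this
  have hmb := mean_bound hn hβ hβ2 hf hf0
  have hR0 : 0 ≤ RI n β (h0 n β) (h0 n β) :=
    integral_nonneg (fun p => mul_nonneg (mul_nonneg (h0_pos n β _).le (h0_pos n β _).le)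
      (ker_nonneg n β le_rfl _))
  have h5 := mul_le_mul_of_nonneg_right hmb hR0
  have h6 : Lq n β f ^ (2 / qq n β) / (Lq n β (h0 n β)) ^ (2 / qq n β) * RI n β (h0 n β) (h0 n β)
      = Hs n β * Lq n β f ^ (2 / qq n β) := by unfold Hs; ring
  rw [h6] at h5
  have h7 : 2 ^ β * RI n β f f ≤ 2 ^ β * (C * DDf n β f +
      (∫ x, f x * mm x ^ β)^2 / (∫ x, h0 n β x * mm x ^ β)^2 * RI n β (h0 n β) (h0 n β)) := by
    linarith
  have h8 := le_of_mul_le_mul_left h7 h2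
  linarith

end IEE

namespace IEE

variable {n : ℕ} {β : ℝ}

lemma qq_beta (hβ : 0 < β) (hβ2 : β < (n:ℝ)/2) : qq n β * β / n = qq n β - 1 := by
  have h := qq_inv hβ hβ2
  have := qq_gt_one hβ hβ2
  have h0 : 0 < (n:ℝ) := by linarith
  have : 0 < qq n β := by linarith
  field_simp at h ⊢
  linarith

lemma hls_inner (hn : 1 ≤ n) (hβ : 0 < β) (hβ2 : β < (n:ℝ)/2) :
    ∃ C : ℝ, 0 ≤ C ∧ ∀ f : Euc n → ℝ, Adm n β f → (∀ x, 0 ≤ f x) → Lq n β f = 1 →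
      ∀ x, f x * ∫ y, {y | f y ≤ f x}.indicator (fun y => f y * ker n β 0 (x - y)) y
        ≤ C * f x ^ qq n β := by
  set J1 := ∫ x in Metric.ball (0 : Euc n) 1, ‖x‖ ^ (-(2*β)) with hJ1
  set J2 := ∫ x in (Metric.ball (0 : Euc n) 1)ᶜ, ‖x‖ ^ (-(2*(n:ℝ))) with hJ2
  have hn0 : 0 < (n:ℝ) := by linarith
  have hJ1p : 0 ≤ J1 := integral_nonneg (fun x => by positivity)
  have hJ2p : 0 ≤ J2 := integral_nonneg (fun x => by positivity)
  refine ⟨J1 + J2 ^ (β/n), by positivity, fun f hf hf0 hL x => ?_⟩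
  have hq := qq_gt_one hβ hβ2
  rcases (hf0 x).eq_or_lt with h | hfx
  · rw [← h, zero_mul, Real.zero_rpow (by linarith), mul_zero]
  set ρ := f x ^ (-(qq n β / n)) with hρ
  have hρ0 : 0 < ρ := Real.rpow_pos_of_pos hfx _
  set g : Euc n → ℝ := fun w => (Metric.ball (0:Euc n) ρ)ᶜ.indicator (fun w => ‖w‖ ^ (-(2*β))) w with hg
  have hgm : Measurable g :=
    (by fun_prop : Measurable (fun w : Euc n => ‖w‖ ^ (-(2*β)))).indicator measurableSet_ball.compl
  have hg0 : ∀ w, 0 ≤ g w := fun w => indicator_nonneg (fun _ _ => by positivity) _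
  have hgp : ∀ w, g w ^ ((n:ℝ)/β) = (Metric.ball (0:Euc n) ρ)ᶜ.indicator (fun w => ‖w‖ ^ (-(2*(n:ℝ)))) w := by
    intro w
    simp only [hg]
    by_cases hw : w ∈ (Metric.ball (0:Euc n) ρ)ᶜ
    · rw [indicator_of_mem hw, indicator_of_mem hw, ← Real.rpow_mul (norm_nonneg _)]
      congr 1; field_simp
    · rw [indicator_of_notMem hw, indicator_of_notMem hw, Real.zero_rpow (by positivity)]
  have hnb : 0 < (n:ℝ)/β := by positivity
  have hgpi : Integrable (fun w => g w ^ ((n:ℝ)/β)) := by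
    simp only [hgp]
    rw [integrable_indicator_iff measurableSet_ball.compl]
    exact integrableOn_compl_ball_rpow n (by linarith) hρ0
  have hmem : MemLp (fun y => g (x - y)) (ENNReal.ofReal ((n:ℝ)/β)) := by
    have hgx : Measurable (fun y => g (x - y)) := hgm.comp (measurable_const.sub measurable_id)
    rw [← integrable_norm_rpow_iff hgx.aestronglyMeasurable
      (by simpa using hnb) (by simp), ENNReal.toReal_ofReal hnb.le]
    simp only [Real.norm_of_nonneg (hg0 _)]
    exact hgpi.comp_sub_left x
  have hh := integral_mul_le_Lp_mul_Lq_of_nonneg (qq_conj hβ hβ2) (μ := volume)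
    (Eventually.of_forall hf0)
    (Eventually.of_forall (fun y : Euc n => hg0 (x - y)))
    (hf.memLp hn hβ hβ2) hmem
  have e1 : ∫ x, f x ^ qq n β = Lq n β f := by
    unfold Lq; congr 1; funext x; rw [abs_of_nonneg (hf0 x)]
  have e2 : ∫ y, g (x - y) ^ ((n:ℝ)/β) = ρ ^ (-(n:ℝ)) * J2 := by
    rw [integral_sub_left_eq_self (fun w => g w ^ ((n:ℝ)/β)) volume x]
    simp only [hgp]
    rw [integral_indicator measurableSet_ball.compl, integral_compl_ball_rpow n _ hρ0]
    congr 2; ring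
  rw [e1, hL, e2, Real.one_rpow, one_mul, Real.mul_rpow (by positivity) hJ2p, ← Real.rpow_mul hρ0.le,
    one_div_div] at hh
  set b : Euc n → ℝ := fun w => (Metric.ball (0:Euc n) ρ).indicator (fun w => ‖w‖ ^ (-(2*β))) w with hb
  have hbi : Integrable b := by
    rw [hb, integrable_indicator_iff measurableSet_ball]
    exact integrableOn_ball_rpow n hn (by linarith) ρ
  have hb0 : ∀ w, 0 ≤ b w := fun w => indicator_nonneg (fun _ _ => by positivity) _
  have hbv : ∫ y, f x * b (x - y) = f x * (ρ ^ ((n:ℝ) - 2*β) * J1) := by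
    rw [integral_const_mul, integral_sub_left_eq_self b volume x, hb,
      integral_indicator measurableSet_ball, integral_ball_rpow n _ hρ0]
  have hfg : Integrable (fun y => f y * g (x - y)) :=
    (hf.integrable hβ2).mul_bdd (c := ρ ^ (-(2*β)))
      (hgm.comp (measurable_const.sub measurable_id)).aestronglyMeasurable
      (Eventually.of_forall (fun y => by
        show ‖g (x - y)‖ ≤ _
        rw [Real.norm_of_nonneg (hg0 _)]
        simp only [hg]
        by_cases hw : x - y ∈ (Metric.ball (0:Euc n) ρ)ᶜ
        · rw [indicator_of_mem hw]
          have : ρ ≤ ‖x - y‖ := by simpa using hw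
          exact Real.rpow_le_rpow_of_nonpos hρ0 this (by linarith)
        · rw [indicator_of_notMem hw]; positivity))
  have key : ∫ y, {y | f y ≤ f x}.indicator (fun y => f y * ker n β 0 (x - y)) y
      ≤ ∫ y, (f x * b (x - y) + f y * g (x - y)) := by
    refine integral_mono_of_nonneg ?_ (((hbi.comp_sub_left x).const_mul _).add hfg) ?_
    · exact Eventually.of_forall (fun y => indicator_nonneg
        (fun y _ => mul_nonneg (hf0 y) (ker_nonneg n β le_rfl _)) _)
    · refine Eventually.of_forall (fun y => ?_)
      have hs : ker n β 0 (x - y) = b (x - y) + g (x - y) := by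
        rw [ker_zero]
        simp only [hb, hg]
        exact (indicator_self_add_compl_apply _ (fun w : Euc n => ‖w‖ ^ (-(2*β))) (x - y)).symm
      by_cases hy : f y ≤ f x
      · simp only [indicator_of_mem (show y ∈ {y | f y ≤ f x} from hy), hs]
        nlinarith [hb0 (x - y)]
      · simp only [indicator_of_notMem (show y ∉ {y | f y ≤ f x} from hy)]
        exact add_nonneg (mul_nonneg hfx.le (hb0 _)) (mul_nonneg (hf0 _) (hg0 _))
  rw [integral_add ((hbi.comp_sub_left x).const_mul _) hfg, hbv] at key
  have hqb := qq_beta hβ hβ2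
  have r1 : f x * (f x * ρ ^ ((n:ℝ) - 2*β)) = f x ^ qq n β := by
    rw [hρ, ← Real.rpow_mul hfx.le]
    nth_rw 1 [← Real.rpow_one (f x)]
    nth_rw 2 [← Real.rpow_one (f x)]
    rw [← Real.rpow_add hfx, ← Real.rpow_add hfx]
    congr 1
    have : -(qq n β / n) * ((n:ℝ) - 2*β) = - qq n β + 2 * (qq n β * β / n) := by field_simp; ring
    rw [this, hqb]; ring
  have r2 : f x * ρ ^ (-(n:ℝ) * (β / n)) = f x ^ qq n β := by
    rw [hρ, ← Real.rpow_mul hfx.le]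
    nth_rw 1 [← Real.rpow_one (f x)]
    rw [← Real.rpow_add hfx]
    congr 1
    have : -(qq n β / n) * (-(n:ℝ) * (β / n)) = (qq n β * β / n) := by field_simp
    rw [this, hqb]; ring
  calc _ ≤ f x * (f x * (ρ ^ ((n:ℝ) - 2*β) * J1) + ρ ^ (-(n:ℝ) * (β / n)) * J2 ^ (β/n)) := by
        apply mul_le_mul_of_nonneg_left _ hfx.le
        linarith
    _ = (f x * (f x * ρ ^ ((n:ℝ) - 2*β))) * J1 + (f x * ρ ^ (-(n:ℝ) * (β / n))) * J2 ^ (β/n) := by ring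
    _ = _ := by rw [r1, r2]; ring

lemma RI_nonneg {f g : Euc n → ℝ} (hf : ∀ x, 0 ≤ f x) (hg : ∀ x, 0 ≤ g x) : 0 ≤ RI n β f g :=
  integral_nonneg (fun p => mul_nonneg (mul_nonneg (hf _) (hg _)) (ker_nonneg n β le_rfl _))

lemma hls_nonsharp (hn : 1 ≤ n) (hβ : 0 < β) (hβ2 : β < (n:ℝ)/2) :
    ∃ C : ℝ, 0 ≤ C ∧ ∀ f : Euc n → ℝ, Adm n β f → (∀ x, 0 ≤ f x) → Lq n β f = 1 →
      RI n β f f ≤ C := by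
  obtain ⟨C, hC, hb⟩ := hls_inner hn hβ hβ2
  refine ⟨2 * C, by positivity, fun f hf hf0 hL => ?_⟩
  set F : Euc n × Euc n → ℝ := fun p => f p.1 * f p.2 * ker n β 0 (p.1 - p.2) with hF
  have hFi : Integrable F (volume.prod volume) := adm_prod_int hn hβ hβ2 le_rfl hf hf
  have hF0 : ∀ p, 0 ≤ F p := fun p => mul_nonneg (mul_nonneg (hf0 _) (hf0 _)) (ker_nonneg n β le_rfl _)
  set S : Set (Euc n × Euc n) := {p | f p.2 ≤ f p.1} with hS
  have hSm : MeasurableSet S := measurableSet_le (hf.1.comp measurable_snd) (hf.1.comp measurable_fst)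
  have hGi : Integrable (S.indicator F) (volume.prod volume) := hFi.indicator hSm
  have hsw : ∀ p : Euc n × Euc n, F p.swap = F p := by
    intro p
    simp only [hF, Prod.fst_swap, Prod.snd_swap]
    unfold ker
    rw [norm_sub_rev]; ring
  have h1 : RI n β f f ≤ ∫ p, (S.indicator F p + S.indicator F p.swap) ∂(volume.prod volume) := by
    unfold RI
    refine integral_mono hFi (hGi.add hGi.swap) (fun p => ?_)
    have i1 := indicator_nonneg (s := S) (fun p _ => hF0 p) p
    have i2 := indicator_nonneg (s := S) (fun p _ => hF0 p) p.swap
    rcases le_total (f p.2) (f p.1) with h | h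
    · simp only [indicator_of_mem (show p ∈ S from h)]
      simp only [hF] at i2 ⊢
      linarith
    · simp only [indicator_of_mem (show p.swap ∈ S from h), hsw]
      simp only [hF] at i1 ⊢
      linarith
  have hGs : Integrable (fun p : Euc n × Euc n => S.indicator F p.swap) (volume.prod volume) := hGi.swap
  rw [integral_add hGi hGs, integral_prod_swap (fun p => S.indicator F p), integral_prod _ hGi] at h1
  have h2 : ∫ x, ∫ y, S.indicator F (x, y) ≤ ∫ x, C * |f x| ^ qq n β := by
    refine integral_mono hGi.integral_prod_left ((hf.rpow_int hn hβ hβ2).const_mul _) (fun x => ?_)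
    simp only
    rw [abs_of_nonneg (hf0 x)]
    refine le_trans (le_of_eq ?_) (hb f hf hf0 hL x)
    rw [← integral_const_mul]
    congr 1; funext y
    by_cases hy : f y ≤ f x
    · simp only [indicator_of_mem (show y ∈ {y | f y ≤ f x} from hy), indicator_of_mem (show (x,y) ∈ S from hy), hF]
      ring
    · simp only [indicator_of_notMem (show y ∉ {y | f y ≤ f x} from hy), indicator_of_notMem (show (x,y) ∉ S from hy)]
      ring
  rw [integral_const_mul] at h2
  change _ ≤ C * Lq n β f at h2
  rw [hL] at h2
  linarith

end IEE

namespace IEE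

variable {n : ℕ} {β : ℝ}

lemma taylor_q {q u : ℝ} (hq : 1 < q) (hq2 : q < 2) (hu : |u| ≤ 1/4) :
    (1 + u) ^ q ≤ 1 + q * u + q * (q - 1) / 2 * u^2 + 20 * |u|^3 := by
  have hu' := abs_le.mp hu
  have h1u : 0 < 1 + u := by linarith
  rw [Real.rpow_def_of_pos h1u]
  have hl := Real.abs_log_sub_add_sum_range_le (x := -u) (by rw [abs_neg]; linarith) 2
  simp only [Finset.sum_range_succ, Finset.sum_range_zero, abs_neg] at hl
  set r := Real.log (1 + u) - (u - u^2/2) with hr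
  have hr' : |r| ≤ 2 * |u|^3 := by
    have e : (0 + (-u) ^ (0 + 1) / (((0:ℕ):ℝ) + 1) + (-u) ^ (1 + 1) / (((1:ℕ):ℝ) + 1) + Real.log (1 - -u)) = r := by
      rw [hr, sub_neg_eq_add]; push_cast; ring
    rw [e] at hl
    refine hl.trans ?_
    rw [div_le_iff₀ (by linarith)]
    have h3 : 0 ≤ |u|^3 := by positivity
    have h4 : |u|^3 * |u| ≤ |u|^3 * (1/4) := mul_le_mul_of_nonneg_left hu h3
    have h5 : |u|^(2+1) = |u|^3 := by norm_num
    rw [h5]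
    linarith
  set a := |u| with ha
  have ha0 : 0 ≤ a := abs_nonneg u
  have hua : u^2 = a^2 := (sq_abs u).symm
  set e := -u^2/2 + r with he
  have he' : |e| ≤ a^2 := by
    have h1 : |e| ≤ |-u^2/2| + |r| := abs_add_le _ _
    have h2 : |-u^2/2| = a^2/2 := by
      rw [abs_div, abs_neg, abs_of_nonneg (sq_nonneg u), hua]; norm_num
    nlinarith [sq_nonneg a]
  have hv : Real.log (1 + u) * q = q * (u + e) := by rw [he, hr]; ring
  rw [hv]
  have hve : |u + e| ≤ 5/4 * a := by
    have h1 : |u + e| ≤ |u| + |e| := abs_add_le _ _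
    nlinarith
  have hv1 : |q * (u + e)| ≤ 5/2 * a := by
    rw [abs_mul, abs_of_pos (by linarith : (0:ℝ) < q)]
    nlinarith [abs_nonneg (u + e)]
  have hb := Real.exp_bound (x := q * (u + e)) (by linarith) (n := 3) (by norm_num)
  simp only [Finset.sum_range_succ, Finset.sum_range_zero] at hb
  norm_num [Nat.factorial] at hb
  have hb2 := (abs_le.mp hb).2
  have hv3 : |q * (u + e)|^3 ≤ (5/2 * a)^3 := by gcongr
  rw [abs_mul] at hv3
  have hue : (u + e)^2 ≤ u^2 + 3 * a^3 := by
    have h1 : u * e ≤ a * a^2 := by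
      calc u * e ≤ |u * e| := le_abs_self _
        _ = a * |e| := by rw [abs_mul]
        _ ≤ _ := by gcongr
    have h2 : e^2 ≤ (a^2)^2 := by rw [← sq_abs e]; gcongr
    nlinarith [pow_nonneg ha0 3]
  have hre : r ≤ 2 * a^3 := (le_abs_self r).trans hr'
  have h4 : q * (u + e) + (q * (u+e))^2/2 ≤ q * u + q * (q-1)/2 * u^2 + 10 * a^3 := by
    have : (q * (u+e))^2/2 ≤ q^2/2 * u^2 + q^2/2 * (3 * a^3) := by
      have := mul_le_mul_of_nonneg_left hue (by positivity : 0 ≤ q^2/2)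
      linarith
    have h5 : q * r ≤ q * (2 * a^3) := mul_le_mul_of_nonneg_left hre (by linarith)
    have ha3 : 0 ≤ a^3 := by positivity
    have h6 : q^2 * a^3 ≤ 4 * a^3 := mul_le_mul_of_nonneg_right (by nlinarith) ha3
    have h7 : q * a^3 ≤ 2 * a^3 := mul_le_mul_of_nonneg_right hq2.le ha3
    have h8 : q * (u + e) = q * u - q * u^2/2 + q * r := by rw [he]; ring
    rw [h8] at this ⊢
    linarith
  have ha3 : 0 ≤ a^3 := by positivity
  have h9 : (5/2 * a)^3 = 125/8 * a^3 := by ring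
  rw [h9] at hv3
  linarith

lemma rpow_bern {r w : ℝ} (hr : 1 ≤ r) (hr2 : r ≤ 2) (hw : 0 ≤ w) :
    (1 + w) ^ r ≤ 1 + r * w + w^2 := by
  have h := rpow_one_add_le_one_add_mul_self (s := w) (p := r - 1) (by linarith) (by linarith) (by linarith)
  have e : (1 + w) ^ r = (1 + w) * (1 + w) ^ (r - 1) := by
    rw [Real.rpow_sub_one (by linarith)]; field_simp
  rw [e]
  nlinarith [sq_nonneg w]

lemma RI_smul (c : ℝ) (f : Euc n → ℝ) :
    RI n β (fun x => c * f x) (fun x => c * f x) = c^2 * RI n β f f := by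
  unfold RI
  rw [← integral_const_mul]; congr 1; funext p; ring

lemma Lq_smul (c : ℝ) (f : Euc n → ℝ) :
    Lq n β (fun x => c * f x) = |c| ^ qq n β * Lq n β f := by
  unfold Lq
  rw [← integral_const_mul]; congr 1; funext p
  rw [abs_mul, Real.mul_rpow (abs_nonneg _) (abs_nonneg _)]

lemma RI_zero_of_Lq_zero (hn : 1 ≤ n) (hβ : 0 < β) (hβ2 : β < (n:ℝ)/2) {f : Euc n → ℝ} (hf : Adm n β f)
    (h : Lq n β f = 0) : RI n β f f = 0 := by
  have hq := qq_gt_one hβ hβ2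
  unfold Lq at h
  rw [integral_eq_zero_iff_of_nonneg (fun x => by positivity) (hf.rpow_int hn hβ hβ2)] at h
  have h0 : ∀ᵐ x, f x = 0 := by
    filter_upwards [h] with x hx
    simp only [Pi.zero_apply] at hx
    rw [Real.rpow_eq_zero (abs_nonneg _) (by linarith)] at hx
    exact abs_eq_zero.mp hx
  rw [RI_eq hn hβ hβ2 hf hf]
  refine integral_eq_zero_of_ae ?_
  filter_upwards [h0] with x hx
  simp [hx]

lemma hom_HLS (hn : 1 ≤ n) (hβ : 0 < β) (hβ2 : β < (n:ℝ)/2) {H : ℝ}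
    (hH : ∀ f : Euc n → ℝ, Adm n β f → (∀ x, 0 ≤ f x) → Lq n β f = 1 → RI n β f f ≤ H)
    {f : Euc n → ℝ} (hf : Adm n β f) (hf0 : ∀ x, 0 ≤ f x) :
    RI n β f f ≤ H * Lq n β f ^ (2 / qq n β) := by
  have hq := qq_gt_one hβ hβ2
  rcases (Lq_nonneg (β := β) f).eq_or_lt with h | h
  · rw [← h, RI_zero_of_Lq_zero hn hβ hβ2 hf h.symm, Real.zero_rpow (by positivity), mul_zero]
  set L := Lq n β f with hL
  set c := L ^ (-(1 / qq n β)) with hc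
  have hc0 : 0 < c := Real.rpow_pos_of_pos h _
  have h1 := hH (fun x => c * f x) (hf.const_mul c) (fun x => mul_nonneg hc0.le (hf0 x)) (by
    rw [Lq_smul, abs_of_pos hc0, ← hL, hc, ← Real.rpow_mul h.le]
    rw [show -(1 / qq n β) * qq n β = -1 by field_simp, Real.rpow_neg_one]
    field_simp)
  rw [RI_smul] at h1
  have h2 : c^2 * L ^ (2 / qq n β) = 1 := by
    rw [hc, ← Real.rpow_natCast, ← Real.rpow_mul h.le, ← Real.rpow_add h]
    convert Real.rpow_zero L using 2
    push_cast; ring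
  have h3 : 0 < L ^ (2 / qq n β) := Real.rpow_pos_of_pos h _
  calc RI n β f f = (c^2 * RI n β f f) * L ^ (2 / qq n β) := by linear_combination (- RI n β f f) * h2
    _ ≤ _ := by gcongr

set_option maxHeartbeats 1600000 in
lemma near_max (hn : 1 ≤ n) (hβ : 0 < β) (hβ2 : β < (n:ℝ)/2) {H : ℝ}
    (hH : ∀ f : Euc n → ℝ, Adm n β f → (∀ x, 0 ≤ f x) → Lq n β f = 1 → RI n β f f ≤ H) :
    ∃ K : ℝ, 0 ≤ K ∧ ∀ (f : Euc n → ℝ) (δ t : ℝ), Adm n β f → (∀ x, 0 ≤ f x) → Lq n β f = 1 →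
      (∀ i, |∫ x, xi i x * f x ^ qq n β| ≤ t^3) → 0 < t → t ≤ 1/4 → 0 ≤ δ → H - δ ≤ RI n β f f →
      H - δ ≤ Hs n β + K * (δ / t^2 + t + δ) := by
  obtain ⟨C, hC, hst⟩ := stability hn hβ hβ2
  have hq := qq_gt_one hβ hβ2
  have hq2 := qq_lt_two hβ hβ2
  set q := qq n β with hqdef
  have hnb : 0 < (n:ℝ) - β := by linarith
  have hqq : ((n:ℝ) - β) * (q - 1) = β := by rw [hqdef]; unfold qq; field_simp; ring
  set N : ℝ := ((n:ℝ) - β) * (n + 1) with hN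
  have hN0 : 0 ≤ N := by positivity
  refine ⟨C * (N + N * 55 * |H| + β), by positivity, fun f δ t hf hf0 hL hcen ht ht4 hδ hHd => ?_⟩
  have hH0 : 0 ≤ H := (RI_nonneg hf0 hf0).trans (hH f hf hf0 hL)
  rw [abs_of_nonneg hH0]
  have hfqi : Integrable (fun x => f x ^ q) := by
    have := hf.rpow_int hn hβ hβ2
    simp only [abs_of_nonneg (hf0 _)] at this
    exact this
  have hfq1 : ∫ x, f x ^ q = 1 := by
    rw [← hL]; unfold Lq; congr 1; funext x; rw [abs_of_nonneg (hf0 x)]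
  set m : Option (Fin n) → ℝ := fun i => ∫ x, xi i x ^2 * f x ^ q with hm
  have hxi1 : ∀ i, Integrable (fun x => xi i x * f x ^ q) := fun i =>
    hfqi.bdd_mul (c := 1) (xi_meas i).aestronglyMeasurable (Eventually.of_forall (fun x => xi_abs_le i x))
  have hxi2 : ∀ i, Integrable (fun x => xi i x ^2 * f x ^ q) := fun i =>
    hfqi.bdd_mul (c := 1) ((xi_meas i).pow_const 2).aestronglyMeasurable
      (Eventually.of_forall (fun x => by
        rw [Real.norm_eq_abs, abs_pow]; exact pow_le_one₀ (abs_nonneg _) (xi_abs_le i x)))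
  have hmsum : ∑ i, m i = 1 := by
    simp only [hm]
    rw [← integral_finset_sum _ (fun i _ => hxi2 i), ← hfq1]
    congr 1; funext x
    rw [← Finset.sum_mul, xi_sq_sum, one_mul]
  have hm0 : ∀ i, 0 ≤ m i := fun i => integral_nonneg (fun x => mul_nonneg (sq_nonneg _) (Real.rpow_nonneg (hf0 x) _))
  have hm1 : ∀ i, m i ≤ 1 := fun i => by
    rw [← hmsum]; exact Finset.single_le_sum (fun i _ => hm0 i) (Finset.mem_univ i)
  -- perturbations
  have hLb : ∀ i (ε : ℝ), |ε| = t → RI n β (fun x => f x * (1 + ε * xi i x)) (fun x => f x * (1 + ε * xi i x))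
      ≤ H * (1 + (q - 1) * t^2 * m i + 55 * t^3) := by
    intro i ε hε
    have hu : ∀ x, |ε * xi i x| ≤ t := fun x => by
      rw [abs_mul, hε]; nlinarith [xi_abs_le i x, abs_nonneg (xi i x)]
    have hbm : BM (fun x : Euc n => 1 + ε * xi i x) :=
      ⟨by have := xi_meas i; fun_prop, 2, fun x => by
        have := abs_le.mp (hu x)
        rw [abs_le]; constructor <;> linarith [this.1, this.2]⟩
    have hp : ∀ x, 0 ≤ 1 + ε * xi i x := fun x => by have := abs_le.mp (hu x); linarith [this.1]
    have hfa := hf.BM_mul hbm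
    have h1 := hom_HLS hn hβ hβ2 hH hfa (fun x => mul_nonneg (hf0 x) (hp x))
    refine h1.trans ?_
    apply mul_le_mul_of_nonneg_left _ hH0
    have h2 : Lq n β (fun x => f x * (1 + ε * xi i x)) ≤ 1 + (q * (q-1)/2 * t^2 * m i + 21 * t^3) := by
      have h3 : Lq n β (fun x => f x * (1 + ε * xi i x)) ≤
          ∫ x, (f x ^ q + (q * ε) * (xi i x * f x ^ q) + (q * (q-1)/2 * t^2) * (xi i x ^2 * f x ^ q)
            + 20 * t^3 * f x ^ q) := by
        unfold Lq
        refine integral_mono (hfa.rpow_int hn hβ hβ2) (((hfqi.add ((hxi1 i).const_mul _)).add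
          ((hxi2 i).const_mul _)).add (hfqi.const_mul _)) (fun x => ?_)
        simp only
        rw [abs_of_nonneg (mul_nonneg (hf0 x) (hp x)), Real.mul_rpow (hf0 x) (hp x)]
        have h4 := taylor_q hq hq2 ((hu x).trans ht4)
        have h5 : |ε * xi i x|^3 ≤ t^3 := by have := hu x; gcongr
        have h6 : (ε * xi i x)^2 = t^2 * xi i x^2 := by rw [mul_pow, ← sq_abs ε, hε]
        have h7 : 0 ≤ f x ^ q := Real.rpow_nonneg (hf0 x) _
        rw [h6] at h4
        have h8 : (1 + ε * xi i x) ^ q ≤ 1 + q * (ε * xi i x) + q * (q - 1)/2 * (t^2 * xi i x^2) + 20 * t^3 := by linarith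
        have h9 := mul_le_mul_of_nonneg_left h8 h7
        refine h9.trans (le_of_eq ?_)
        ring
      have hA1 : Integrable (fun x => f x ^ q + (q * ε) * (xi i x * f x ^ q)) := hfqi.add ((hxi1 i).const_mul _)
      have hA2 : Integrable (fun x => f x ^ q + (q * ε) * (xi i x * f x ^ q) + (q * (q-1)/2 * t^2) * (xi i x ^2 * f x ^ q)) :=
        hA1.add ((hxi2 i).const_mul _)
      rw [integral_add hA2 (hfqi.const_mul _),
        integral_add hA1 ((hxi2 i).const_mul _),
        integral_add hfqi ((hxi1 i).const_mul _), integral_const_mul, integral_const_mul, integral_const_mul,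
        hfq1] at h3
      have hl1 : q * ε * ∫ x, xi i x * f x ^ q ≤ t^3 := by
        refine (le_abs_self _).trans ?_
        rw [abs_mul, abs_mul, hε, abs_of_pos (by linarith : 0 < q)]
        have h0 := abs_nonneg (∫ x, xi i x * f x ^ q)
        have h1 : q * t ≤ 1 := by nlinarith
        exact (mul_le_mul h1 (hcen i) h0 zero_le_one).trans (by rw [one_mul])
      change _ ≤ 1 + q * ε * _ + q * (q-1)/2 * t^2 * m i + 20 * t^3 * 1 at h3
      linarith
    set w := q * (q-1)/2 * t^2 * m i + 21 * t^3 with hw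
    have hq1 : 0 ≤ q * (q-1)/2 := by nlinarith
    have hmi := hm0 i
    have hw0 : 0 ≤ w := by positivity
    have hw1 : w ≤ 7 * t^2 := by
      have : q * (q-1)/2 ≤ 1 := by nlinarith
      have : q * (q-1)/2 * m i ≤ 1 := by nlinarith [hm1 i]
      have : (q * (q-1)/2 * m i) * t^2 ≤ 1 * t^2 := by gcongr
      nlinarith [sq_nonneg t]
    have h10 := rpow_bern (r := 2/q) (w := w) (by rw [le_div_iff₀ (by linarith)]; linarith)
      (by rw [div_le_iff₀ (by linarith)]; linarith) hw0
    have h11 : Lq n β (fun x => f x * (1 + ε * xi i x)) ^ (2/q) ≤ (1 + w) ^ (2/q) :=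
      Real.rpow_le_rpow (Lq_nonneg _) h2 (by positivity)
    have h12 : 2/q * w ≤ (q-1) * t^2 * m i + 42 * t^3 := by
      have : 2/q * w = (q-1) * t^2 * m i + 42/q * t^3 := by rw [hw]; field_simp; ring
      rw [this]
      have : 42/q ≤ 42 := by rw [div_le_iff₀ (by linarith)]; linarith
      have := mul_le_mul_of_nonneg_right this (by positivity : 0 ≤ t^3)
      linarith
    have h13 : w^2 ≤ 13 * t^3 := by
      have : w^2 ≤ (7 * t^2)^2 := by gcongr
      have h3 : 0 ≤ t^3 := by positivity
      nlinarith
    linarith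
  have hpar : ∀ i, RI n β (fun x => f x * (1 + t * xi i x)) (fun x => f x * (1 + t * xi i x))
      + RI n β (fun x => f x * (1 + (-t) * xi i x)) (fun x => f x * (1 + (-t) * xi i x))
      = 2 * RI n β f f + 2 * t^2 * RI n β (fun x => f x * xi i x) (fun x => f x * xi i x) := by
    intro i
    have hb : ∀ ε : ℝ, BM (fun x : Euc n => 1 + ε * xi i x) := fun ε =>
      ⟨by have := xi_meas i; fun_prop, 1 + |ε|, fun x => by
        refine (abs_add_le _ _).trans ?_
        rw [abs_one, abs_mul]
        nlinarith [xi_abs_le i x, abs_nonneg ε]⟩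
    unfold RI
    rw [← integral_add (adm_prod_int hn hβ hβ2 le_rfl (hf.BM_mul (hb _)) (hf.BM_mul (hb _)))
      (adm_prod_int hn hβ hβ2 le_rfl (hf.BM_mul (hb _)) (hf.BM_mul (hb _))), ← integral_const_mul,
      ← integral_const_mul, ← integral_add ((adm_prod_int hn hβ hβ2 le_rfl hf hf).const_mul _)
      ((adm_prod_int hn hβ hβ2 le_rfl (hf.BM_mul (BM.xi i)) (hf.BM_mul (BM.xi i))).const_mul _)]
    congr 1; funext p; ring
  have hRi : ∀ i, RI n β (fun x => f x * xi i x) (fun x => f x * xi i x)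
      ≤ δ/t^2 + 55 * H * t + H * (q-1) * m i := by
    intro i
    have a1 := hLb i t (abs_of_pos ht)
    have a2 := hLb i (-t) (by rw [abs_neg, abs_of_pos ht])
    have a3 := hpar i
    have a4 : t^2 * RI n β (fun x => f x * xi i x) (fun x => f x * xi i x) ≤
        t^2 * (δ/t^2 + 55 * H * t + H * (q-1) * m i) := by
      have : t^2 * (δ/t^2 + 55 * H * t + H * (q-1) * m i) = δ + H * ((q-1) * t^2 * m i + 55 * t^3) := by
        field_simp; ring
      rw [this]; linarith
    exact le_of_mul_le_mul_left a4 (by positivity)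
  have hsum : ∑ i, RI n β (fun x => f x * xi i x) (fun x => f x * xi i x)
      ≤ (n + 1) * (δ/t^2 + 55 * H * t) + H * (q-1) := by
    refine (Finset.sum_le_sum (fun i _ => hRi i)).trans (le_of_eq ?_)
    rw [Finset.sum_add_distrib, ← Finset.mul_sum, hmsum, Finset.sum_const, Finset.card_univ]
    simp; ring
  have hDD : DDf n β f ≤ N * (δ/t^2 + 55 * H * t) + β * δ := by
    unfold DDf
    have := mul_le_mul_of_nonneg_left hsum hnb.le
    have h2 := mul_le_mul_of_nonneg_left hHd hβ.le
    have h3 : ((n:ℝ) - β) * ((n + 1) * (δ/t^2 + 55 * H * t) + H * (q-1))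
      = N * (δ/t^2 + 55 * H * t) + H * (((n:ℝ) - β) * (q-1)) := by rw [hN]; ring
    rw [h3, hqq] at this
    linarith
  have hfin := hst f hf hf0
  rw [hL, Real.one_rpow, mul_one] at hfin
  have hd : 0 ≤ δ/t^2 := by positivity
  have h14 : N * (δ/t^2 + 55 * H * t) + β * δ ≤ (N + N * 55 * H + β) * (δ / t^2 + t + δ) := by
    have b1 : 0 ≤ N * (t + δ) := by positivity
    have b2 : 0 ≤ N * 55 * H * (δ/t^2 + δ) := by positivity
    have b3 : 0 ≤ β * (δ/t^2 + t) := by positivity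
    nlinarith
  have h15 := mul_le_mul_of_nonneg_left (hDD.trans h14) hC
  linarith

end IEE

namespace IEE

variable {n : ℕ} {β : ℝ}

lemma integral_affine (F : Euc n → ℝ) (a : Euc n) {δ : ℝ} (hδ : 0 < δ) :
    ∫ x, F (a + δ • x) = (δ ^ (n:ℝ))⁻¹ * ∫ x, F x := by
  have := Measure.integral_comp_smul (μ := (volume : Measure (Euc n))) (fun x => F (a + x)) δ
  rw [integral_add_left_eq_self F a] at this
  rw [this]
  simp only [finrank_euclideanSpace, Fintype.card_fin, smul_eq_mul]
  rw [abs_of_pos (by positivity), Real.rpow_natCast]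

/-- rescaled function -/
def rsc (n : ℕ) (β : ℝ) (a : Euc n) (δ : ℝ) (f : Euc n → ℝ) (x : Euc n) : ℝ :=
  δ ^ ((n:ℝ) - β) * f (a + δ • x)

lemma rsc_adm (hβ2 : β < (n:ℝ)/2) {f : Euc n → ℝ} (hf : Adm n β f) (a : Euc n) {δ : ℝ} (hδ : 0 < δ) :
    Adm n β (rsc n β a δ f) := by
  have hn0 : (0:ℝ) ≤ n := by positivity
  obtain ⟨hm, C, hC, hb⟩ := hf
  set K := 1 + 2 * (1 + ‖a‖^2) / δ^2 with hK
  have hK0 : 0 < K := by positivity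
  have h1 : Adm n β (fun x => f (a + δ • x)) := by
    refine ⟨hm.comp (by fun_prop), C * K ^ ((n:ℝ) - β), by positivity, fun x => (hb _).trans ?_⟩
    rw [mul_assoc]
    apply mul_le_mul_of_nonneg_left _ hC
    unfold h0
    have hp : 0 < (n:ℝ) - β := by linarith
    have h2 : (1 + ‖x‖^2) / K ≤ 1 + ‖a + δ • x‖^2 := by
      rw [div_le_iff₀ hK0]
      have h3 : ‖δ • x‖ ≤ ‖a + δ • x‖ + ‖a‖ := by
        calc ‖δ • x‖ = ‖(a + δ • x) - a‖ := by congr 1; abel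
          _ ≤ _ := norm_sub_le _ _
      rw [norm_smul, Real.norm_of_nonneg hδ.le] at h3
      set z := ‖a + δ • x‖
      have h4 : (δ * ‖x‖)^2 ≤ (z + ‖a‖)^2 := by gcongr
      have h5 : ‖x‖^2 ≤ 2 * (z^2 + ‖a‖^2) / δ^2 := by
        rw [le_div_iff₀ (by positivity)]; nlinarith [sq_nonneg (z - ‖a‖)]
      have h6 : (1 + z^2) * K = 1 + z^2 + 2 * (1 + ‖a‖^2) * (1 + z^2) / δ^2 := by rw [hK]; ring
      rw [h6]
      have h7 : 2 * (z^2 + ‖a‖^2) / δ^2 ≤ 2 * (1 + ‖a‖^2) * (1 + z^2) / δ^2 := by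
        apply div_le_div_of_nonneg_right _ (by positivity)
        nlinarith [mul_nonneg (sq_nonneg z) (sq_nonneg ‖a‖)]
      nlinarith [sq_nonneg z]
    calc (1 + ‖a + δ • x‖^2) ^ (-((n:ℝ) - β)) ≤ ((1 + ‖x‖^2) / K) ^ (-((n:ℝ) - β)) :=
          Real.rpow_le_rpow_of_nonpos (by positivity) h2 (by linarith)
      _ = K ^ ((n:ℝ) - β) * (1 + ‖x‖^2) ^ (-((n:ℝ) - β)) := by
          rw [Real.div_rpow (by positivity) hK0.le, Real.rpow_neg hK0.le, div_inv_eq_mul, mul_comm]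
  exact h1.const_mul _

lemma rsc_int (hβ : 0 < β) (hβ2 : β < (n:ℝ)/2) {f : Euc n → ℝ} (hf0 : ∀ x, 0 ≤ f x) (a : Euc n) {δ : ℝ}
    (hδ : 0 < δ) (φ : Euc n → ℝ) :
    ∫ x, φ x * rsc n β a δ f x ^ qq n β = ∫ x, φ (δ⁻¹ • (x - a)) * f x ^ qq n β := by
  have h := integral_affine (fun x => φ (δ⁻¹ • (x - a)) * f x ^ qq n β) a hδ
  have hp : 0 < δ ^ (n:ℝ) := by positivity
  rw [eq_inv_mul_iff_mul_eq₀ hp.ne'] at h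
  rw [← h, ← integral_const_mul]
  congr 1; funext x
  unfold rsc
  have hnb : 0 < (n:ℝ) - β := by linarith
  rw [Real.mul_rpow (by positivity) (hf0 _), ← Real.rpow_mul hδ.le,
    show ((n:ℝ) - β) * qq n β = n by unfold qq; field_simp]
  simp only [add_sub_cancel_left, smul_smul, inv_mul_cancel₀ hδ.ne', one_smul]
  ring

lemma rsc_RI (hn : 1 ≤ n) (hβ : 0 < β) (hβ2 : β < (n:ℝ)/2) {f : Euc n → ℝ} (hf : Adm n β f) (a : Euc n) {δ : ℝ}
    (hδ : 0 < δ) : RI n β (rsc n β a δ f) (rsc n β a δ f) = RI n β f f := by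
  rw [RI_eq hn hβ hβ2 (rsc_adm hβ2 hf a hδ) (rsc_adm hβ2 hf a hδ), RI_eq hn hβ hβ2 hf hf]
  have hp : 0 < δ ^ (n:ℝ) := by positivity
  have h1 : ∀ x, pot n β (rsc n β a δ f) 0 x = δ ^ β * pot n β f 0 (a + δ • x) := by
    intro x
    unfold pot
    have h := integral_affine (fun z => f z * ker n β 0 ((a + δ • x) - z)) a hδ
    have e : ∀ z, rsc n β a δ f z * ker n β 0 (x - z)
        = (δ ^ (β + n)) * (f (a + δ • z) * ker n β 0 ((a + δ • x) - (a + δ • z))) := by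
      intro z
      unfold rsc
      rw [ker_zero, ker_zero, add_sub_add_left_eq_sub, ← smul_sub, norm_smul, Real.norm_of_nonneg hδ.le,
        Real.mul_rpow hδ.le (norm_nonneg _)]
      have : δ ^ ((n:ℝ) - β) = δ ^ (β + n) * δ ^ (-(2*β)) := by
        rw [← Real.rpow_add hδ]; congr 1; ring
      rw [this]; ring
    simp only [e]
    rw [integral_const_mul, h, Real.rpow_add hδ]
    field_simp
  simp only [h1]
  have h := integral_affine (fun x => f x * pot n β f 0 x) a hδ
  rw [eq_inv_mul_iff_mul_eq₀ hp.ne'] at h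
  rw [← h, ← integral_const_mul]
  congr 1; funext x
  unfold rsc
  have : δ ^ (n:ℝ) = δ ^ ((n:ℝ) - β) * δ ^ β := by
    rw [← Real.rpow_add hδ]; congr 1; ring
  rw [this]; ring

/-- the log functional integrand -/
def LD (a : Euc n) (δ : ℝ) (x : Euc n) : ℝ := Real.log ((δ^2 + ‖x - a‖^2) / δ)

lemma LD_meas (a : Euc n) (δ : ℝ) : Measurable (LD a δ) := by
  unfold LD
  exact Real.measurable_log.comp (by fun_prop)

lemma LD_int (hn : 1 ≤ n) {w : Euc n → ℝ} (hw : Measurable w) {C : ℝ}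
    (hb : ∀ x, |w x| ≤ C * (1 + ‖x‖^2) ^ (-(n:ℝ))) (a : Euc n) {δ : ℝ} (hδ : 0 < δ) :
    Integrable (fun x => LD a δ x * w x) := by
  have hn1 : (1:ℝ) ≤ n := by exact_mod_cast hn
  set K := δ^2 + 2 * ‖a‖^2 + 2 with hK
  have hK0 : 0 < K := by positivity
  set c := |Real.log δ| + |Real.log (K/δ)| with hc
  have i1 := ((jbn_int hn).const_mul (c * C)).add
    ((integrable_jb n (γ := (n:ℝ) - 1/4) (by linarith)).const_mul (4 * C))
  refine i1.mono' ((LD_meas a δ).mul hw).aestronglyMeasurable (Eventually.of_forall (fun x => ?_))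
  have hD : δ^2 + ‖x - a‖^2 ≤ K * (1 + ‖x‖^2) := by
    have h1 : ‖x - a‖ ≤ ‖x‖ + ‖a‖ := norm_sub_le _ _
    have h2 : ‖x - a‖^2 ≤ (‖x‖ + ‖a‖)^2 := by gcongr
    rw [hK]
    nlinarith [sq_nonneg (‖x‖ - ‖a‖), mul_nonneg (sq_nonneg ‖x‖) (sq_nonneg ‖a‖), mul_nonneg (sq_nonneg δ) (sq_nonneg ‖x‖)]
  have hj := jb_pos x
  have hlo : Real.log δ ≤ LD a δ x := by
    unfold LD
    apply Real.log_le_log hδ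
    rw [le_div_iff₀ hδ]; nlinarith [sq_nonneg ‖x - a‖]
  have hup : LD a δ x ≤ Real.log (K/δ) + 4 * (1 + ‖x‖^2) ^ (1/4:ℝ) := by
    unfold LD
    calc _ ≤ Real.log (K/δ * (1 + ‖x‖^2)) := by
          apply Real.log_le_log (by positivity)
          rw [div_mul_eq_mul_div]
          gcongr
      _ = Real.log (K/δ) + Real.log (1 + ‖x‖^2) := Real.log_mul (by positivity) (by positivity)
      _ ≤ _ := by
          have := Real.log_le_rpow_div hj.le (by norm_num : (0:ℝ) < 1/4)
          linarith
  have hab : |LD a δ x| ≤ c + 4 * (1 + ‖x‖^2) ^ (1/4:ℝ) := by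
    have h4 : 0 ≤ 4 * (1 + ‖x‖^2) ^ (1/4:ℝ) := by positivity
    rw [abs_le]
    constructor
    · have := neg_abs_le (Real.log δ)
      have := abs_nonneg (Real.log (K/δ))
      linarith
    · have := le_abs_self (Real.log (K/δ))
      have := abs_nonneg (Real.log δ)
      linarith
  rw [Real.norm_eq_abs, abs_mul]
  simp only [Pi.add_apply]
  calc |LD a δ x| * |w x| ≤ (c + 4 * (1 + ‖x‖^2) ^ (1/4:ℝ)) * (C * (1 + ‖x‖^2) ^ (-(n:ℝ))) :=
        mul_le_mul hab (hb x) (abs_nonneg _) ((abs_nonneg _).trans hab)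
    _ = c * C * (1 + ‖x‖^2) ^ (-(n:ℝ)) + 4 * C * ((1 + ‖x‖^2) ^ (1/4:ℝ) * (1 + ‖x‖^2) ^ (-(n:ℝ))) := by ring
    _ = _ := by
        rw [← Real.rpow_add hj, show (1/4:ℝ) + -(n:ℝ) = -((n:ℝ) - 1/4) by ring]

lemma LD_bdd (hn : 1 ≤ n) {w : Euc n → ℝ} (hw : Measurable w) (hw0 : ∀ x, 0 ≤ w x) {C : ℝ}
    (hb : ∀ x, |w x| ≤ C * (1 + ‖x‖^2) ^ (-(n:ℝ))) (a : Euc n) {δ : ℝ} (hδ : 0 < δ) :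
    -(2 * C * ∫ x in Metric.ball (0 : Euc n) 1, ‖x‖ ^ (-(1/2):ℝ)) ≤ ∫ x, LD a δ x * w x := by
  have hn1 : (1:ℝ) ≤ n := by exact_mod_cast hn
  have hwC : ∀ x, w x ≤ C := fun x => by
    have h1 := (le_abs_self _).trans (hb x)
    have h2 : (1 + ‖x‖^2) ^ (-(n:ℝ)) ≤ 1 :=
      Real.rpow_le_one_of_one_le_of_nonpos (by nlinarith [sq_nonneg ‖x‖]) (by linarith)
    have h3 : 0 < (1 + ‖x‖^2) ^ (-(n:ℝ)) := Real.rpow_pos_of_pos (jb_pos x) _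
    have hC : 0 ≤ C := by
      by_contra h; push Not at h
      have := (abs_nonneg _).trans (hb x)
      nlinarith
    nlinarith
  set b : Euc n → ℝ := fun y => (Metric.ball (0:Euc n) 1).indicator (fun y => ‖y‖ ^ (-(1/2):ℝ)) y with hbd
  have hbi : Integrable b := by
    rw [hbd, integrable_indicator_iff measurableSet_ball]
    exact integrableOn_ball_rpow n hn (by linarith) 1
  have hb0 : ∀ y, 0 ≤ b y := fun y => indicator_nonneg (fun _ _ => by positivity) _
  have hv : ∫ x, (-(2*C)) * b (x - a) = -(2 * C * ∫ x in Metric.ball (0 : Euc n) 1, ‖x‖ ^ (-(1/2):ℝ)) := by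
    rw [integral_const_mul, integral_sub_right_eq_self b a, hbd, integral_indicator measurableSet_ball]; ring
  rw [← hv]
  refine integral_mono_ae ((hbi.comp_sub_right a).const_mul _) (LD_int hn hw hb a hδ) ?_
  filter_upwards [ae_ne n hn a] with x hx
  have hr : 0 < ‖x - a‖ := norm_pos_iff.mpr (sub_ne_zero.mpr (Ne.symm hx))
  set r := ‖x - a‖ with hrd
  have h1 : Real.log r ≤ LD a δ x := by
    unfold LD
    apply Real.log_le_log hr
    rw [le_div_iff₀ hδ]; nlinarith [sq_nonneg (r - δ)]
  have h2 : -(2 * b (x - a)) ≤ Real.log r := by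
    simp only [hbd]
    by_cases h : x - a ∈ Metric.ball (0:Euc n) 1
    · rw [indicator_of_mem h, ← hrd]
      have := Real.log_le_rpow_div (x := r⁻¹) (by positivity) (by norm_num : (0:ℝ) < 1/2)
      rw [Real.log_inv, Real.inv_rpow hr.le, ← Real.rpow_neg hr.le] at this
      linarith
    · rw [indicator_of_notMem h]
      have : 1 ≤ r := by simpa using h
      have := Real.log_nonneg this
      linarith
  have h3 : -(2 * b (x - a)) * w x ≤ LD a δ x * w x := mul_le_mul_of_nonneg_right (h2.trans h1) (hw0 x)
  have h4 := mul_le_mul_of_nonneg_left (hwC x) (hb0 (x - a))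
  linarith

lemma LD_var_shift (a : Euc n) {δ : ℝ} (hδ : 0 < δ) (i : Fin n) (t : ℝ) (x : Euc n) :
    LD (a + (t * δ) • EuclideanSpace.single i 1) δ x ≤
      LD a δ x + (-t * xi (some i) (δ⁻¹ • (x - a)) + 3 * t^2) := by
  set D := δ^2 + ‖x - a‖^2 with hD
  have hD0 : 0 < D := by positivity
  have hD' : δ^2 + ‖x - (a + (t * δ) • EuclideanSpace.single i 1)‖^2
      = D - 2 * t * δ * (x - a) i + t^2 * δ^2 := by
    rw [hD, ← sub_sub, @norm_sub_sq_real _ _ _ (x - a)]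
    rw [real_inner_smul_right, norm_smul, EuclideanSpace.inner_single_right]
    simp [mul_pow]; ring
  have hxi : xi (some i) (δ⁻¹ • (x - a)) = 2 * δ * (x - a) i / D := by
    simp only [xi]
    rw [norm_smul, Real.norm_of_nonneg (by positivity), hD]
    simp only [PiLp.smul_apply, smul_eq_mul]
    field_simp
  have hD'0 : 0 < D - 2 * t * δ * (x - a) i + t^2 * δ^2 := by rw [← hD']; positivity
  unfold LD
  rw [hD', ← hD, hxi]
  have h1 := Real.log_le_sub_one_of_pos (div_pos hD'0 hD0)
  rw [Real.log_div hD'0.ne' hδ.ne', Real.log_div hD0.ne' hδ.ne']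
  rw [Real.log_div hD'0.ne' hD0.ne'] at h1
  have h2 : (D - 2 * t * δ * (x - a) i + t^2 * δ^2) / D - 1 = -t * (2 * δ * (x - a) i / D) + t^2 * (δ^2 / D) := by
    field_simp; ring
  have h3 : δ^2 / D ≤ 1 := by rw [div_le_one hD0, hD]; nlinarith [sq_nonneg ‖x - a‖]
  have h4 := mul_le_mul_of_nonneg_left h3 (sq_nonneg t)
  nlinarith [sq_nonneg t]

lemma log_lower {t : ℝ} (ht : |t| ≤ 1/2) : t - 2 * t^2 ≤ Real.log (1 + t) := by
  have h := abs_le.mp ht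
  have h1 : 0 < 1 + t := by linarith
  have h2 := Real.log_le_sub_one_of_pos (inv_pos.mpr h1)
  rw [Real.log_inv] at h2
  have h3 : (1 + t)⁻¹ ≤ 1 - t + 2 * t^2 := by
    rw [inv_le_iff_one_le_mul₀ h1]
    nlinarith [sq_nonneg t]
  linarith

lemma LD_var_scale (a : Euc n) {δ : ℝ} (hδ : 0 < δ) {t : ℝ} (ht : |t| ≤ 1/2) (x : Euc n) :
    LD a (δ * (1 + t)) x ≤ LD a δ x + (t * xi none (δ⁻¹ • (x - a)) + 3 * t^2) := by
  have h := abs_le.mp ht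
  have h1t : 0 < 1 + t := by linarith
  set D := δ^2 + ‖x - a‖^2 with hD
  have hD0 : 0 < D := by positivity
  have hD' : (δ * (1 + t))^2 + ‖x - a‖^2 = D + (2 * t + t^2) * δ^2 := by rw [hD]; ring
  have hxi : xi none (δ⁻¹ • (x - a)) = 2 * δ^2 / D - 1 := by
    simp only [xi]
    rw [norm_smul, Real.norm_of_nonneg (by positivity), hD]
    field_simp; ring
  have hD'0 : 0 < D + (2 * t + t^2) * δ^2 := by rw [← hD']; positivity
  unfold LD
  rw [hD', ← hD, hxi]
  have h1 := Real.log_le_sub_one_of_pos (div_pos hD'0 hD0)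
  rw [Real.log_div hD'0.ne' (by positivity), Real.log_div hD0.ne' hδ.ne', Real.log_mul hδ.ne' h1t.ne']
  rw [Real.log_div hD'0.ne' hD0.ne'] at h1
  have h2 : (D + (2 * t + t^2) * δ^2) / D - 1 = t * (2 * δ^2 / D) + t^2 * (δ^2 / D) := by
    field_simp; ring
  have h3 : δ^2 / D ≤ 1 := by rw [div_le_one hD0, hD]; nlinarith [sq_nonneg ‖x - a‖]
  have h4 := mul_le_mul_of_nonneg_left h3 (sq_nonneg t)
  have h5 := log_lower ht
  nlinarith [sq_nonneg t]

lemma centering (hn : 1 ≤ n) (hβ : 0 < β) (hβ2 : β < (n:ℝ)/2) {f : Euc n → ℝ} (hf : Adm n β f)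
    (hf0 : ∀ x, 0 ≤ f x) (hL : Lq n β f = 1) {ε : ℝ} (hε : 0 < ε) (hε2 : ε ≤ 1/2) :
    ∃ g : Euc n → ℝ, Adm n β g ∧ (∀ x, 0 ≤ g x) ∧ Lq n β g = 1 ∧ RI n β g g = RI n β f f ∧
      ∀ i, |∫ x, xi i x * g x ^ qq n β| ≤ 4 * ε := by
  have hq := qq_gt_one hβ hβ2
  set w : Euc n → ℝ := fun x => f x ^ qq n β with hw
  have hwi : Integrable w := by
    have := hf.rpow_int hn hβ hβ2
    simp only [abs_of_nonneg (hf0 _)] at this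
    exact this
  have hw1 : ∫ x, w x = 1 := by
    rw [← hL]; unfold Lq; congr 1; funext x; rw [abs_of_nonneg (hf0 x)]
  have hw0 : ∀ x, 0 ≤ w x := fun x => Real.rpow_nonneg (hf0 x) _
  have hwm : Measurable w := hf.1.pow_const _
  obtain ⟨C, hwb⟩ : ∃ C, ∀ x, |w x| ≤ C * (1 + ‖x‖^2) ^ (-(n:ℝ)) := by
    obtain ⟨_, C, hC, hb⟩ := hf
    refine ⟨C ^ qq n β, fun x => ?_⟩
    rw [abs_of_nonneg (hw0 x), ← h0_rpow hβ hβ2, ← Real.mul_rpow hC (h0_pos n β x).le]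
    exact Real.rpow_le_rpow (hf0 x) ((le_abs_self _).trans (hb x)) (by linarith)
  set S : Set ℝ := {y | ∃ (a : Euc n) (δ : ℝ), 0 < δ ∧ y = ∫ x, LD a δ x * w x} with hS
  have hSb : BddBelow S := ⟨_, by
    rintro y ⟨a, δ, hδ, rfl⟩
    exact LD_bdd hn hwm hw0 hwb a hδ⟩
  have hSn : S.Nonempty := ⟨_, 0, 1, one_pos, rfl⟩
  obtain ⟨_, ⟨a, δ, hδ, rfl⟩, hlt⟩ := exists_lt_of_csInf_lt hSn
    (show sInf S < sInf S + ε^2 by have : 0 < ε^2 := by positivity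
                                   linarith)
  have hxm : ∀ i, Measurable (fun x : Euc n => xi i (δ⁻¹ • (x - a))) := fun i =>
    (xi_meas i).comp (by fun_prop)
  have hxw : ∀ i, Integrable (fun x => xi i (δ⁻¹ • (x - a)) * w x) := fun i =>
    hwi.bdd_mul (c := 1) (hxm i).aestronglyMeasurable (Eventually.of_forall (fun x => xi_abs_le i _))
  have hmin : ∀ i (t c : ℝ) (a' : Euc n) (δ' : ℝ), 0 < δ' →
      (∀ x, LD a' δ' x ≤ LD a δ x + (c * xi i (δ⁻¹ • (x - a)) + 3 * t^2)) →
      - ε^2 ≤ c * (∫ x, xi i (δ⁻¹ • (x - a)) * w x) + 3 * t^2 := by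
    intro i t c a' δ' hδ' hle
    have h1 : sInf S ≤ ∫ x, LD a' δ' x * w x := csInf_le hSb ⟨a', δ', hδ', rfl⟩
    have j1 : Integrable (fun x => LD a δ x * w x + c * (xi i (δ⁻¹ • (x - a)) * w x)) :=
      (LD_int hn hwm hwb a hδ).add ((hxw i).const_mul c)
    have h2 : ∫ x, LD a' δ' x * w x ≤ ∫ x, (LD a δ x * w x + c * (xi i (δ⁻¹ • (x - a)) * w x) + 3 * t^2 * w x) := by
      refine integral_mono (LD_int hn hwm hwb a' hδ') (j1.add (hwi.const_mul _)) (fun x => ?_)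
      have := mul_le_mul_of_nonneg_right (hle x) (hw0 x)
      refine this.trans (le_of_eq ?_)
      ring
    rw [integral_add j1 (hwi.const_mul _), integral_add (LD_int hn hwm hwb a hδ) ((hxw i).const_mul c),
      integral_const_mul, integral_const_mul, hw1] at h2
    linarith
  have hbound : ∀ i, |∫ x, xi i (δ⁻¹ • (x - a)) * w x| ≤ 4 * ε := by
    intro i
    have hε' : |ε| ≤ 1/2 := by rw [abs_of_pos hε]; exact hε2
    have key : -ε^2 ≤ ε * (∫ x, xi i (δ⁻¹ • (x - a)) * w x) + 3 * ε^2 ∧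
        -ε^2 ≤ (-ε) * (∫ x, xi i (δ⁻¹ • (x - a)) * w x) + 3 * ε^2 := by
      rcases i with _ | i
      · constructor
        · exact hmin none ε ε a (δ * (1 + ε)) (by positivity) (LD_var_scale a hδ hε')
        · exact hmin none ε (-ε) a (δ * (1 + -ε)) (mul_pos hδ (by linarith)) (fun x => by
            have := LD_var_scale a hδ (t := -ε) (by rw [abs_neg]; exact hε') x
            rwa [neg_sq] at this)
      · constructor
        · exact hmin (some i) ε ε _ δ hδ (fun x => by
            have := LD_var_shift a hδ i (-ε) x
            rwa [neg_sq, neg_neg] at this)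
        · exact hmin (some i) ε (-ε) _ δ hδ (fun x => LD_var_shift a hδ i ε x)
    rw [abs_le]
    constructor <;> nlinarith [key.1, key.2]
  have hg0 : ∀ x, 0 ≤ rsc n β a δ f x := fun x => mul_nonneg (by positivity) (hf0 _)
  refine ⟨rsc n β a δ f, rsc_adm hβ2 hf a hδ, hg0, ?_, rsc_RI hn hβ hβ2 hf a hδ, fun i => ?_⟩
  · have := rsc_int hβ hβ2 hf0 a hδ (fun _ => 1)
    simp only [one_mul] at this
    rw [show ∫ x, f x ^ qq n β = 1 from hw1] at this
    rw [← this]; unfold Lq; congr 1; funext x; rw [abs_of_nonneg (hg0 x)]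
  · rw [rsc_int hβ hβ2 hf0 a hδ]; exact hbound i

/-- sharp HLS inequality -/
lemma sharp_HLS (hn : 1 ≤ n) (hβ : 0 < β) (hβ2 : β < (n:ℝ)/2) {f : Euc n → ℝ} (hf : Adm n β f)
    (hf0 : ∀ x, 0 ≤ f x) : RI n β f f ≤ Hs n β * Lq n β f ^ (2 / qq n β) := by
  refine hom_HLS hn hβ hβ2 (fun f hf hf0 hL => ?_) hf hf0
  obtain ⟨C, hC, hb⟩ := hls_nonsharp hn hβ hβ2
  set S : Set ℝ := {y | ∃ f : Euc n → ℝ, Adm n β f ∧ (∀ x, 0 ≤ f x) ∧ Lq n β f = 1 ∧ y = RI n β f f} with hS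
  have hSb : BddAbove S := ⟨C, by rintro y ⟨f, h1, h2, h3, rfl⟩; exact hb f h1 h2 h3⟩
  have hSn : S.Nonempty := ⟨_, f, hf, hf0, hL, rfl⟩
  set H := sSup S with hH
  have hle : ∀ f : Euc n → ℝ, Adm n β f → (∀ x, 0 ≤ f x) → Lq n β f = 1 → RI n β f f ≤ H :=
    fun f h1 h2 h3 => le_csSup hSb ⟨f, h1, h2, h3, rfl⟩
  refine (hle f hf hf0 hL).trans ?_
  obtain ⟨K, hK, hnm⟩ := near_max hn hβ hβ2 hle
  by_contra hcon
  push Not at hcon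
  set γ := H - Hs n β with hγ
  have hγ0 : 0 < γ := by linarith
  set t := min (1/4) (γ / (4 * (K + 1))) with ht
  have ht0 : 0 < t := by positivity
  have ht4 : t ≤ 1/4 := min_le_left _ _
  have htK : K * t ≤ γ / 4 := by
    have h1 : t ≤ γ / (4 * (K + 1)) := min_le_right _ _
    rw [le_div_iff₀ (by positivity)] at h1
    nlinarith
  set δ := γ / (4 * (K / t^2 + K + 1)) with hδ
  have hδ0 : 0 < δ := by positivity
  have hδK : (K / t^2 + K + 1) * δ = γ / 4 := by rw [hδ]; field_simp
  obtain ⟨_, ⟨f1, h1, h2, h3, rfl⟩, hlt⟩ := exists_lt_of_lt_csSup hSn (show H - δ < sSup S by linarith)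
  have ht3 : 0 < t^3 := by positivity
  obtain ⟨g, g1, g2, g3, g4, g5⟩ := centering hn hβ hβ2 h1 h2 h3 (ε := t^3/4) (by positivity) (by
    have : t^3 ≤ 1 := pow_le_one₀ ht0.le (by linarith)
    linarith)
  have := hnm g δ t g1 g2 g3 (fun i => (g5 i).trans (by linarith)) ht0 ht4 hδ0.le (by rw [g4]; linarith)
  have e : K * (δ / t^2 + t + δ) = (K / t^2 + K) * δ + K * t := by ring
  rw [e] at this
  nlinarith

end IEE

namespace IEE

variable {n : ℕ} {a : ℝ}

/-- the weight measure on the half line -/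
def nu1 (a : ℝ) : Measure ℝ := (volume.restrict (Ioi 0)).withDensity (fun y => ENNReal.ofReal (y ^ a))

instance : SigmaFinite (nu1 a) := by unfold nu1; infer_instance

/-- the weighted measure on the half space -/
def mu (n : ℕ) (a : ℝ) : Measure (Euc n × ℝ) := volume.prod (nu1 a)

instance : SigmaFinite (mu n a) := by unfold mu; infer_instance

lemma wt_meas (a : ℝ) : Measurable (fun y : ℝ => ENNReal.ofReal (y ^ a)) := by fun_prop

lemma integral_nu1 (g : ℝ → ℝ) : ∫ y, g y ∂(nu1 a) = ∫ y in Ioi (0:ℝ), y ^ a * g y := by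
  unfold nu1
  rw [integral_withDensity_eq_integral_toReal_smul (wt_meas a) (Eventually.of_forall (fun y => ENNReal.ofReal_lt_top))]
  refine setIntegral_congr_fun measurableSet_Ioi (fun y hy => ?_)
  have : 0 ≤ y ^ a := Real.rpow_nonneg (le_of_lt hy) _
  simp [ENNReal.toReal_ofReal this]

lemma integrable_nu1 (g : ℝ → ℝ) :
    Integrable g (nu1 a) ↔ IntegrableOn (fun y => y ^ a * g y) (Ioi (0:ℝ)) := by
  unfold nu1
  rw [integrable_withDensity_iff_integrable_smul' (wt_meas a) (Eventually.of_forall (fun y => ENNReal.ofReal_lt_top))]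
  refine integrableOn_congr_fun (fun y hy => ?_) measurableSet_Ioi
  have : 0 ≤ y ^ a := Real.rpow_nonneg (le_of_lt hy) _
  simp [ENNReal.toReal_ofReal this]

lemma nu1_ae_pos : ∀ᵐ y ∂(nu1 a), 0 < y := by
  unfold nu1
  exact (withDensity_absolutelyContinuous _ _).ae_le (ae_restrict_mem measurableSet_Ioi)

lemma mu_ae_pos : ∀ᵐ p ∂(mu n a), 0 < p.2 := by
  unfold mu
  exact Measure.quasiMeasurePreserving_snd.ae nu1_ae_pos

lemma integral_mu {F : Euc n × ℝ → ℝ} (hF : Integrable F (mu n a)) :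
    ∫ p, F p ∂(mu n a) = ∫ x, ∫ y in Ioi (0:ℝ), y ^ a * F (x, y) := by
  unfold mu at hF ⊢
  rw [integral_prod _ hF]
  simp only [integral_nu1]

lemma nu1_Ioc_int (ha : -1 < a) {α : ℝ} (hα : α < 1 + a) (r : ℝ) :
    Integrable (indicator (Iio r) (fun y : ℝ => y ^ (-α))) (nu1 a) := by
  rw [integrable_nu1]
  have h1 : IntegrableOn (fun y : ℝ => y ^ (a - α)) (Ioo 0 r) := by
    rcases le_or_gt r 0 with hr | hr
    · simp [Ioo_eq_empty_of_le hr]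
    have := (intervalIntegral.intervalIntegrable_rpow' (a := 0) (b := r) (r := a - α) (by linarith))
    rw [intervalIntegrable_iff_integrableOn_Ioo_of_le hr.le] at this
    exact this
  have h2 : (fun y : ℝ => y ^ a * indicator (Iio r) (fun y : ℝ => y ^ (-α)) y)
      = indicator (Iio r) (fun y : ℝ => y ^ a * y ^ (-α)) := by
    funext y
    by_cases hy : y ∈ Iio r
    · simp [indicator_of_mem hy]
    · simp [indicator_of_notMem hy]
  rw [h2, IntegrableOn, integrable_indicator_iff measurableSet_Iio, IntegrableOn,
    Measure.restrict_restrict measurableSet_Iio]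
  have : Iio r ∩ Ioi 0 = Ioo 0 r := by ext y; simp [and_comm]
  rw [this]
  refine h1.congr_fun (fun y hy => ?_) measurableSet_Ioo
  simp only
  rw [sub_eq_add_neg, Real.rpow_add hy.1]

lemma nu1_Ioc_val (ha : -1 < a) {α : ℝ} (hα : α < 1 + a) {r : ℝ} (hr : 0 < r) :
    ∫ y, (indicator (Iio r) (fun y : ℝ => y ^ (-α))) y ∂(nu1 a) = r ^ (1 + a - α) / (1 + a - α) := by
  rw [integral_nu1]
  have h2 : (fun y : ℝ => y ^ a * indicator (Iio r) (fun y : ℝ => y ^ (-α)) y)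
      = indicator (Iio r) (fun y : ℝ => y ^ a * y ^ (-α)) := by
    funext y
    by_cases hy : y ∈ Iio r
    · simp [indicator_of_mem hy]
    · simp [indicator_of_notMem hy]
  rw [h2, integral_indicator measurableSet_Iio, Measure.restrict_restrict measurableSet_Iio]
  have : Iio r ∩ Ioi 0 = Ioo 0 r := by ext y; simp [and_comm]
  rw [this, setIntegral_congr_fun (g := fun y : ℝ => y ^ (a - α)) measurableSet_Ioo (fun y hy => by
    simp only; rw [sub_eq_add_neg, Real.rpow_add hy.1]), ← integral_Ioc_eq_integral_Ioo,
    ← intervalIntegral.integral_of_le hr.le, integral_rpow (Or.inl (by linarith)), Real.zero_rpow (by linarith)]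
  rw [sub_zero, show a - α + 1 = 1 + a - α by ring]

lemma nu1_jb_int (ha : -1 < a) {γ : ℝ} (hγ : 1 + a < 2 * γ) :
    Integrable (fun y : ℝ => (1 + y^2) ^ (-γ)) (nu1 a) := by
  rw [integrable_nu1]
  have h1 : IntegrableOn (fun y : ℝ => y ^ a) (Ioc 0 1) := by
    have := (intervalIntegral.intervalIntegrable_rpow' (a := 0) (b := 1) (r := a) (by linarith))
    rwa [intervalIntegrable_iff_integrableOn_Ioc_of_le zero_le_one] at this
  have h2 : IntegrableOn (fun y : ℝ => y ^ (a - 2 * γ)) (Ioi 1) :=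
    integrableOn_Ioi_rpow_of_lt (by linarith) one_pos
  have hm : Measurable (fun y : ℝ => y ^ a * (1 + y^2) ^ (-γ)) := by fun_prop
  have hγ0 : 0 < γ := by linarith
  rw [← Ioc_union_Ioi_eq_Ioi zero_le_one]
  refine IntegrableOn.union ?_ ?_
  · refine h1.mono' hm.aestronglyMeasurable ((ae_restrict_mem measurableSet_Ioc).mono (fun y hy => ?_))
    have hy0 := hy.1
    rw [Real.norm_of_nonneg (by positivity)]
    have : (1 + y^2) ^ (-γ) ≤ 1 :=
      Real.rpow_le_one_of_one_le_of_nonpos (by nlinarith) (by linarith)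
    exact mul_le_of_le_one_right (by positivity) this
  · refine h2.mono' hm.aestronglyMeasurable ((ae_restrict_mem measurableSet_Ioi).mono (fun y hy => ?_))
    have hy0 : 0 < y := lt_trans one_pos hy
    rw [Real.norm_of_nonneg (by positivity), sub_eq_add_neg, Real.rpow_add hy0]
    have : (1 + y^2) ^ (-γ) ≤ (y^2) ^ (-γ) :=
      Real.rpow_le_rpow_of_nonpos (by positivity) (by linarith) (by linarith)
    have e : (y^2) ^ (-γ) = y ^ (-(2 * γ)) := by
      rw [← Real.rpow_natCast, ← Real.rpow_mul hy0.le]; congr 1; push_cast; ring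
    rw [e] at this
    gcongr

/-- the squared Euclidean length on the product -/
def sq (p : Euc n × ℝ) : ℝ := ‖p.1‖^2 + p.2^2

lemma sq_nonneg' (p : Euc n × ℝ) : 0 ≤ sq p := by unfold sq; positivity

lemma sq_cont : Continuous (sq : Euc n × ℝ → ℝ) := by unfold sq; fun_prop

lemma mu_jb_int (ha : -1 < a) {γ : ℝ} (hγ : (n:ℝ) + 1 + a < 2 * γ) :
    Integrable (fun p : Euc n × ℝ => (1 + sq p) ^ (-γ)) (mu n a) := by
  set e := (2 * γ - ((n:ℝ) + 1 + a)) / 4 with he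
  have he0 : 0 < e := by rw [he]; linarith
  have h1 := integrable_jb n (γ := (n:ℝ)/2 + e) (by linarith)
  have h2 := nu1_jb_int (a := a) (γ := (1 + a)/2 + e) ha (by linarith)
  refine (h1.mul_prod h2).mono' ?_ (Eventually.of_forall (fun p => ?_))
  · have : Continuous (fun p : Euc n × ℝ => (1 + sq p) ^ (-γ)) :=
      Continuous.rpow_const (by have := sq_cont (n := n); fun_prop) (fun p => Or.inl (by have := sq_nonneg' p; positivity))
    exact this.aestronglyMeasurable
  · have hs := sq_nonneg' p
    have hn0 : (0:ℝ) ≤ n := by positivity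
    rw [Real.norm_of_nonneg (by positivity)]
    have : -γ = -((n:ℝ)/2 + e) + -((1 + a)/2 + e) := by rw [he]; ring
    rw [this, Real.rpow_add (by positivity)]
    unfold sq
    gcongr ?_ * ?_
    · apply Real.rpow_le_rpow_of_nonpos (by positivity) (by nlinarith [_root_.sq_nonneg p.2]) (by linarith)
    · apply Real.rpow_le_rpow_of_nonpos (by positivity) (by nlinarith [_root_.sq_nonneg ‖p.1‖]) (by linarith)

lemma mu_box_lt_top (ha : -1 < a) (r : ℝ) : mu n a (Metric.ball 0 r) < ⊤ := by
  have h := nu1_Ioc_int (a := a) ha (α := 0) (by linarith) r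
  have h2 : (nu1 a) (Iio r) < ⊤ := by
    simp only [neg_zero, Real.rpow_zero] at h
    rw [integrable_indicator_iff measurableSet_Iio] at h
    have := integrableOn_const_iff (C := (1:ℝ)) (s := Iio r) (μ := nu1 a) |>.mp h
    simpa using this
  refine lt_of_le_of_lt (measure_mono (t := Metric.ball (0: Euc n) r ×ˢ Iio r) ?_) ?_
  · intro p hp
    have hp' : ‖p‖ < r := by simpa using hp
    refine ⟨by simpa using (norm_fst_le p).trans_lt hp', ?_⟩
    have := (norm_snd_le p).trans_lt hp'
    exact (le_abs_self _).trans_lt this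
  · unfold mu
    rw [Measure.prod_prod]
    exact ENNReal.mul_lt_top measure_ball_lt_top h2

lemma mu_cpt_int (ha : -1 < a) {F : Euc n × ℝ → ℝ} (hF : Continuous F) {K : Set (Euc n × ℝ)} (hK : IsCompact K)
    (h : ∀ p, 0 < p.2 → p ∉ K → F p = 0) : Integrable F (mu n a) := by
  have hKf : mu n a K < ⊤ := by
    obtain ⟨r, hr⟩ := hK.isBounded.subset_ball 0
    exact (measure_mono hr).trans_lt (mu_box_lt_top ha r)
  have h1 : Integrable (K.indicator F) (mu n a) := by
    rw [integrable_indicator_iff hK.measurableSet]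
    obtain ⟨M, hM⟩ := hK.exists_bound_of_continuousOn hF.continuousOn
    exact Measure.integrableOn_of_bounded hKf.ne hF.aestronglyMeasurable
      ((ae_restrict_mem hK.measurableSet).mono hM)
  refine h1.congr ?_
  filter_upwards [mu_ae_pos] with p hp
  by_cases hpK : p ∈ K
  · rw [indicator_of_mem hpK]
  · rw [indicator_of_notMem hpK, h p hp hpK]

lemma mu_scale {F : Euc n × ℝ → ℝ} {r : ℝ} (hr : 0 < r) (hF : Integrable F (mu n a))
    (hF2 : Integrable (fun p => F (r • p)) (mu n a)) :
    ∫ p, F (r • p) ∂(mu n a) = r ^ (-((n:ℝ) + 1 + a)) * ∫ p, F p ∂(mu n a) := by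
  rw [integral_mu hF, integral_mu hF2]
  have h1 : ∀ x : Euc n, ∫ y in Ioi (0:ℝ), y ^ a * F (r • (x, y))
      = r ^ (-(1 + a)) * ∫ y in Ioi (0:ℝ), y ^ a * F (r • x, y) := by
    intro x
    have := integral_comp_mul_left_Ioi (fun y => y ^ a * F (r • x, y)) 0 hr
    rw [mul_zero] at this
    have e : ∀ y ∈ Ioi (0:ℝ), y ^ a * F (r • (x, y)) = r ^ (-a) * ((r * y) ^ a * F (r • x, r * y)) := by
      intro y hy
      have hy0 : (0:ℝ) < y := hy
      rw [Real.mul_rpow hr.le hy0.le, Real.rpow_neg hr.le, Prod.smul_mk, smul_eq_mul]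
      have := Real.rpow_pos_of_pos hr a
      field_simp
    rw [setIntegral_congr_fun measurableSet_Ioi e, integral_const_mul, this, smul_eq_mul, ← mul_assoc,
      neg_add, Real.rpow_add hr, Real.rpow_neg_one]
    ring
  simp only [h1]
  rw [integral_const_mul, Measure.integral_comp_smul volume (fun x => ∫ y in Ioi (0:ℝ), y ^ a * F (x, y)) r]
  simp only [finrank_euclideanSpace, Fintype.card_fin, smul_eq_mul]
  rw [abs_of_pos (by positivity), ← mul_assoc, ← Real.rpow_natCast, ← Real.rpow_neg hr.le, ← Real.rpow_add hr]
  congr 2; ring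

lemma mu_trans_pres (z : Euc n) : MeasurePreserving (fun p : Euc n × ℝ => (p.1 + z, p.2)) (mu n a) (mu n a) :=
  (measurePreserving_add_right volume z).prod (MeasurePreserving.id _)

lemma trans_emb (z : Euc n) : MeasurableEmbedding (fun p : Euc n × ℝ => (p.1 + z, p.2)) :=
  ((Homeomorph.addRight z).prodCongr (Homeomorph.refl ℝ)).measurableEmbedding

lemma mu_trans (F : Euc n × ℝ → ℝ) (z : Euc n) :
    ∫ p, F (p.1 + z, p.2) ∂(mu n a) = ∫ p, F p ∂(mu n a) :=
  (mu_trans_pres z).integral_comp (trans_emb z) F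

lemma mu_trans_int {F : Euc n × ℝ → ℝ} (z : Euc n) (h : Integrable F (mu n a)) :
    Integrable (fun p => F (p.1 + z, p.2)) (mu n a) :=
  (mu_trans_pres z).integrable_comp_of_integrable h

end IEE

namespace IEE
variable {n : ℕ} {a β : ℝ}

/-- coordinate directions of the half space -/
def bb (n : ℕ) : Option (Fin n) → Euc n × ℝ
  | none => (0, 1)
  | some i => (EuclideanSpace.single i 1, 0)

def crd (p : Euc n × ℝ) : Option (Fin n) → ℝ
  | none => p.2
  | some i => p.1 i

def gr (F : Euc n × ℝ → ℝ) (p : Euc n × ℝ) (k : Option (Fin n)) : ℝ := fderiv ℝ F p (bb n k)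

def gip (F G : Euc n × ℝ → ℝ) (p : Euc n × ℝ) : ℝ := ∑ k, gr F p k * gr G p k

lemma sum_crd (p : Euc n × ℝ) : ∑ k, crd p k • bb n k = p := by
  rw [Fintype.sum_option]
  have : ∑ i : Fin n, p.1 i • (EuclideanSpace.single i (1:ℝ)) = p.1 := by
    ext j
    simp [Finset.sum_apply, Pi.single_apply]
  simp only [crd, bb]
  ext1
  · simp [Prod.fst_sum, this]
  · simp [Prod.snd_sum]

lemma sq_crd (p : Euc n × ℝ) : sq p = ∑ k, crd p k ^ 2 := by
  rw [Fintype.sum_option]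
  simp only [crd, sq, EuclideanSpace.real_norm_sq_eq]
  ring

lemma sq_contDiff : ContDiff ℝ (⊤ : ℕ∞) (sq : Euc n × ℝ → ℝ) := by
  unfold sq
  exact (contDiff_fst.norm_sq ℝ).add (contDiff_snd.pow 2)

lemma sq_hasFDeriv (p : Euc n × ℝ) :
    ∃ L : Euc n × ℝ →L[ℝ] ℝ, HasFDerivAt (sq : Euc n × ℝ → ℝ) L p ∧ (∀ k, L (bb n k) = 2 * crd p k) ∧ L p = 2 * sq p := by
  have h1 : HasFDerivAt (fun p : Euc n × ℝ => ‖p.1‖^2) _ p := (hasFDerivAt_fst (𝕜 := ℝ) (p := p)).norm_sq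
  have h2 : HasFDerivAt (fun p : Euc n × ℝ => p.2^2) _ p := (hasFDerivAt_snd (𝕜 := ℝ) (p := p)).pow 2
  refine ⟨_, h1.add h2, ?_, ?_⟩
  · intro k
    cases k with
    | none => simp [bb, crd]
    | some i => simp [bb, crd, EuclideanSpace.inner_single_right]
  · simp [sq, ]
    ring

lemma rpow_sq_hasFDeriv {c : ℝ} (hc : 0 < c) (γ : ℝ) (p : Euc n × ℝ) :
    ∃ L : Euc n × ℝ →L[ℝ] ℝ, HasFDerivAt (fun p : Euc n × ℝ => (sq p + c) ^ γ) L p ∧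
      (∀ k, L (bb n k) = 2 * γ * (sq p + c) ^ (γ - 1) * crd p k) ∧ L p = 2 * γ * (sq p + c) ^ (γ - 1) * sq p := by
  obtain ⟨L, h1, h2, h3⟩ := sq_hasFDeriv p
  have hpos : 0 < sq p + c := by have := sq_nonneg' p; linarith
  refine ⟨_, (h1.add_const c).rpow_const (p := γ) (Or.inl hpos.ne'), ?_, ?_⟩
  · intro k; simp [h2]; ring
  · simp [h3]; ring

lemma rpow_sq_contDiff {c : ℝ} (hc : 0 < c) (γ : ℝ) :
    ContDiff ℝ (⊤ : ℕ∞) (fun p : Euc n × ℝ => (sq p + c) ^ γ) := by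
  refine (sq_contDiff.add contDiff_const).rpow_const_of_ne (fun p => ?_)
  have := sq_nonneg' p; positivity

lemma dilation (ha : -1 < a) {ψ : Euc n × ℝ → ℝ} (hψ : ContDiff ℝ 1 ψ) (hc : HasCompactSupport ψ) :
    ∫ p, fderiv ℝ ψ p p ∂(mu n a) = -((n:ℝ) + 1 + a) * ∫ p, ψ p ∂(mu n a) := by
  obtain ⟨R, hR⟩ := hc.isCompact.isBounded.subset_closedBall (0: Euc n × ℝ)
  have hsupp : ∀ q : Euc n × ℝ, R < ‖q‖ → q ∉ tsupport ψ := by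
    intro q hq hm
    have := hR hm
    simp at this; linarith
  have hdc : Continuous (fderiv ℝ ψ) := hψ.continuous_fderiv (by norm_num)
  have hdcs : HasCompactSupport (fderiv ℝ ψ) := hc.fderiv ℝ
  obtain ⟨M, hM⟩ := hdcs.exists_bound_of_continuous hdc
  have hM0 : 0 ≤ M := (norm_nonneg _).trans (hM 0)
  have hIntg : ∀ r : ℝ, r ∈ Ioo (1/2:ℝ) (3/2) → Integrable (fun p => ψ (r • p)) (mu n a) := by
    intro r hr
    refine mu_cpt_int ha (hψ.continuous.comp (continuous_const_smul r)) (isCompact_closedBall 0 (2*R)) ?_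
    intro p _ hp
    apply image_eq_zero_of_notMem_tsupport
    apply hsupp
    rw [norm_smul, Real.norm_eq_abs, abs_of_pos (by linarith [hr.1])]
    simp at hp
    nlinarith [hr.1, norm_nonneg p]
  have hI : Integrable ψ (mu n a) := by simpa using hIntg 1 (by norm_num)
  have hder := hasDerivAt_integral_of_dominated_loc_of_deriv_le (μ := mu n a) (F := fun r p => ψ (r • p))
    (F' := fun r p => fderiv ℝ ψ (r • p) p) (x₀ := (1:ℝ)) (s := Ioo (1/2:ℝ) (3/2))
    (bound := (Metric.closedBall 0 (2*R)).indicator (fun _ => M * (2*R)))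
    (Ioo_mem_nhds (by norm_num) (by norm_num))
    (Filter.Eventually.of_forall (fun r => (hψ.continuous.comp (continuous_const_smul r)).aestronglyMeasurable))
    (hIntg 1 (by norm_num))
    ((hdc.comp (continuous_const_smul (1:ℝ))).clm_apply continuous_id).aestronglyMeasurable
    (Filter.Eventually.of_forall (fun p r hr => by
      by_cases hp : p ∈ Metric.closedBall (0 : Euc n × ℝ) (2*R)
      · rw [indicator_of_mem hp]
        refine (ContinuousLinearMap.le_opNorm _ _).trans ?_
        simp at hp
        exact mul_le_mul (hM _) hp (norm_nonneg _) hM0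
      · rw [indicator_of_notMem hp]
        have : r • p ∉ tsupport ψ := by
          apply hsupp
          rw [norm_smul, Real.norm_eq_abs, abs_of_pos (by linarith [hr.1])]
          simp at hp
          nlinarith [hr.1, norm_nonneg p]
        have h0 : fderiv ℝ ψ (r • p) = 0 := by
          by_contra h
          exact this (support_fderiv_subset ℝ h)
        simp [h0]))
    (by
      rw [integrable_indicator_iff Metric.isClosed_closedBall.measurableSet]
      refine integrableOn_const ?_
      exact ((measure_mono (Metric.closedBall_subset_ball (by linarith : 2*R < 2*R+1))).trans_lt (mu_box_lt_top ha _)).ne)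
    (Filter.Eventually.of_forall (fun p r hr => by
      have h1 : HasFDerivAt ψ (fderiv ℝ ψ (r • p)) (r • p) := (hψ.differentiable (by norm_num) _).hasFDerivAt
      have h2 : HasDerivAt (fun r : ℝ => r • p) p r := by simpa using (hasDerivAt_id r).smul_const p
      exact h1.comp_hasDerivAt r h2))
  have h1 := hder.2
  simp only [one_smul] at h1
  have h2 : HasDerivAt (fun r : ℝ => r ^ (-((n:ℝ) + 1 + a)) * ∫ p, ψ p ∂(mu n a))
      (-((n:ℝ) + 1 + a) * (∫ p, ψ p ∂(mu n a))) 1 := by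
    have := (Real.hasDerivAt_rpow_const (x := 1) (p := -((n:ℝ) + 1 + a)) (Or.inl one_ne_zero)).mul_const (∫ p, ψ p ∂(mu n a))
    simpa using this
  refine h1.unique (h2.congr_of_eventuallyEq ?_)
  filter_upwards [Ioo_mem_nhds (show (1/2:ℝ) < 1 by norm_num) (show (1:ℝ) < 3/2 by norm_num)] with r hr
  exact mu_scale (by linarith [hr.1]) hI (hIntg r hr)

def Phi (n : ℕ) (β τ : ℝ) (p : Euc n × ℝ) : ℝ := (sq p + τ^2) ^ (-β)
def rho (n : ℕ) (β τ : ℝ) (p : Euc n × ℝ) : ℝ := 4 * β * (β + 1) * τ^2 * (sq p + τ^2) ^ (-β - 2)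

lemma Phi_contDiff {τ : ℝ} (hτ : 0 < τ) : ContDiff ℝ (⊤ : ℕ∞) (Phi n β τ) :=
  rpow_sq_contDiff (by positivity) _

lemma rho_cont {τ : ℝ} (hτ : 0 < τ) : Continuous (rho n β τ) :=
  continuous_const.mul (rpow_sq_contDiff (by positivity) _).continuous

lemma fderiv_eq_sum (F : Euc n × ℝ → ℝ) (p : Euc n × ℝ) : fderiv ℝ F p p = ∑ k, gr F p k * crd p k := by
  have h : fderiv ℝ F p p = fderiv ℝ F p (∑ k, crd p k • bb n k) := by rw [sum_crd p]
  rw [h, map_sum]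
  simp [gr, mul_comm]

lemma gip_Phi (φ : Euc n × ℝ → ℝ) {τ : ℝ} (hτ : 0 < τ) (p : Euc n × ℝ) :
    gip φ (Phi n β τ) p = -(2 * β) * ((sq p + τ^2) ^ (-β - 1) * fderiv ℝ φ p p) := by
  obtain ⟨L, h1, h2, h3⟩ := rpow_sq_hasFDeriv (n := n) (c := τ^2) (by positivity) (-β) p
  have : ∀ k, gr (Phi n β τ) p k = 2 * -β * (sq p + τ^2) ^ (-β - 1) * crd p k := by
    intro k; unfold gr Phi; rw [h1.fderiv, h2]
  unfold gip
  rw [fderiv_eq_sum, Finset.mul_sum, Finset.mul_sum]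
  refine Finset.sum_congr rfl fun k _ => ?_
  rw [this]; ring

lemma ibp0 (ha : -1 < a) (hab : (n:ℝ) + 1 + a = 2 * β + 2) {φ : Euc n × ℝ → ℝ} (hφ : ContDiff ℝ 1 φ)
    (hc : HasCompactSupport φ) {τ : ℝ} (hτ : 0 < τ) :
    ∫ p, gip φ (Phi n β τ) p ∂(mu n a) = ∫ p, φ p * rho n β τ p ∂(mu n a) := by
  have hτ2 : 0 < τ^2 := by positivity
  set ψ : Euc n × ℝ → ℝ := fun p => (sq p + τ^2) ^ (-β - 1) * φ p with hψd
  have hw : ContDiff ℝ 1 (fun p : Euc n × ℝ => (sq p + τ^2) ^ (-β - 1)) := (rpow_sq_contDiff hτ2 _).of_le (by exact_mod_cast le_top)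
  have hw2 : Continuous (fun p : Euc n × ℝ => (sq p + τ^2) ^ (-β - 2)) := (rpow_sq_contDiff hτ2 _).continuous
  have hψ : ContDiff ℝ 1 ψ := hw.mul hφ
  have hψc : HasCompactSupport ψ := hc.mul_left
  have hz : ∀ p, p ∉ tsupport φ → φ p = 0 := fun p hp => image_eq_zero_of_notMem_tsupport hp
  have hz' : ∀ p, p ∉ tsupport φ → fderiv ℝ φ p = 0 := fun p hp => by
    by_contra h; exact hp (support_fderiv_subset ℝ h)
  have hdc : Continuous (fderiv ℝ φ) := hφ.continuous_fderiv (by norm_num)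
  have hA : Integrable (fun p => (sq p + τ^2) ^ (-β - 1) * fderiv ℝ φ p p) (mu n a) :=
    mu_cpt_int ha (hw.continuous.mul (hdc.clm_apply continuous_id)) hc.isCompact (fun p _ hp => by simp [hz' p hp])
  have hB : Integrable (fun p => (sq p + τ^2) ^ (-β - 1) * φ p) (mu n a) :=
    mu_cpt_int ha (hw.continuous.mul hφ.continuous) hc.isCompact (fun p _ hp => by simp [hz p hp])
  have hC : Integrable (fun p => (sq p + τ^2) ^ (-β - 2) * φ p) (mu n a) :=
    mu_cpt_int ha (hw2.mul hφ.continuous) hc.isCompact (fun p _ hp => by simp [hz p hp])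
  have hd : ∀ p, fderiv ℝ ψ p p = (sq p + τ^2) ^ (-β - 1) * fderiv ℝ φ p p
      + (-(2 * (β + 1)) * ((sq p + τ^2) ^ (-β - 1) * φ p) + 2 * (β+1) * τ^2 * ((sq p + τ^2) ^ (-β - 2) * φ p)) := by
    intro p
    obtain ⟨L, h1, h2, h3⟩ := rpow_sq_hasFDeriv (n := n) hτ2 (-β - 1) p
    have hp : 0 < sq p + τ^2 := by have := sq_nonneg' p; linarith
    have := (h1.mul (hφ.differentiable (by norm_num) p).hasFDerivAt).fderiv
    change fderiv ℝ ψ p = _ at this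
    rw [this]
    have e : (sq p + τ^2) ^ (-β - 1) = (sq p + τ^2) ^ (-β - 2) * (sq p + τ^2) := by
      rw [← Real.rpow_add_one hp.ne']; congr 1; ring
    simp only [ContinuousLinearMap.add_apply, ContinuousLinearMap.smul_apply, smul_eq_mul, h3]
    rw [show -β - 1 - 1 = -β - 2 by ring, e]; ring
  have h := dilation ha hψ hψc
  simp only [hd] at h
  have hBC : Integrable (fun p => -(2 * (β + 1)) * ((sq p + τ^2) ^ (-β - 1) * φ p) + 2 * (β+1) * τ^2 * ((sq p + τ^2) ^ (-β - 2) * φ p)) (mu n a) :=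
    (hB.const_mul _).add (hC.const_mul _)
  rw [integral_add hA hBC, integral_add (hB.const_mul _) (hC.const_mul _),
    integral_const_mul, integral_const_mul] at h
  simp only [gip_Phi φ hτ]
  rw [integral_const_mul]
  have e2 : ∀ p, φ p * rho n β τ p = 4 * β * (β+1) * τ^2 * ((sq p + τ^2) ^ (-β - 2) * φ p) := by
    intro p; unfold rho; ring
  simp only [e2]
  rw [integral_const_mul]
  rw [hab] at h
  have h' : ∫ p, (sq p + τ^2) ^ (-β - 1) * fderiv ℝ φ p p ∂(mu n a)
     = - (2 * (β+1) * τ^2 * ∫ p, (sq p + τ^2) ^ (-β - 2) * φ p ∂(mu n a)) := by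
    have : ∫ p, ψ p ∂(mu n a) = ∫ p, (sq p + τ^2) ^ (-β - 1) * φ p ∂(mu n a) := rfl
    rw [this] at h
    linarith
  rw [h']; ring

def sh (z : Euc n) (p : Euc n × ℝ) : Euc n × ℝ := (p.1 - z, p.2)

lemma gr_sh (F : Euc n × ℝ → ℝ) (z : Euc n) (p : Euc n × ℝ) (k) :
    gr (fun q => F (sh z q)) p k = gr F (sh z p) k := by
  unfold gr
  have h : (fun q => F (sh z q)) = fun q => F (q - (z, 0)) := by
    funext q; congr 1; ext1 <;> simp [sh]
  have h2 : sh z p = p - (z, 0) := by ext1 <;> simp [sh]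
  rw [h, h2, fderiv_comp_sub]

lemma ibp1 (ha : -1 < a) (hab : (n:ℝ) + 1 + a = 2 * β + 2) {φ : Euc n × ℝ → ℝ} (hφ : ContDiff ℝ 1 φ)
    (hc : HasCompactSupport φ) {τ : ℝ} (hτ : 0 < τ) (z : Euc n) :
    ∫ p, (∑ k, gr φ p k * gr (Phi n β τ) (sh z p) k) ∂(mu n a)
      = ∫ p, φ (p.1 + z, p.2) * rho n β τ p ∂(mu n a) := by
  rw [← mu_trans _ z]
  have hφ' : ContDiff ℝ 1 (fun p : Euc n × ℝ => φ (p.1 + z, p.2)) :=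
    hφ.comp ((contDiff_fst.add contDiff_const).prodMk contDiff_snd)
  have hc' : HasCompactSupport (fun p : Euc n × ℝ => φ (p.1 + z, p.2)) :=
    hc.comp_homeomorph ((Homeomorph.addRight z).prodCongr (Homeomorph.refl ℝ))
  rw [← ibp0 ha hab hφ' hc' hτ]
  congr 1
  funext p
  unfold gip
  refine Finset.sum_congr rfl fun k _ => ?_
  have h2 : (fun p : Euc n × ℝ => φ (p.1 + z, p.2)) = fun q => φ (sh (-z) q) := by
    funext q; simp [sh]
  rw [h2, gr_sh]
  simp [sh]

end IEE

namespace IEE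
variable {n : ℕ} {a β : ℝ}

def WW (n : ℕ) (β : ℝ) (f : Euc n → ℝ) (τ : ℝ) (p : Euc n × ℝ) : ℝ := pot n β f (p.2^2 + τ^2) p.1

lemma WW_eq (f : Euc n → ℝ) (τ : ℝ) (p : Euc n × ℝ) : WW n β f τ p = ∫ z, f z * Phi n β τ (sh z p) := by
  unfold WW pot ker Phi sh sq
  simp only [add_assoc]

lemma sh_contDiff (z : Euc n) : ContDiff ℝ (⊤ : ℕ∞) (sh z) := by
  unfold sh; fun_prop

lemma sh_cont2 : Continuous (fun q : (Euc n × ℝ) × Euc n => sh q.2 q.1) := by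
  unfold sh; fun_prop

lemma WW_contDiff {f : Euc n → ℝ} (hf : Continuous f) (hfc : HasCompactSupport f) {τ : ℝ} (hτ : 0 < τ) :
    ContDiff ℝ (⊤ : ℕ∞) (WW n β f τ) := by
  rw [contDiff_iff_contDiffAt]
  intro p
  obtain ⟨R, hR⟩ := hfc.isCompact.isBounded.subset_closedBall (0: Euc n)
  have hR2 : ∀ z, f z ≠ 0 → ‖z‖ ≤ |R| := by
    intro z hz
    have := hR (subset_tsupport _ hz)
    simp at this; exact this.trans (le_abs_self R)
  let χ : ContDiffBump (0 : Euc n) := ⟨‖p.1‖ + 1 + |R|, ‖p.1‖ + 2 + |R|, by positivity, by linarith⟩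
  let g : ℝ → Euc n → ℝ := fun y x => χ x * Phi n β τ (x, y)
  have h := contDiffOn_convolution_right_with_param (𝕜 := ℝ) (μ := (volume : Measure (Euc n))) (f := f) (n := ⊤)
    (ContinuousLinearMap.mul ℝ ℝ) (g := g) (s := univ) (k := tsupport χ) isOpen_univ χ.hasCompactSupport
    (fun y x _ hx => by simp [g, image_eq_zero_of_notMem_tsupport hx])
    (hf.locallyIntegrable) (by
      apply ContDiff.contDiffOn
      have : ContDiff ℝ (⊤ : ℕ∞) (fun q : ℝ × Euc n => χ q.2 * Phi n β τ (q.2, q.1)) :=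
        (χ.contDiff.comp contDiff_snd).mul ((Phi_contDiff hτ).comp (contDiff_snd.prodMk contDiff_fst))
      exact this)
  rw [univ_prod_univ, contDiffOn_univ] at h
  have h2 := h.comp (contDiff_snd.prodMk contDiff_fst : ContDiff ℝ (⊤ : ℕ∞) (fun q : Euc n × ℝ => (q.2, q.1)))
  refine (h2.contDiffAt (x := p)).congr_of_eventuallyEq ?_
  have hnb : ∀ᶠ q : Euc n × ℝ in 𝓝 p, ‖q.1‖ < ‖p.1‖ + 1 :=
    (continuous_fst.norm.tendsto p).eventually (gt_mem_nhds (by linarith))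
  filter_upwards [hnb] with q hq
  rw [WW_eq]
  simp only [Function.comp, convolution, ContinuousLinearMap.mul_apply', g]
  congr 1
  funext z
  by_cases hz : f z = 0
  · simp [hz]
  · have : χ (q.1 - z) = 1 := by
      apply χ.one_of_mem_closedBall
      simp only [Metric.mem_closedBall, dist_zero_right]
      have := norm_sub_le q.1 z
      have := hR2 z hz
      change _ ≤ ‖p.1‖ + 1 + |R|
      linarith
    rw [this, one_mul]; rfl

lemma gr_WW {f : Euc n → ℝ} (hf : Continuous f) (hfc : HasCompactSupport f) {τ : ℝ} (hτ : 0 < τ)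
    (p : Euc n × ℝ) (k : Option (Fin n)) :
    gr (WW n β f τ) p k = ∫ z, f z * gr (Phi n β τ) (sh z p) k := by
  have hP := Phi_contDiff (n := n) (β := β) hτ
  have hdc : Continuous (fderiv ℝ (Phi n β τ)) := hP.continuous_fderiv (by simp)
  have hdc2 : Continuous (fun q : (Euc n × ℝ) × Euc n => fderiv ℝ (Phi n β τ) (sh q.2 q.1)) := hdc.comp sh_cont2
  obtain ⟨M, hM⟩ := ((isCompact_closedBall p 1).prod hfc.isCompact).exists_bound_of_continuousOn hdc2.continuousOn
  have hdz : Continuous (fun z : Euc n => fderiv ℝ (Phi n β τ) (sh z p)) :=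
    hdc2.comp (continuous_const.prodMk continuous_id)
  have hPz : ∀ q, Continuous (fun z : Euc n => Phi n β τ (sh z q)) := fun q =>
    hP.continuous.comp (sh_cont2.comp (continuous_const.prodMk continuous_id))
  have hF'c : Continuous (fun z => f z • fderiv ℝ (Phi n β τ) (sh z p)) := hf.smul hdz
  have hF'i : Integrable (fun z => f z • fderiv ℝ (Phi n β τ) (sh z p)) volume :=
    hF'c.integrable_of_hasCompactSupport hfc.smul_right
  have h := hasFDerivAt_integral_of_dominated_of_fderiv_le (𝕜 := ℝ) (μ := (volume : Measure (Euc n)))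
    (F := fun p z => f z * Phi n β τ (sh z p)) (F' := fun p z => f z • fderiv ℝ (Phi n β τ) (sh z p))
    (x₀ := p) (s := Metric.closedBall p 1) (bound := fun z => ‖f z‖ * M)
    (Metric.closedBall_mem_nhds p one_pos)
    (Filter.Eventually.of_forall fun q => (hf.mul (hPz q)).aestronglyMeasurable)
    ((hf.mul (hPz p)).integrable_of_hasCompactSupport hfc.mul_right)
    hF'c.aestronglyMeasurable
    (Filter.Eventually.of_forall fun z q hq => by
      rw [norm_smul]
      by_cases hz : z ∈ tsupport f
      · exact mul_le_mul_of_nonneg_left (hM (q, z) ⟨hq, hz⟩) (norm_nonneg _)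
      · simp [image_eq_zero_of_notMem_tsupport hz])
    ((hf.norm.mul continuous_const).integrable_of_hasCompactSupport hfc.norm.mul_right)
    (Filter.Eventually.of_forall fun z q hq => by
      have h1 : HasFDerivAt (Phi n β τ) (fderiv ℝ (Phi n β τ) (sh z q)) (sh z q) :=
        (hP.differentiable (by simp) _).hasFDerivAt
      have h2 : HasFDerivAt (sh z) (ContinuousLinearMap.id ℝ (Euc n × ℝ)) q := by
        have : sh z = fun q => q - (z, (0:ℝ)) := by funext q; ext1 <;> simp [sh]
        rw [this]; exact (hasFDerivAt_id q).sub_const _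
      have := (h1.comp q h2).const_mul (f z)
      simpa using this)
  unfold gr
  have e : WW n β f τ = fun p => ∫ z, f z * Phi n β τ (sh z p) := by funext q; exact WW_eq f τ q
  rw [e, h.fderiv, ContinuousLinearMap.integral_apply hF'i]
  simp

/-- the bilinear functional appearing after integration by parts -/
def JJ (n : ℕ) (a β : ℝ) (f : Euc n → ℝ) (τ : ℝ) (φ : Euc n × ℝ → ℝ) : ℝ :=
  ∫ z, f z * ∫ p, φ (τ • p + (z, 0)) * rho n β 1 p ∂(mu n a)

lemma rho_int (ha : -1 < a) (hab : (n:ℝ) + 1 + a = 2 * β + 2) : Integrable (rho n β 1) (mu n a) := by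
  have h := mu_jb_int (n := n) ha (γ := β + 2) (by linarith)
  refine (h.const_mul (4 * β * (β + 1) * 1^2)).congr (Filter.Eventually.of_forall fun p => ?_)
  simp only [rho]
  rw [show -(β+2) = -β - 2 by ring, add_comm (1:ℝ) (sq p)]; norm_num

lemma sq_smul (r : ℝ) (p : Euc n × ℝ) : sq (r • p) = r^2 * sq p := by
  unfold sq; simp [norm_smul, mul_pow]; ring

lemma JJ_scale (ha : -1 < a) (hab : (n:ℝ) + 1 + a = 2 * β + 2) {φ : Euc n × ℝ → ℝ} (hφ : Continuous φ)
    (hc : HasCompactSupport φ) {τ : ℝ} (hτ : 0 < τ) (z : Euc n) :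
    ∫ p, φ (p.1 + z, p.2) * rho n β τ p ∂(mu n a) = ∫ p, φ (τ • p + (z, 0)) * rho n β 1 p ∂(mu n a) := by
  have hcont : Continuous (fun p : Euc n × ℝ => φ (p.1 + z, p.2) * rho n β τ p) :=
    (hφ.comp (by fun_prop)).mul (rho_cont hτ)
  have hcs : HasCompactSupport (fun p : Euc n × ℝ => φ (p.1 + z, p.2) * rho n β τ p) :=
    HasCompactSupport.mul_right (hc.comp_homeomorph ((Homeomorph.addRight z).prodCongr (Homeomorph.refl ℝ)))
  have h1 : Integrable (fun p : Euc n × ℝ => φ (p.1 + z, p.2) * rho n β τ p) (mu n a) :=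
    mu_cpt_int ha hcont hcs.isCompact (fun p _ hp => by have h9 := image_eq_zero_of_notMem_tsupport hp; exact h9)
  have hcs2 := hcs.comp_homeomorph (Homeomorph.smulOfNeZero τ hτ.ne')
  have h2 : Integrable (fun p : Euc n × ℝ => φ ((τ • p).1 + z, (τ • p).2) * rho n β τ (τ • p)) (mu n a) :=
    mu_cpt_int ha (hcont.comp (continuous_const_smul τ)) hcs2.isCompact (fun p _ hp => by have h9 := image_eq_zero_of_notMem_tsupport hp; exact h9)
  have h := mu_scale hτ h1 h2
  have e : ∀ p : Euc n × ℝ, φ (τ • p + (z, 0)) * rho n β 1 p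
      = τ ^ ((n:ℝ) + 1 + a) * (φ ((τ • p).1 + z, (τ • p).2) * rho n β τ (τ • p)) := by
    intro p
    have h1 : rho n β τ (τ • p) = τ ^ (-((n:ℝ) + 1 + a)) * rho n β 1 p := by
      unfold rho
      rw [sq_smul, hab, show τ^2 * sq p + τ^2 = τ^2 * (sq p + 1^2) by ring,
        Real.mul_rpow (by positivity) (by have := sq_nonneg' p; positivity), ← Real.rpow_natCast τ 2,
        ← Real.rpow_mul hτ.le]
      have : τ ^ (-(2*β+2)) = τ ^ ((2:ℕ):ℝ) * τ ^ (((2:ℕ):ℝ) * (-β - 2)) := by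
        rw [← Real.rpow_add hτ]; congr 1; push_cast; ring
      rw [this]; ring
    have h2 : τ • p + (z, 0) = ((τ • p).1 + z, (τ • p).2) := by ext1 <;> simp
    rw [h1, h2, Real.rpow_neg hτ.le]
    have := Real.rpow_pos_of_pos hτ ((n:ℝ) + 1 + a)
    field_simp
  simp only [e]
  rw [integral_const_mul, h, ← mul_assoc, ← Real.rpow_add hτ]
  simp

lemma ibp (ha : -1 < a) (hab : (n:ℝ) + 1 + a = 2 * β + 2) {φ : Euc n × ℝ → ℝ} (hφ : ContDiff ℝ 1 φ)
    (hc : HasCompactSupport φ) {τ : ℝ} (hτ : 0 < τ) {f : Euc n → ℝ} (hf : Continuous f) (hfc : HasCompactSupport f) :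
    ∫ p, gip φ (WW n β f τ) p ∂(mu n a) = JJ n a β f τ φ := by
  unfold JJ
  have hP := Phi_contDiff (n := n) (β := β) hτ
  have hdP : Continuous (fderiv ℝ (Phi n β τ)) := hP.continuous_fderiv (by simp)
  have hdφ : Continuous (fderiv ℝ φ) := hφ.continuous_fderiv (by norm_num)
  have hgP : ∀ k, Continuous (fun q : (Euc n × ℝ) × Euc n => gr (Phi n β τ) (sh q.2 q.1) k) := fun k =>
    (hdP.comp sh_cont2).clm_apply continuous_const
  have hgφ : ∀ k, Continuous (fun q : (Euc n × ℝ) => gr φ q k) := fun k => hdφ.clm_apply continuous_const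
  have hgz : ∀ p k, p ∉ tsupport φ → gr φ p k = 0 := fun p k hp => by
    have : fderiv ℝ φ p = 0 := by by_contra h; exact hp (support_fderiv_subset ℝ h)
    simp [gr, this]
  set G : (Euc n × ℝ) × Euc n → ℝ := fun q => ∑ k, gr φ q.1 k * (f q.2 * gr (Phi n β τ) (sh q.2 q.1) k) with hG
  have hGc : Continuous G := continuous_finset_sum _ fun k _ =>
    ((hgφ k).comp continuous_fst).mul ((hf.comp continuous_snd).mul (hgP k))
  have hK : IsCompact (tsupport φ ×ˢ tsupport f) := hc.isCompact.prod hfc.isCompact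
  have hG0 : ∀ q, q ∉ tsupport φ ×ˢ tsupport f → G q = 0 := by
    intro q hq
    simp only [hG]
    refine Finset.sum_eq_zero fun k _ => ?_
    by_cases h1 : q.1 ∈ tsupport φ
    · have : q.2 ∉ tsupport f := fun h2 => hq ⟨h1, h2⟩
      rw [image_eq_zero_of_notMem_tsupport this]; ring
    · rw [hgz _ _ h1]; ring
  have hKf : ((mu n a).prod volume) (tsupport φ ×ˢ tsupport f) < ⊤ := by
    rw [Measure.prod_prod]
    refine ENNReal.mul_lt_top ?_ hfc.isCompact.measure_lt_top
    obtain ⟨r, hr⟩ := hc.isCompact.isBounded.subset_ball 0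
    exact (measure_mono hr).trans_lt (mu_box_lt_top ha r)
  have hGi : Integrable G ((mu n a).prod volume) := by
    have : (tsupport φ ×ˢ tsupport f).indicator G = G := by
      rw [indicator_eq_self]
      intro q hq; by_contra h; exact hq (hG0 q h)
    rw [← this, integrable_indicator_iff hK.measurableSet]
    obtain ⟨M, hM⟩ := hK.exists_bound_of_continuousOn hGc.continuousOn
    exact Measure.integrableOn_of_bounded hKf.ne hGc.aestronglyMeasurable
      ((ae_restrict_mem hK.measurableSet).mono hM)
  have e1 : ∀ p, gip φ (WW n β f τ) p = ∫ z, G (p, z) := by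
    intro p
    unfold gip
    simp only [hG]
    rw [integral_finset_sum]
    · refine Finset.sum_congr rfl fun k _ => ?_
      rw [gr_WW hf hfc hτ, integral_const_mul]
    · intro k _
      apply Integrable.const_mul
      exact (hf.mul ((hgP k).comp (continuous_const.prodMk continuous_id))).integrable_of_hasCompactSupport hfc.mul_right
  simp only [e1]
  rw [integral_integral_swap (f := fun p z => G (p, z)) hGi]
  congr 1
  funext z
  rw [← JJ_scale ha hab hφ.continuous hc hτ z, ← ibp1 ha hab hφ hc hτ z, ← integral_const_mul]
  congr 1
  funext p
  simp only [hG]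
  rw [Finset.mul_sum]
  refine Finset.sum_congr rfl fun k _ => ?_
  ring

def kap (n : ℕ) (a β : ℝ) : ℝ := ∫ p, rho n β 1 p ∂(mu n a)

lemma rho_nonneg (hβ : 0 < β) (p : Euc n × ℝ) : 0 ≤ rho n β 1 p := by
  unfold rho; have := sq_nonneg' p; positivity

lemma kap_nonneg (hβ : 0 < β) : 0 ≤ kap n a β := integral_nonneg (rho_nonneg hβ)

lemma JJ_lim (ha : -1 < a) (hab : (n:ℝ) + 1 + a = 2 * β + 2) (hβ : 0 < β) {f : Euc n → ℝ} (hf : Continuous f)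
    (hfc : HasCompactSupport f) {φ : ℝ → Euc n × ℝ → ℝ} {φ0 : Euc n → ℝ} {M : ℝ}
    (hφc : ∀ τ, 0 < τ → Continuous (φ τ)) (hM : ∀ τ, 0 < τ → ∀ p, |φ τ p| ≤ M)
    (hl : ∀ z p, 0 < p.2 → Tendsto (fun τ : ℝ => φ τ (τ • p + (z, 0))) (𝓝[>] 0) (𝓝 (φ0 z))) :
    Tendsto (fun τ => JJ n a β f τ (φ τ)) (𝓝[>] 0) (𝓝 (kap n a β * ∫ z, f z * φ0 z)) := by
  have hρ := rho_int ha hab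
  have hpos : ∀ᶠ τ : ℝ in 𝓝[>] 0, 0 < τ := eventually_mem_nhdsWithin
  have hbd : ∀ τ, 0 < τ → ∀ z, ∀ p, ‖φ τ (τ • p + (z, 0)) * rho n β 1 p‖ ≤ M * rho n β 1 p := by
    intro τ hτ z p
    rw [norm_mul, Real.norm_of_nonneg (rho_nonneg hβ p), Real.norm_eq_abs]
    exact mul_le_mul_of_nonneg_right (hM τ hτ _) (rho_nonneg hβ p)
  have h1 : ∀ z, Tendsto (fun τ : ℝ => ∫ p, φ τ (τ • p + (z, 0)) * rho n β 1 p ∂(mu n a)) (𝓝[>] 0)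
      (𝓝 (∫ p, φ0 z * rho n β 1 p ∂(mu n a))) := by
    intro z
    apply tendsto_integral_filter_of_dominated_convergence (fun p => M * rho n β 1 p)
    · filter_upwards [hpos] with τ hτ
      exact (((hφc τ hτ).comp (by fun_prop)).mul (rho_cont one_pos)).aestronglyMeasurable
    · filter_upwards [hpos] with τ hτ
      exact Filter.Eventually.of_forall (hbd τ hτ z)
    · exact hρ.const_mul M
    · filter_upwards [mu_ae_pos] with p hp
      exact (hl z p hp).mul_const _
  have e : kap n a β * ∫ z, f z * φ0 z = ∫ z, f z * ∫ p, φ0 z * rho n β 1 p ∂(mu n a) := by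
    rw [← integral_const_mul]; congr 1; funext z
    rw [integral_const_mul]; unfold kap; ring
  rw [e]
  unfold JJ
  apply tendsto_integral_filter_of_dominated_convergence (fun z => ‖f z‖ * (M * kap n a β))
  · filter_upwards [hpos] with τ hτ
    refine hf.aestronglyMeasurable.mul ?_
    have hj : Continuous (fun q : Euc n × (Euc n × ℝ) => φ τ (τ • q.2 + (q.1, 0)) * rho n β 1 q.2) :=
      ((hφc τ hτ).comp (by fun_prop)).mul ((rho_cont one_pos).comp continuous_snd)
    exact (hj.stronglyMeasurable.integral_prod_right' (ν := mu n a)).aestronglyMeasurable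
  · filter_upwards [hpos] with τ hτ
    refine Filter.Eventually.of_forall fun z => ?_
    rw [norm_mul]
    refine mul_le_mul_of_nonneg_left ?_ (norm_nonneg _)
    unfold kap
    rw [← integral_const_mul]
    exact norm_integral_le_of_norm_le (hρ.const_mul M) (Filter.Eventually.of_forall (hbd τ hτ z))
  · exact (hf.norm.mul continuous_const).integrable_of_hasCompactSupport hfc.norm.mul_right
  · exact Filter.Eventually.of_forall fun z => (h1 z).const_mul _

end IEE

namespace IEE
variable {n : ℕ} {a β : ℝ}

lemma adm_of_cpt {f : Euc n → ℝ} (hf : Continuous f) (hfc : HasCompactSupport f) : Adm n β f := by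
  refine ⟨hf.measurable, ?_⟩
  have hc : Continuous (fun x => f x / h0 n β x) := hf.div (h0_cont n β) (fun x => (h0_pos n β x).ne')
  have hs : HasCompactSupport (fun x => f x / h0 n β x) := by
    simp only [div_eq_mul_inv]; exact hfc.mul_right
  obtain ⟨M, hM⟩ := hs.exists_bound_of_continuous hc
  refine ⟨M, (norm_nonneg _).trans (hM 0), fun x => ?_⟩
  have := hM x
  rw [norm_div, Real.norm_of_nonneg (h0_pos n β x).le, div_le_iff₀ (h0_pos n β x)] at this
  exact this

lemma WW_bound (hn : 1 ≤ n) (hβ : 0 < β) (hβ2 : β < (n:ℝ)/2) :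
    ∃ C : ℝ, 0 < C ∧ ∀ f : Euc n → ℝ, Measurable f → ∀ C1 : ℝ, 0 ≤ C1 → (∀ x, |f x| ≤ C1 * h0 n β x) →
      ∀ τ p, |WW n β f τ p| ≤ C1 * C * (1 + sq p) ^ (-β) := by
  obtain ⟨C, hC, h⟩ := pot_bound n hn hβ hβ2
  refine ⟨C, hC, fun f hfm C1 hC1 hf τ p => ?_⟩
  have ht : 0 ≤ p.2^2 + τ^2 := by positivity
  obtain ⟨h1, h2⟩ := h p.1 (p.2^2 + τ^2) ht
  unfold WW pot
  have h3 : ∀ z, ‖f z * ker n β (p.2^2 + τ^2) (p.1 - z)‖ ≤ C1 * (h0 n β z * ker n β (p.2^2 + τ^2) (p.1 - z)) := by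
    intro z
    rw [norm_mul, Real.norm_of_nonneg (ker_nonneg n β ht _), Real.norm_eq_abs, ← mul_assoc]
    exact mul_le_mul_of_nonneg_right (hf z) (ker_nonneg n β ht _)
  have h4 := norm_integral_le_of_norm_le (h1.const_mul C1) (Filter.Eventually.of_forall h3)
  rw [Real.norm_eq_abs, integral_const_mul] at h4
  refine h4.trans ?_
  rw [mul_assoc]
  refine mul_le_mul_of_nonneg_left (h2.trans ?_) hC1
  refine mul_le_mul_of_nonneg_left ?_ hC.le
  have := sq_nonneg' p
  apply Real.rpow_le_rpow_of_nonpos (by linarith) _ (by linarith)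
  unfold sq
  nlinarith [_root_.sq_nonneg τ]

lemma pot_lim {ι : Type*} {l : Filter ι} [l.IsCountablyGenerated] (hn : 1 ≤ n) (hβ : 0 < β) (hβ2 : β < (n:ℝ)/2)
    {f : Euc n → ℝ} (hf : Continuous f) (hfc : HasCompactSupport f) {xs : ι → Euc n} {ts : ι → ℝ} {x : Euc n}
    (hx : Tendsto xs l (𝓝 x)) (ht : Tendsto ts l (𝓝 0)) (ht0 : ∀ i, 0 ≤ ts i) :
    Tendsto (fun i => pot n β f (ts i) (xs i)) l (𝓝 (pot n β f 0 x)) := by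
  have e : ∀ t y, pot n β f t y = ∫ u, f (y - u) * ker n β t u := by
    intro t y
    unfold pot
    rw [← integral_sub_left_eq_self _ volume y]
    simp
  simp only [e]
  obtain ⟨M, hM⟩ := hfc.exists_bound_of_continuous hf
  have hM0 : 0 ≤ M := (norm_nonneg _).trans (hM 0)
  obtain ⟨R, hR⟩ := hfc.isCompact.isBounded.subset_closedBall (0: Euc n)
  have hnb : ∀ᶠ i in l, ‖xs i‖ < ‖x‖ + 1 := (hx.norm).eventually (gt_mem_nhds (by linarith))
  apply tendsto_integral_filter_of_dominated_convergence
    ((Metric.ball 0 (‖x‖ + 2 + R)).indicator (fun u => M * ‖u‖ ^ (-(2*β))))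
  · refine Filter.Eventually.of_forall fun i => ?_
    exact ((hf.comp (continuous_const.sub continuous_id)).measurable.mul (ker_meas n β _)).aestronglyMeasurable
  · filter_upwards [hnb] with i hi
    filter_upwards [ae_ne n hn 0] with u hu
    by_cases hfu : f (xs i - u) = 0
    · rw [hfu]; simp
      exact indicator_nonneg (fun u _ => by positivity) _
    · have h1 := hR (subset_tsupport _ hfu)
      simp at h1
      have h2 : ‖u‖ ≤ ‖xs i‖ + ‖xs i - u‖ := by
        have := norm_sub_le (xs i) (xs i - u); simpa using this
      rw [indicator_of_mem (by simp; linarith), norm_mul, Real.norm_of_nonneg (ker_nonneg n β (ht0 i) _), ← ker_zero]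
      exact mul_le_mul (hM _) (ker_le_ker0 n hβ (ht0 i) u (Ne.symm hu)) (ker_nonneg n β (ht0 i) _) hM0
  · rw [integrable_indicator_iff Metric.isOpen_ball.measurableSet]
    exact (integrableOn_ball_rpow n hn (by linarith) _).const_mul M
  · filter_upwards [ae_ne n hn 0] with u hu
    have h1 : Tendsto (fun i => f (xs i - u)) l (𝓝 (f (x - u))) :=
      (hf.tendsto _).comp (hx.sub_const u)
    refine h1.mul ?_
    unfold ker
    have : 0 < ‖u‖ := norm_pos_iff.mpr (Ne.symm hu)
    exact (tendsto_const_nhds.add ht).rpow_const (Or.inl (by positivity))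

lemma WW_lim (hn : 1 ≤ n) (hβ : 0 < β) (hβ2 : β < (n:ℝ)/2)
    {f : Euc n → ℝ} (hf : Continuous f) (hfc : HasCompactSupport f) (z : Euc n) (p : Euc n × ℝ) :
    Tendsto (fun τ : ℝ => WW n β f τ (τ • p + (z, 0))) (𝓝[>] 0) (𝓝 (pot n β f 0 z)) := by
  unfold WW
  have h0 : Tendsto (fun τ : ℝ => τ) (𝓝[>] 0) (𝓝 0) := tendsto_nhdsWithin_of_tendsto_nhds tendsto_id
  apply pot_lim hn hβ hβ2 hf hfc
  · have : Tendsto (fun τ : ℝ => τ • p.1 + z) (𝓝[>] 0) (𝓝 ((0:ℝ) • p.1 + z)) := (h0.smul_const _).add_const z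
    simpa using this
  · have : Tendsto (fun τ : ℝ => (τ * p.2)^2 + τ^2) (𝓝[>] 0) (𝓝 (((0:ℝ) * p.2)^2 + 0^2)) :=
      ((h0.mul_const _).pow 2).add (h0.pow 2)
    simpa using this
  · intro τ; positivity

lemma gr_mul {F G : Euc n × ℝ → ℝ} (hF : ContDiff ℝ 1 F) (hG : ContDiff ℝ 1 G) (p k) :
    gr (fun p => F p * G p) p k = F p * gr G p k + G p * gr F p k := by
  unfold gr
  have := ((hF.differentiable (by norm_num) p).hasFDerivAt.mul (hG.differentiable (by norm_num) p).hasFDerivAt).fderiv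
  change fderiv ℝ (fun p => F p * G p) p = _ at this
  rw [this]; simp

lemma gr_cont {F : Euc n × ℝ → ℝ} (hF : ContDiff ℝ 1 F) (k) : Continuous (fun p => gr F p k) :=
  (hF.continuous_fderiv (by norm_num)).clm_apply continuous_const

lemma gr_zero {F : Euc n × ℝ → ℝ} {p} (hp : p ∉ tsupport F) (k) : gr F p k = 0 := by
  have : fderiv ℝ F p = 0 := by by_contra h; exact hp (support_fderiv_subset ℝ h)
  simp [gr, this]

lemma gip_cont {F G : Euc n × ℝ → ℝ} (hF : ContDiff ℝ 1 F) (hG : ContDiff ℝ 1 G) : Continuous (gip F G) :=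
  continuous_finset_sum _ fun k _ => (gr_cont hF k).mul (gr_cont hG k)

lemma gip_self_nonneg (F : Euc n × ℝ → ℝ) (p) : 0 ≤ gip F F p :=
  Finset.sum_nonneg fun k _ => mul_self_nonneg _

lemma gip_zero_left {F G : Euc n × ℝ → ℝ} {p} (hp : p ∉ tsupport F) : gip F G p = 0 :=
  Finset.sum_eq_zero fun k _ => by rw [gr_zero hp]; ring

lemma gip_int (ha : -1 < a) {F G : Euc n × ℝ → ℝ} (hF : ContDiff ℝ 1 F) (hG : ContDiff ℝ 1 G)
    (hc : HasCompactSupport F) : Integrable (gip F G) (mu n a) :=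
  mu_cpt_int ha (gip_cont hF hG) hc.isCompact (fun p _ hp => gip_zero_left hp)

lemma gip_cs (ha : -1 < a) {F G : Euc n × ℝ → ℝ} (hF : ContDiff ℝ 1 F) (hG : ContDiff ℝ 1 G)
    (hFc : HasCompactSupport F) (hGc : HasCompactSupport G) :
    (∫ p, gip F G p ∂(mu n a))^2 ≤ (∫ p, gip F F p ∂(mu n a)) * ∫ p, gip G G p ∂(mu n a) := by
  have hFF := gip_int ha hF hF hFc
  have hFG := gip_int ha hF hG hFc
  have hGG := gip_int ha hG hG hGc
  have h : ∀ t : ℝ, 0 ≤ (∫ p, gip G G p ∂(mu n a)) * (t * t) + (2 * ∫ p, gip F G p ∂(mu n a)) * t + ∫ p, gip F F p ∂(mu n a) := by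
    intro t
    have hA : Integrable (fun p => gip G G p * (t*t)) (mu n a) := hGG.mul_const _
    have hB : Integrable (fun p => gip F G p * (2*t)) (mu n a) := hFG.mul_const _
    have hAB : Integrable (fun p => gip G G p * (t*t) + gip F G p * (2*t)) (mu n a) := hA.add hB
    have e : ∫ p, ((gip G G p * (t*t) + gip F G p * (2*t)) + gip F F p) ∂(mu n a)
       = (∫ p, gip G G p ∂(mu n a)) * (t * t) + (2 * ∫ p, gip F G p ∂(mu n a)) * t + ∫ p, gip F F p ∂(mu n a) := by
      rw [integral_add hAB hFF, integral_add hA hB, integral_mul_const, integral_mul_const]; ring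
    rw [← e]
    apply integral_nonneg
    intro p
    simp only [gip, Finset.sum_mul, ← Finset.sum_add_distrib, Pi.zero_apply]
    refine Finset.sum_nonneg fun k _ => ?_
    nlinarith [_root_.sq_nonneg (t * gr G p k + gr F p k)]
  have := discrim_le_zero h
  unfold discrim at this
  nlinarith

lemma energy_id (ha : -1 < a) (hab : (n:ℝ) + 1 + a = 2 * β + 2) {ζ : Euc n × ℝ → ℝ} (hζ : ContDiff ℝ 1 ζ)
    (hc : HasCompactSupport ζ) {τ : ℝ} (hτ : 0 < τ) {f : Euc n → ℝ} (hf : Continuous f) (hfc : HasCompactSupport f) :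
    ∫ p, gip (fun p => ζ p * WW n β f τ p) (fun p => ζ p * WW n β f τ p) p ∂(mu n a)
      = JJ n a β f τ (fun p => ζ p ^ 2 * WW n β f τ p) + ∫ p, WW n β f τ p ^ 2 * gip ζ ζ p ∂(mu n a) := by
  have hW : ContDiff ℝ 1 (WW n β f τ) := (WW_contDiff hf hfc hτ).of_le (by exact_mod_cast le_top)
  have h2 : ContDiff ℝ 1 (fun p => ζ p ^ 2) := hζ.pow 2
  have h2c : HasCompactSupport (fun p => ζ p ^ 2) := by
    simp only [pow_two]; exact hc.mul_left
  have h3 : ContDiff ℝ 1 (fun p => ζ p ^ 2 * WW n β f τ p) := h2.mul hW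
  have h3c : HasCompactSupport (fun p => ζ p ^ 2 * WW n β f τ p) := h2c.mul_right
  have hI : Integrable (fun p => WW n β f τ p ^ 2 * gip ζ ζ p) (mu n a) :=
    mu_cpt_int ha ((hW.continuous.pow 2).mul (gip_cont hζ hζ)) hc.isCompact
      (fun p _ hp => by show WW n β f τ p ^ 2 * gip ζ ζ p = 0; rw [gip_zero_left hp]; ring)
  rw [← ibp ha hab h3 h3c hτ hf hfc, ← integral_add (gip_int ha h3 hW h3c) hI]
  congr 1
  funext p
  simp only [gip, Finset.mul_sum, ← Finset.sum_add_distrib]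
  refine Finset.sum_congr rfl fun k _ => ?_
  have e : gr (fun p => ζ p ^ 2) p k = 2 * ζ p * gr ζ p k := by
    have := gr_mul hζ hζ p k
    simp only [pow_two]; rw [this]; ring
  rw [gr_mul hζ hW, gr_mul h2 hW, e]
  ring

def eta0 (n : ℕ) : ContDiffBump (0 : Euc n × ℝ) := ⟨1, 2, one_pos, one_lt_two⟩

def etaR (n : ℕ) (R : ℝ) (p : Euc n × ℝ) : ℝ := eta0 n (R⁻¹ • p)

lemma etaR_contDiff (R : ℝ) : ContDiff ℝ (⊤ : ℕ∞) (etaR n R) :=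
  (eta0 n).contDiff.comp (contDiff_const_smul _)

lemma etaR_nonneg (R : ℝ) (p : Euc n × ℝ) : 0 ≤ etaR n R p := (eta0 n).nonneg
lemma etaR_le_one (R : ℝ) (p : Euc n × ℝ) : etaR n R p ≤ 1 := (eta0 n).le_one

lemma etaR_one {R : ℝ} (hR : 0 < R) {p : Euc n × ℝ} (hp : ‖p‖ ≤ R) : etaR n R p = 1 := by
  apply (eta0 n).one_of_mem_closedBall
  simp only [Metric.mem_closedBall, dist_zero_right, norm_smul, norm_inv, Real.norm_of_nonneg hR.le]
  change _ ≤ (1:ℝ)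
  rw [inv_mul_le_iff₀ hR]; linarith

lemma etaR_zero {R : ℝ} (hR : 0 < R) {p : Euc n × ℝ} (hp : 2 * R ≤ ‖p‖) : etaR n R p = 0 := by
  apply (eta0 n).zero_of_le_dist
  simp only [dist_zero_right, norm_smul, norm_inv, Real.norm_of_nonneg hR.le]
  change (2:ℝ) ≤ _
  rw [le_inv_mul_iff₀ hR]; linarith

lemma etaR_tsupport {R : ℝ} (hR : 0 < R) : tsupport (etaR n R) ⊆ Metric.closedBall 0 (2*R) := by
  apply closure_minimal _ Metric.isClosed_closedBall
  intro p hp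
  by_contra h
  simp at h
  exact hp (etaR_zero hR h.le)

lemma etaR_cpt {R : ℝ} (hR : 0 < R) : HasCompactSupport (etaR n R) :=
  (isCompact_closedBall 0 (2*R)).of_isClosed_subset (isClosed_tsupport _) (etaR_tsupport hR)

lemma etaR_grad (n : ℕ) : ∃ C : ℝ, 0 < C ∧ ∀ R : ℝ, 0 < R → ∀ p : Euc n × ℝ,
    gip (etaR n R) (etaR n R) p ≤ (Metric.closedBall 0 (2*R) \ Metric.ball 0 R).indicator (fun _ => C * R^(-2:ℝ)) p := by
  have h1 : ContDiff ℝ 1 (eta0 n) := (eta0 n).contDiff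
  have hc : HasCompactSupport (gip (eta0 n) (eta0 n)) := by
    apply HasCompactSupport.of_support_subset_isCompact (eta0 n).hasCompactSupport.isCompact
    intro p hp; by_contra h; exact hp (gip_zero_left h)
  obtain ⟨M, hM⟩ := hc.exists_bound_of_continuous (gip_cont h1 h1)
  refine ⟨|M| + 1, by positivity, fun R hR p => ?_⟩
  by_cases hp : p ∈ Metric.closedBall 0 (2*R) \ Metric.ball 0 R
  · rw [indicator_of_mem hp]
    have e : ∀ k, gr (etaR n R) p k = R⁻¹ * gr (eta0 n) (R⁻¹ • p) k := by
      intro k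
      unfold gr etaR
      have h2 := (h1.differentiable (by norm_num) (R⁻¹ • p)).hasFDerivAt
      have h3 : HasFDerivAt (fun p : Euc n × ℝ => R⁻¹ • p) (R⁻¹ • ContinuousLinearMap.id ℝ _) p :=
        (hasFDerivAt_id (𝕜 := ℝ) p).const_smul (R⁻¹)
      have := (h2.comp p h3).fderiv
      change fderiv ℝ (fun p => eta0 n (R⁻¹ • p)) p = _ at this
      rw [this]; simp
    have e2 : gip (etaR n R) (etaR n R) p = R⁻¹^2 * gip (eta0 n) (eta0 n) (R⁻¹ • p) := by
      unfold gip
      rw [Finset.mul_sum]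
      refine Finset.sum_congr rfl fun k _ => ?_
      rw [e]; ring
    rw [e2, Real.rpow_neg hR.le, mul_comm, inv_pow]
    have : R ^ (2:ℝ) = R^2 := by norm_cast
    rw [this]
    refine mul_le_mul_of_nonneg_right ?_ (by positivity)
    have := hM (R⁻¹ • p)
    linarith [le_abs_self (gip (eta0 n) (eta0 n) (R⁻¹ • p)), le_abs_self M, Real.norm_eq_abs (gip (eta0 n) (eta0 n) (R⁻¹ • p))]
  · rw [indicator_of_notMem hp]
    apply le_of_eq
    by_cases h2 : ‖p‖ < R
    · have : etaR n R =ᶠ[𝓝 p] fun _ => 1 := by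
        filter_upwards [continuous_norm.tendsto p |>.eventually (gt_mem_nhds h2)] with q hq
        exact etaR_one hR hq.le
      unfold gip gr
      rw [this.fderiv_eq]; simp
    · apply gip_zero_left
      intro h
      have := etaR_tsupport hR h
      exact hp ⟨this, by simpa using h2⟩

lemma mu_ball_scale (ha : -1 < a) {R : ℝ} (hR : 0 < R) :
    (mu n a).real (Metric.closedBall 0 (2*R)) ≤ (mu n a).real (Metric.ball 0 3) * R ^ ((n:ℝ) + 1 + a) := by
  have hms : MeasurableSet (Metric.closedBall (0 : Euc n × ℝ) (2*R)) := Metric.isClosed_closedBall.measurableSet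
  have hms2 : MeasurableSet (Metric.closedBall (0 : Euc n × ℝ) 2) := Metric.isClosed_closedBall.measurableSet
  have hfin : ∀ r : ℝ, mu n a (Metric.closedBall 0 r) < ⊤ := fun r =>
    (measure_mono (Metric.closedBall_subset_ball (by linarith : r < r+1))).trans_lt (mu_box_lt_top ha _)
  have h1 : Integrable ((Metric.closedBall (0 : Euc n × ℝ) (2*R)).indicator (fun _ => (1:ℝ))) (mu n a) := by
    rw [integrable_indicator_iff hms]; exact integrableOn_const (hfin _).ne
  have e : (fun p => (Metric.closedBall (0 : Euc n × ℝ) (2*R)).indicator (fun _ => (1:ℝ)) (R • p))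
      = (Metric.closedBall (0 : Euc n × ℝ) 2).indicator (fun _ => (1:ℝ)) := by
    funext p
    unfold indicator
    congr 1
    simp only [Metric.mem_closedBall, dist_zero_right, norm_smul, Real.norm_of_nonneg hR.le, eq_iff_iff]
    rw [mul_comm 2 R]
    exact mul_le_mul_iff_right₀ hR
  have h2 : Integrable ((Metric.closedBall (0 : Euc n × ℝ) 2).indicator (fun _ => (1:ℝ))) (mu n a) := by
    rw [integrable_indicator_iff hms2]; exact integrableOn_const (hfin _).ne
  have h := mu_scale hR h1 (by rw [e]; exact h2)
  rw [e, integral_indicator hms, integral_indicator hms2] at h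
  simp only [integral_const, smul_eq_mul, mul_one, measureReal_restrict_apply_univ] at h
  have h3 : (mu n a).real (Metric.closedBall 0 2) ≤ (mu n a).real (Metric.ball 0 3) :=
    measureReal_mono (Metric.closedBall_subset_ball (by norm_num)) (mu_box_lt_top ha _).ne
  rw [h, Real.rpow_neg hR.le, inv_mul_le_iff₀ (by positivity)] at h3
  linarith

end IEE

namespace IEE
variable {n : ℕ} {a β : ℝ}

lemma norm_sq_le_sq (p : Euc n × ℝ) : ‖p‖^2 ≤ sq p := by
  unfold sq
  rcases max_choice ‖p.1‖ ‖p.2‖ with h | h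
  · rw [Prod.norm_def, h]; nlinarith [_root_.sq_nonneg p.2]
  · rw [Prod.norm_def, h, Real.norm_eq_abs, sq_abs]; nlinarith [_root_.sq_nonneg ‖p.1‖]

lemma sq_le_norm_sq (p : Euc n × ℝ) : sq p ≤ 2 * ‖p‖^2 := by
  unfold sq
  have h1 := norm_fst_le p
  have h2 := norm_snd_le p
  rw [Real.norm_eq_abs] at h2
  have h3 : p.2^2 ≤ ‖p‖^2 := by rw [← sq_abs]; gcongr
  have h4 : ‖p.1‖^2 ≤ ‖p‖^2 := by gcongr
  linarith

lemma cut_bound (hn : 1 ≤ n) (hβ : 0 < β) (hβ2 : β < (n:ℝ)/2) (ha : -1 < a) (hab : (n:ℝ) + 1 + a = 2 * β + 2) :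
    ∃ C : ℝ, 0 < C ∧ ∀ f : Euc n → ℝ, Measurable f → ∀ C1 : ℝ, 0 ≤ C1 → (∀ x, |f x| ≤ C1 * h0 n β x) →
      ∀ τ R : ℝ, 0 < R → ∫ p, WW n β f τ p ^ 2 * gip (etaR n R) (etaR n R) p ∂(mu n a) ≤ C1^2 * C * R ^ (-(2*β)) := by
  obtain ⟨C, hC, hW⟩ := WW_bound (n := n) hn hβ hβ2
  obtain ⟨D, hD, hη⟩ := etaR_grad n
  set V := (mu n a).real (Metric.ball 0 3) with hV
  have hV0 : 0 ≤ V := measureReal_nonneg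
  refine ⟨C^2 * D * V + 1, by positivity, fun f hfm C1 hC1 hf τ R hR => ?_⟩
  set S : Set (Euc n × ℝ) := Metric.closedBall 0 (2*R) \ Metric.ball 0 R with hS
  have hSm : MeasurableSet S := Metric.isClosed_closedBall.measurableSet.diff Metric.isOpen_ball.measurableSet
  set B : ℝ := (C1 * C)^2 * R^(-(4*β)) * (D * R^(-2:ℝ)) with hB
  have hB0 : 0 ≤ B := by positivity
  have hfin : mu n a (Metric.closedBall 0 (2*R)) < ⊤ :=
    (measure_mono (Metric.closedBall_subset_ball (by linarith : 2*R < 2*R+1))).trans_lt (mu_box_lt_top ha _)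
  have hSf : mu n a S < ⊤ := (measure_mono diff_subset).trans_lt hfin
  have hp : ∀ p, WW n β f τ p ^ 2 * gip (etaR n R) (etaR n R) p ≤ S.indicator (fun _ => B) p := by
    intro p
    have h1 := hη R hR p
    by_cases hpS : p ∈ S
    · rw [indicator_of_mem hpS] at h1 ⊢
      have h2 := hW f hfm C1 hC1 hf τ p
      have h3 : (1 + sq p) ^ (-β) ≤ R ^ (-(2*β)) := by
        have h4 : R ≤ ‖p‖ := by simpa using hpS.2
        have h5 : R^2 ≤ 1 + sq p := by nlinarith [norm_sq_le_sq p]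
        have h6 := Real.rpow_le_rpow_of_nonpos (by positivity) h5 (by linarith : -β ≤ 0)
        rw [← Real.rpow_natCast, ← Real.rpow_mul hR.le] at h6
        convert h6 using 2; push_cast; ring
      have h7 : WW n β f τ p ^ 2 ≤ (C1 * C)^2 * R^(-(4*β)) := by
        rw [← sq_abs]
        have h8 : |WW n β f τ p| ≤ C1 * C * R ^ (-(2*β)) := h2.trans (mul_le_mul_of_nonneg_left h3 (by positivity))
        have h9 : |WW n β f τ p|^2 ≤ (C1 * C * R ^ (-(2*β)))^2 := by gcongr
        rw [mul_pow, ← Real.rpow_natCast (R ^ _), ← Real.rpow_mul hR.le] at h9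
        convert h9 using 3; push_cast; ring
      exact mul_le_mul h7 h1 (gip_self_nonneg _ _) (by positivity)
    · rw [indicator_of_notMem hpS] at h1 ⊢
      have : gip (etaR n R) (etaR n R) p = 0 := le_antisymm h1 (gip_self_nonneg _ _)
      rw [this]; simp
  have hi : Integrable (S.indicator (fun _ => B)) (mu n a) := by
    rw [integrable_indicator_iff hSm]; exact integrableOn_const hSf.ne
  have h1 := integral_mono_of_nonneg (μ := mu n a)
    (Filter.Eventually.of_forall fun p => mul_nonneg (_root_.sq_nonneg (WW n β f τ p)) (gip_self_nonneg (etaR n R) p))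
    hi (Filter.Eventually.of_forall hp)
  refine h1.trans ?_
  rw [integral_indicator hSm]
  simp only [integral_const, smul_eq_mul, measureReal_restrict_apply_univ]
  have h2 : (mu n a).real S ≤ V * R ^ ((n:ℝ) + 1 + a) :=
    (measureReal_mono diff_subset hfin.ne).trans (mu_ball_scale ha hR)
  calc (mu n a).real S * B ≤ (V * R ^ ((n:ℝ) + 1 + a)) * B := mul_le_mul_of_nonneg_right h2 hB0
    _ = C1^2 * (C^2 * D * V) * R^(-(2*β)) := by
        have : R ^ (-(2*β)) = R ^ ((n:ℝ) + 1 + a) * R^(-(4*β)) * R^(-2:ℝ) := by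
          rw [← Real.rpow_add hR, ← Real.rpow_add hR, hab]; congr 1; ring
        rw [this, hB]; ring
    _ ≤ _ := by
        apply mul_le_mul_of_nonneg_right _ (by positivity)
        apply mul_le_mul_of_nonneg_left _ (by positivity)
        linarith

lemma pot_lower (hn : 1 ≤ n) (hβ : 0 < β) (hβ2 : β < (n:ℝ)/2) :
    ∃ c : ℝ, 0 < c ∧ ∀ h : Euc n → ℝ, Adm n β h → (∀ x, 0 ≤ h x) → (∀ x, ‖x‖ < 1 → h0 n β x ≤ h x) →
      ∀ x, c * (1 + ‖x‖^2) ^ (-β) ≤ pot n β h 0 x := by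
  have hvol : 0 < (volume : Measure (Euc n)).real (Metric.ball 0 1) := by
    apply ENNReal.toReal_pos (Metric.measure_ball_pos _ _ one_pos).ne' measure_ball_lt_top.ne
  set c1 : ℝ := 2 ^ (-((n:ℝ) - β)) with hc1
  have hc1p : 0 < c1 := by positivity
  refine ⟨(volume : Measure (Euc n)).real (Metric.ball 0 1) * (c1 * 2 ^ (-β)), by positivity, ?_⟩
  intro h hA hnn hge x
  have hi := adm_pot_int hn hβ hβ2 le_rfl hA x
  unfold pot
  have hnn2 : ∀ z, 0 ≤ h z * ker n β 0 (x - z) := fun z => mul_nonneg (hnn z) (ker_nonneg n β le_rfl _)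
  have h1 : ∫ z in Metric.ball (0 : Euc n) 1, h z * ker n β 0 (x - z) ≤ ∫ z, h z * ker n β 0 (x - z) :=
    setIntegral_le_integral hi (Filter.Eventually.of_forall hnn2)
  refine le_trans ?_ h1
  have h2 : ∫ z in Metric.ball (0 : Euc n) 1, (c1 * 2 ^ (-β)) * (1 + ‖x‖^2) ^ (-β)
      ≤ ∫ z in Metric.ball (0 : Euc n) 1, h z * ker n β 0 (x - z) := by
    have hk : IntegrableOn (fun _ : Euc n => (c1 * 2 ^ (-β)) * (1 + ‖x‖^2) ^ (-β)) (Metric.ball (0 : Euc n) 1) volume :=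
      integrableOn_const measure_ball_lt_top.ne
    apply integral_mono_ae hk hi.integrableOn
    filter_upwards [ae_restrict_mem Metric.isOpen_ball.measurableSet, ae_restrict_of_ae (ae_ne n hn x)] with z hz hxz
    have hz1 : ‖z‖ < 1 := by simpa using hz
    have h3 : c1 ≤ h z := by
      refine le_trans ?_ (hge z hz1)
      unfold h0
      apply Real.rpow_le_rpow_of_nonpos (by positivity) (by nlinarith [norm_nonneg z]) (by linarith)
    have h4 : 2 ^ (-β) * (1 + ‖x‖^2) ^ (-β) ≤ ker n β 0 (x - z) := by
      rw [← Real.mul_rpow (by norm_num) (by positivity)]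
      unfold ker
      have hpos : 0 < ‖x - z‖ := norm_pos_iff.mpr (sub_ne_zero.mpr hxz)
      apply Real.rpow_le_rpow_of_nonpos (by positivity) _ (by linarith)
      have h5 := norm_sub_le x z
      nlinarith [_root_.sq_nonneg (‖x‖ - ‖z‖), norm_nonneg z, norm_nonneg x]
    show c1 * 2 ^ (-β) * (1 + ‖x‖^2) ^ (-β) ≤ h z * ker n β 0 (x - z)
    rw [mul_assoc]
    exact mul_le_mul h3 h4 (by positivity) (hnn z)
  refine le_trans (le_of_eq ?_) h2
  rw [setIntegral_const, smul_eq_mul]; ring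

lemma RI_h0_pos (hn : 1 ≤ n) (hβ : 0 < β) (hβ2 : β < (n:ℝ)/2) : 0 < RI n β (h0 n β) (h0 n β) := by
  obtain ⟨c, hc, h⟩ := pot_lower (n := n) hn hβ hβ2
  have h1 := h (h0 n β) Adm.h0 (fun x => (h0_pos n β x).le) (fun x _ => le_rfl)
  rw [RI_eq hn hβ hβ2 Adm.h0 Adm.h0]
  have hi : Integrable (fun x => h0 n β x * pot n β (h0 n β) 0 x) := by
    have := (adm_prod_int hn hβ hβ2 le_rfl (Adm.h0 (n := n) (β := β)) Adm.h0).integral_prod_left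
    simp only [mul_assoc, integral_const_mul] at this
    exact this
  have h2 : ∫ x : Euc n, c * (1 + ‖x‖^2) ^ (-(n:ℝ)) ≤ ∫ x, h0 n β x * pot n β (h0 n β) 0 x := by
    apply integral_mono ((jbn_int hn).const_mul c) hi
    intro x
    show c * (1 + ‖x‖^2) ^ (-(n:ℝ)) ≤ h0 n β x * pot n β (h0 n β) 0 x
    have e : c * (1 + ‖x‖^2) ^ (-(n:ℝ)) = h0 n β x * (c * (1 + ‖x‖^2) ^ (-β)) := by
      unfold h0
      have : (1 + ‖x‖^2) ^ (-(n:ℝ)) = (1 + ‖x‖^2) ^ (-((n:ℝ) - β)) * (1 + ‖x‖^2) ^ (-β) := by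
        rw [← Real.rpow_add (by positivity)]; congr 1; ring
      rw [this]; ring
    rw [e]
    exact mul_le_mul_of_nonneg_left (h1 x) (h0_pos n β x).le
  refine lt_of_lt_of_le ?_ h2
  rw [integral_const_mul]
  exact mul_pos hc (jbn_pos hn)

lemma Hs_pos (hn : 1 ≤ n) (hβ : 0 < β) (hβ2 : β < (n:ℝ)/2) : 0 < Hs n β := by
  unfold Hs
  apply div_pos (RI_h0_pos hn hβ hβ2)
  apply Real.rpow_pos_of_pos
  rw [Lq_h0 hβ hβ2]; exact jbn_pos hn

lemma kap_pos (hβ : 0 < β) (ha : -1 < a) (hab : (n:ℝ) + 1 + a = 2 * β + 2) : 0 < kap n a β := by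
  unfold kap
  rw [integral_pos_iff_support_of_nonneg (rho_nonneg hβ) (rho_int ha hab)]
  have : Function.support (rho n β 1) = univ := by
    apply eq_univ_of_forall
    intro p
    have h := sq_nonneg' p
    have : 0 < rho n β 1 p := by unfold rho; positivity
    exact this.ne'
  rw [this]
  have hnu : nu1 a ≠ 0 := by
    intro h
    have h1 := nu1_Ioc_val (a := a) ha (α := 0) (by linarith) one_pos
    rw [h] at h1
    simp at h1
    linarith
  unfold mu
  rw [← univ_prod_univ, Measure.prod_prod]
  apply ENNReal.mul_pos
  · exact (isOpen_univ.measure_pos volume univ_nonempty).ne'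
  · exact fun h => hnu (Measure.measure_univ_eq_zero.mp h)

lemma abs_RI_le (hn : 1 ≤ n) (hβ : 0 < β) (hβ2 : β < (n:ℝ)/2) {f : Euc n → ℝ} (hf : Adm n β f) :
    RI n β f f ≤ RI n β (fun x => |f x|) (fun x => |f x|) := by
  have hA : Adm n β (fun x => |f x|) := ⟨hf.1.abs, hf.2.imp fun C h => ⟨h.1, fun x => by rw [abs_abs]; exact h.2 x⟩⟩
  unfold RI
  apply integral_mono (adm_prod_int hn hβ hβ2 le_rfl hf hf) (adm_prod_int hn hβ hβ2 le_rfl hA hA)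
  intro p
  apply mul_le_mul_of_nonneg_right _ (ker_nonneg n β le_rfl _)
  rw [← abs_mul]; exact le_abs_self _

lemma energy_limsup (hn : 1 ≤ n) (hβ : 0 < β) (hβ2 : β < (n:ℝ)/2) (ha : -1 < a) (hab : (n:ℝ) + 1 + a = 2 * β + 2)
    {f : Euc n → ℝ} (hf : Continuous f) (hfc : HasCompactSupport f) {θ : Euc n × ℝ → ℝ} (hθ : Continuous θ) {R : ℝ} (hR : 0 < R)
    (hfR : ∀ x, f x ≠ 0 → ‖x‖ ≤ R) :
    Tendsto (fun τ => JJ n a β f τ (fun p => (θ p * etaR n R p) ^ 2 * WW n β f τ p)) (𝓝[>] 0)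
      (𝓝 (kap n a β * ∫ z, f z * (θ (z, 0) ^ 2 * pot n β f 0 z))) := by
  obtain ⟨hfm, C1, hC1, hb⟩ := adm_of_cpt (β := β) hf hfc
  obtain ⟨C, hC, hW⟩ := WW_bound (n := n) hn hβ hβ2
  have hWb := hW f hfm C1 hC1 hb
  have hW1 : ∀ τ p, |WW n β f τ p| ≤ C1 * C := fun τ p => by
    refine (hWb τ p).trans ?_
    have := sq_nonneg' p
    have h1 := Real.rpow_le_one_of_one_le_of_nonpos (by linarith : (1:ℝ) ≤ 1 + sq p) (by linarith : -β ≤ 0)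
    have h2 : 0 ≤ C1 * C := by positivity
    nlinarith
  have hη := (etaR_contDiff (n := n) R).continuous
  have hθη : Continuous (fun p => (θ p * etaR n R p) ^ 2) := (hθ.mul hη).pow 2
  have hθηc : HasCompactSupport (fun p => (θ p * etaR n R p) ^ 2) := by
    have : (fun p => (θ p * etaR n R p) ^ 2) = fun p => (θ p ^ 2 * etaR n R p) * etaR n R p := by funext p; ring
    rw [this]; exact (etaR_cpt hR).mul_left
  obtain ⟨M, hM⟩ := hθηc.exists_bound_of_continuous hθη
  have hM0 : 0 ≤ M := (norm_nonneg _).trans (hM 0)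
  have hlim := JJ_lim ha hab hβ hf hfc (φ := fun τ p => (θ p * etaR n R p) ^ 2 * WW n β f τ p)
    (φ0 := fun z => (θ (z, 0) * etaR n R (z, 0)) ^ 2 * pot n β f 0 z) (M := M * (C1 * C))
    (fun τ hτ => hθη.mul (WW_contDiff hf hfc hτ).continuous)
    (fun τ hτ p => by
      rw [abs_mul]
      exact mul_le_mul (hM p) (hW1 τ p) (abs_nonneg _) hM0)
    (fun z p hp => by
      refine Tendsto.mul ?_ (WW_lim hn hβ hβ2 hf hfc z p)
      have h0 : Tendsto (fun τ : ℝ => τ) (𝓝[>] 0) (𝓝 0) := tendsto_nhdsWithin_of_tendsto_nhds tendsto_id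
      have h1 : Tendsto (fun τ : ℝ => τ • p + ((z, 0) : Euc n × ℝ)) (𝓝[>] 0) (𝓝 ((0:ℝ) • p + (z, 0))) :=
        (h0.smul_const _).add_const _
      rw [zero_smul, zero_add] at h1
      exact (hθη.tendsto _).comp h1)
  convert hlim using 4 with z
  funext z
  by_cases hz : f z = 0
  · simp [hz]
  · rw [etaR_one hR (by
      rw [Prod.norm_def]; simp only [norm_zero]
      exact max_le (hfR z hz) hR.le)]
    ring

end IEE

namespace IEE
variable {n : ℕ} {a β : ℝ}

lemma trace_ineq (hn : 1 ≤ n) (hβ : 0 < β) (hβ2 : β < (n:ℝ)/2) (ha : -1 < a) (hab : (n:ℝ) + 1 + a = 2 * β + 2)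
    {g : Euc n × ℝ → ℝ} (hg : ContDiff ℝ 1 g) (hgc : HasCompactSupport g) :
    kap n a β * (∫ x, |g (x, 0)| ^ ((n:ℝ)/β)) ^ (2*β/n) ≤ Hs n β * ∫ p, gip g g p ∂(mu n a) := by
  have hn0 : (0:ℝ) < n := by exact_mod_cast hn
  have hp2 : 0 < (n:ℝ)/β - 2 := by rw [sub_pos, lt_div_iff₀ hβ]; linarith
  have hq0 : 0 < qq n β := by linarith [qq_gt_one hβ hβ2]
  have hκ := kap_pos (n := n) hβ ha hab
  have hH := Hs_pos (n := n) hn hβ hβ2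
  set E := ∫ p, gip g g p ∂(mu n a) with hE
  have hE0 : 0 ≤ E := integral_nonneg (gip_self_nonneg g)
  set X := ∫ x, |g (x, 0)| ^ ((n:ℝ)/β) with hX
  have hX0 : 0 ≤ X := integral_nonneg fun x => by positivity
  set g0 : Euc n → ℝ := fun x => g (x, 0) with hg0
  have hg0c : Continuous g0 := hg.continuous.comp (by fun_prop)
  set f : Euc n → ℝ := fun x => |g0 x| ^ ((n:ℝ)/β - 2) * g0 x with hf
  have hfc : Continuous f := (hg0c.abs.rpow_const (fun x => Or.inr hp2.le)).mul hg0c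
  obtain ⟨R0, hR0⟩ := hgc.isCompact.isBounded.subset_closedBall (0: Euc n × ℝ)
  have hg0s : ∀ x, g0 x ≠ 0 → ‖x‖ ≤ R0 := by
    intro x hx
    have := hR0 (subset_tsupport g hx)
    simp at this
    exact this
  have hg0cs : HasCompactSupport g0 := by
    apply HasCompactSupport.of_support_subset_isCompact (isCompact_closedBall (0 : Euc n) R0)
    intro x hx; simpa using hg0s x hx
  have hfcs : HasCompactSupport f := hg0cs.mul_left
  have hfg : ∀ x, f x * g0 x = |g0 x| ^ ((n:ℝ)/β) := by
    intro x
    simp only [hf]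
    by_cases h : g0 x = 0
    · rw [h]; simp [(div_pos hn0 hβ).ne']
    · have h1 : 0 < |g0 x| := abs_pos.mpr h
      rw [mul_assoc, ← abs_mul_abs_self, show (n:ℝ)/β = ((n:ℝ)/β - 2) + (2:ℕ) by push_cast; ring,
        Real.rpow_add h1, Real.rpow_natCast]
      simp only [Nat.cast_ofNat, add_sub_cancel_right]
      ring
  have hA : Adm n β f := adm_of_cpt hfc hfcs
  have hAabs : Adm n β (fun x => |f x|) := adm_of_cpt hfc.abs hfcs.abs
  have hLq : Lq n β (fun x => |f x|) = X := by
    unfold Lq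
    rw [hX]
    congr 1; funext x
    simp only [hf, abs_abs, abs_mul]
    rw [abs_of_nonneg (by positivity : 0 ≤ |g0 x| ^ ((n:ℝ)/β - 2))]
    by_cases h : g0 x = 0
    · have h' : g (x, 0) = 0 := h
      rw [h, h']; simp [(div_pos hn0 hβ).ne', hq0.ne']
    · have h1 : 0 < |g0 x| := abs_pos.mpr h
      rw [← Real.rpow_add_one h1.ne', ← Real.rpow_mul h1.le]
      congr 1
      unfold qq
      have : 0 < (n:ℝ) - β := by linarith
      field_simp
      ring
  have hHLS : RI n β f f ≤ Hs n β * X ^ (2 / qq n β) := by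
    refine (abs_RI_le hn hβ hβ2 hA).trans ?_
    rw [← hLq]
    exact sharp_HLS hn hβ hβ2 hAabs (fun x => abs_nonneg _)
  -- limit of the pairing
  obtain ⟨Mg, hMg⟩ := hgc.exists_bound_of_continuous hg.continuous
  have hl1 : Tendsto (fun τ => JJ n a β f τ g) (𝓝[>] 0) (𝓝 (kap n a β * X)) := by
    have h := JJ_lim ha hab hβ hfc hfcs (φ := fun τ => g) (φ0 := g0) (M := Mg) (fun τ hτ => hg.continuous) (fun τ hτ p => hMg p)
      (fun z p hp => by
        have h0 : Tendsto (fun τ : ℝ => τ) (𝓝[>] 0) (𝓝 0) := tendsto_nhdsWithin_of_tendsto_nhds tendsto_id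
        have h1 : Tendsto (fun τ : ℝ => τ • p + ((z, 0) : Euc n × ℝ)) (𝓝[>] 0) (𝓝 ((0:ℝ) • p + (z, 0))) :=
          (h0.smul_const _).add_const _
        rw [zero_smul, zero_add] at h1
        exact (hg.continuous.tendsto _).comp h1)
    simp only [hfg] at h
    exact h
  obtain ⟨C, hC, hcut⟩ := cut_bound (n := n) hn hβ hβ2 ha hab
  obtain ⟨hfm, C1, hC1, hb⟩ := hA
  have hA : Adm n β f := ⟨hfm, C1, hC1, hb⟩
  have hR : ∀ R : ℝ, max R0 0 < R → (kap n a β * X)^2 ≤ E * (kap n a β * RI n β f f + C1^2 * C * R ^ (-(2*β))) := by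
    intro R hRR
    have hR0' : R0 < R := (le_max_left _ _).trans_lt hRR
    have hRp : 0 < R := (le_max_right _ _).trans_lt hRR
    have hl2 := energy_limsup hn hβ hβ2 ha hab hfc hfcs (θ := fun _ => 1) continuous_const hRp (fun x hx => by
      have : g0 x ≠ 0 := fun h => hx (by simp [hf, h])
      exact (hg0s x this).trans hR0'.le)
    simp only [one_mul, one_pow] at hl2
    rw [← RI_eq hn hβ hβ2 hA hA] at hl2
    refine le_of_tendsto_of_tendsto (hl1.pow 2) ((hl2.add_const (C1^2 * C * R ^ (-(2*β)))).const_mul E) ?_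
    filter_upwards [self_mem_nhdsWithin] with τ hτ
    have hτ0 : 0 < τ := hτ
    have hη : ContDiff ℝ 1 (etaR n R) := (etaR_contDiff R).of_le (by exact_mod_cast le_top)
    have hW : ContDiff ℝ 1 (WW n β f τ) := (WW_contDiff hfc hfcs hτ0).of_le (by exact_mod_cast le_top)
    have hηW : ContDiff ℝ 1 (fun p => etaR n R p * WW n β f τ p) := hη.mul hW
    have hcs := gip_cs ha hg hηW hgc (etaR_cpt hRp).mul_right
    have e1 : ∫ p, gip g (fun p => etaR n R p * WW n β f τ p) p ∂(mu n a) = JJ n a β f τ g := by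
      rw [← ibp ha hab hg hgc hτ0 hfc hfcs]
      congr 1; funext p
      by_cases hp : p ∈ tsupport g
      · have hpn : ‖p‖ < R := by
          have := hR0 hp
          simp only [Metric.mem_closedBall, dist_zero_right] at this
          linarith
        have hev : (fun p => etaR n R p * WW n β f τ p) =ᶠ[𝓝 p] WW n β f τ := by
          filter_upwards [continuous_norm.tendsto p |>.eventually (gt_mem_nhds hpn)] with q hq
          rw [etaR_one hRp hq.le, one_mul]
        unfold gip gr
        rw [hev.fderiv_eq]
      · rw [gip_zero_left hp, gip_zero_left hp]
    rw [e1, energy_id ha hab hη (etaR_cpt hRp) hτ0 hfc hfcs] at hcs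
    refine hcs.trans ?_
    apply mul_le_mul_of_nonneg_left _ hE0
    have := hcut f hfm C1 hC1 hb τ R hRp
    linarith
  have hfin : (kap n a β * X)^2 ≤ E * (kap n a β * RI n β f f) := by
    have hl3 : Tendsto (fun R : ℝ => E * (kap n a β * RI n β f f + C1^2 * C * R ^ (-(2*β)))) atTop
        (𝓝 (E * (kap n a β * RI n β f f + C1^2 * C * 0))) :=
      (((tendsto_rpow_neg_atTop (by linarith : 0 < 2*β)).const_mul _).const_add _).const_mul _
    rw [mul_zero, add_zero] at hl3
    refine ge_of_tendsto hl3 ?_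
    filter_upwards [eventually_gt_atTop (max R0 0)] with R hh using hR R hh
  rcases hX0.eq_or_lt with hX1 | hX1
  · rw [← hX1, Real.zero_rpow (by positivity), mul_zero]; positivity
  · have h1 : (kap n a β * X)^2 ≤ E * (kap n a β * (Hs n β * X ^ (2 / qq n β))) := by
      refine hfin.trans ?_
      gcongr
    have h2 : X^2 = X ^ (2*β/n) * X ^ (2 / qq n β) := by
      rw [← Real.rpow_add hX1, ← Real.rpow_natCast]
      congr 1
      have := qq_inv hβ hβ2
      have h3 : 2 / qq n β = 2 * (1 / qq n β) := by ring
      rw [h3, this]; push_cast; field_simp; ring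
    have h3 : 0 < X ^ (2 / qq n β) := Real.rpow_pos_of_pos hX1 _
    have h4 : kap n a β * X ^ (2 / qq n β) * (kap n a β * X ^ (2*β/n)) ≤ kap n a β * X ^ (2 / qq n β) * (Hs n β * E) := by
      calc _ = (kap n a β)^2 * X^2 := by rw [h2]; ring
        _ ≤ _ := by rw [← mul_pow]; linarith
    exact le_of_mul_le_mul_left h4 (by positivity)

lemma pdX_eq {F : Euc n × ℝ → ℝ} {w : Euc n → ℝ → ℝ} (hw : ∀ x y, w x y = F (x, y)) {x : Euc n} {y : ℝ} (hF : DifferentiableAt ℝ F (x, y)) (i : Fin n) :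
    pdX n w i x y = gr F (x, y) (some i) := by
  unfold pdX gr bb
  have h1 : HasFDerivAt (fun x' : Euc n => (x', y)) (ContinuousLinearMap.inl ℝ (Euc n) ℝ) x := by
    exact hasFDerivAt_prodMk_left x y
  have := (hF.hasFDerivAt.comp x h1).fderiv
  have e : (fun x' => w x' y) = F ∘ (fun x' => (x', y)) := by funext x'; exact hw x' y
  rw [e, this]; simp

lemma pdY_eq {F : Euc n × ℝ → ℝ} {w : Euc n → ℝ → ℝ} (hw : ∀ x y, w x y = F (x, y)) {x : Euc n} {y : ℝ} (hF : DifferentiableAt ℝ F (x, y)) :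
    pdY n w x y = gr F (x, y) none := by
  unfold pdY gr bb
  have h1 : HasFDerivAt (fun y' : ℝ => (x, y')) (ContinuousLinearMap.inr ℝ (Euc n) ℝ) y := by
    exact hasFDerivAt_prodMk_right x y
  have := (hF.hasFDerivAt.comp_hasDerivAt y h1.hasDerivAt).deriv
  have e : (fun y' => w x y') = F ∘ (fun y' => (x, y')) := by funext x'; exact hw x x'
  rw [e, this]; simp

lemma half_ext {g : Euc n → ℝ → ℝ} (hg : ContDiff ℝ (⊤ : ℕ∞) (fun p : Euc n × ℝ => g p.1 p.2))
    (hc : IsCompact (closure {p : Euc n × ℝ | 0 ≤ p.2 ∧ g p.1 p.2 ≠ 0})) :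
    ∃ G : Euc n × ℝ → ℝ, ContDiff ℝ (⊤ : ℕ∞) G ∧ HasCompactSupport G ∧ (∀ p, 0 ≤ p.2 → G p = g p.1 p.2) ∧
      (∀ p k, 0 < p.2 → gr G p k = gr (fun p => g p.1 p.2) p k) := by
  obtain ⟨R, hR⟩ := hc.isBounded.subset_closedBall (0: Euc n × ℝ)
  have hR1 : 0 < |R| + 1 := by positivity
  have he : ∀ p : Euc n × ℝ, 0 ≤ p.2 → etaR n (|R|+1) p * g p.1 p.2 = g p.1 p.2 := by
    intro p hp
    by_cases h : g p.1 p.2 = 0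
    · rw [h, mul_zero]
    · have := hR (subset_closure (show p ∈ {p : Euc n × ℝ | 0 ≤ p.2 ∧ g p.1 p.2 ≠ 0} from ⟨hp, h⟩))
      simp only [Metric.mem_closedBall, dist_zero_right] at this
      rw [etaR_one hR1 (by linarith [le_abs_self R]), one_mul]
  refine ⟨fun p => etaR n (|R|+1) p * g p.1 p.2, (etaR_contDiff _).mul hg, (etaR_cpt hR1).mul_right, he, ?_⟩
  intro p k hp
  unfold gr
  have : (fun p : Euc n × ℝ => etaR n (|R|+1) p * g p.1 p.2) =ᶠ[𝓝 p] fun p => g p.1 p.2 := by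
    filter_upwards [continuous_snd.tendsto p |>.eventually (lt_mem_nhds hp)] with q hq
    exact he q hq.le
  rw [this.fderiv_eq]

lemma K_lower (hn : 1 ≤ n) {s : ℝ} (hs : s ∈ Ioo (0:ℝ) 1) (hns : 2 * s < (n:ℝ)) :
    kap n (1 - 2*s) ((n:ℝ)/2 - s) / Hs n ((n:ℝ)/2 - s) ≤ sInf (KQuotSet n s) := by
  have hn0 : (0:ℝ) < n := by exact_mod_cast hn
  set β : ℝ := (n:ℝ)/2 - s with hβd
  have hβ : 0 < β := by rw [hβd]; linarith
  have hβ2 : β < (n:ℝ)/2 := by rw [hβd]; linarith [hs.1]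
  have ha : -1 < 1 - 2*s := by linarith [hs.2]
  have hab : (n:ℝ) + 1 + (1 - 2*s) = 2 * β + 2 := by rw [hβd]; ring
  have hH := Hs_pos (n := n) hn hβ hβ2
  have hexp : 2*(n:ℝ) / ((n:ℝ) - 2*s) = (n:ℝ)/β := by
    have h1 : (n:ℝ) - 2*s = 2*β := by rw [hβd]; ring
    rw [h1]; field_simp
  have hexp2 : ((n:ℝ) - 2*s) / n = 2*β/n := by rw [hβd]; congr 1; ring
  apply le_csInf
  · refine ⟨_, fun x y => etaR n 1 (x, y), ?_, ?_, ⟨0, ?_⟩, rfl⟩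
    · exact etaR_contDiff 1
    · refine (etaR_cpt (n := n) one_pos).isCompact.of_isClosed_subset isClosed_closure ?_
      exact closure_mono fun p hp => hp.2
    · show etaR n 1 (0, 0) ≠ 0
      rw [etaR_one one_pos (by simp)]; exact one_ne_zero
  · rintro r ⟨g, hg, hc, ⟨x1, hx1⟩, rfl⟩
    obtain ⟨G, hG, hGc, hGe, hGd⟩ := half_ext hg hc
    have hG1 : ContDiff ℝ 1 G := hG.of_le (by exact_mod_cast le_top)
    have h := trace_ineq hn hβ hβ2 ha hab hG1 hGc
    have eE : ∫ x : Euc n, ∫ y in Ioi (0:ℝ), y ^ (1 - 2*s) * ((∑ i, (pdX n g i x y) ^ 2) + (pdY n g x y) ^ 2)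
        = ∫ p, gip G G p ∂(mu n (1 - 2*s)) := by
      rw [integral_mu (gip_int ha hG1 hG1 hGc)]
      congr 1; funext x
      apply setIntegral_congr_fun measurableSet_Ioi
      intro y hy
      have hy0 : (0:ℝ) < y := hy
      have hd : DifferentiableAt ℝ (fun p : Euc n × ℝ => g p.1 p.2) (x, y) := hg.differentiable (by simp) _
      simp only
      congr 1
      unfold gip
      rw [Fintype.sum_option, add_comm]
      congr 1
      · rw [pdY_eq (fun _ _ => rfl) hd, hGd _ _ hy0]; ring
      · refine Finset.sum_congr rfl fun i _ => ?_
        rw [pdX_eq (fun _ _ => rfl) hd, hGd _ _ hy0]; ring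
    have eX : ∫ x : Euc n, |g x 0| ^ (2*(n:ℝ) / ((n:ℝ) - 2*s)) = ∫ x, |G (x, 0)| ^ ((n:ℝ)/β) := by
      rw [hexp]; congr 1; funext x; rw [hGe (x, 0) le_rfl]
    rw [eE, eX, hexp2]
    have hXpos : 0 < ∫ x, |G (x, 0)| ^ ((n:ℝ)/β) := by
      have hcont : Continuous (fun x => |G (x, 0)| ^ ((n:ℝ)/β)) :=
        ((hG.continuous.comp (by fun_prop : Continuous fun x : Euc n => (x, (0:ℝ)))).abs).rpow_const (fun x => Or.inr (by positivity))
      have hcs : HasCompactSupport (fun x => |G (x, 0)| ^ ((n:ℝ)/β)) := by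
        obtain ⟨R, hR⟩ := hGc.isCompact.isBounded.subset_closedBall (0: Euc n × ℝ)
        apply HasCompactSupport.of_support_subset_isCompact (isCompact_closedBall (0 : Euc n) R)
        intro x hx
        have : G (x, 0) ≠ 0 := by
          intro h0; apply hx; simp [h0, (div_pos hn0 hβ).ne']
        have := hR (subset_tsupport G this)
        simp at this
        simpa using this
      apply hcont.integral_pos_of_hasCompactSupport_nonneg_nonzero hcs (fun x => by positivity) (x := x1)
      rw [hGe (x1, 0) le_rfl]
      have : 0 < |g x1 0| := abs_pos.mpr hx1
      positivity
    rw [div_le_div_iff₀ hH (by positivity)]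
    linarith

end IEE

namespace IEE
variable {n : ℕ} {a β : ℝ}

/-- truncated extremal -/
def hR (n : ℕ) (β R : ℝ) (x : Euc n) : ℝ := h0 n β x * etaR n (R/2) (x, 0)

lemma hR_nonneg (R : ℝ) (x : Euc n) : 0 ≤ hR n β R x := mul_nonneg (h0_pos n β x).le (etaR_nonneg _ _)
lemma hR_le (R : ℝ) (x : Euc n) : hR n β R x ≤ h0 n β x :=
  mul_le_of_le_one_right (h0_pos n β x).le (etaR_le_one _ _)
lemma norm_x0 (x : Euc n) : ‖((x, 0) : Euc n × ℝ)‖ = ‖x‖ := by simp [Prod.norm_def]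
lemma hR_eq {R : ℝ} (hR' : 0 < R) {x : Euc n} (hx : ‖x‖ ≤ R/2) : hR n β R x = h0 n β x := by
  unfold hR; rw [etaR_one (by linarith) (by rw [norm_x0]; exact hx), mul_one]
lemma hR_supp {R : ℝ} (hR' : 0 < R) {x : Euc n} (hx : hR n β R x ≠ 0) : ‖x‖ ≤ R := by
  by_contra h
  push Not at h
  apply hx; unfold hR
  rw [etaR_zero (by linarith) (by rw [norm_x0]; linarith), mul_zero]
lemma hR_cont (R : ℝ) : Continuous (hR n β R) :=
  (h0_cont n β).mul ((etaR_contDiff (R/2)).continuous.comp (by fun_prop))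
lemma hR_cpt {R : ℝ} (hR' : 0 < R) : HasCompactSupport (hR n β R) := by
  apply HasCompactSupport.intro (isCompact_closedBall (0 : Euc n) R)
  intro x hx
  by_contra h
  exact hx (by simpa using hR_supp hR' h)
lemma hR_abs (R : ℝ) (x : Euc n) : |hR n β R x| ≤ 1 * h0 n β x := by
  rw [abs_of_nonneg (hR_nonneg R x), one_mul]; exact hR_le R x
lemma hR_adm (R : ℝ) : Adm n β (hR n β R) := ⟨(hR_cont R).measurable, 1, zero_le_one, hR_abs R⟩

lemma RI_symm (hn : 1 ≤ n) (hβ : 0 < β) (hβ2 : β < (n:ℝ)/2) {f g : Euc n → ℝ} : RI n β f g = RI n β g f := by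
  unfold RI
  rw [← integral_prod_swap]
  congr 1; funext p
  simp only [Prod.fst_swap, Prod.snd_swap, ker]
  rw [norm_sub_rev]; ring

lemma pot_le (hn : 1 ≤ n) (hβ : 0 < β) (hβ2 : β < (n:ℝ)/2) :
    ∃ C : ℝ, 0 < C ∧ ∀ f : Euc n → ℝ, Measurable f → (∀ x, |f x| ≤ 1 * h0 n β x) → ∀ x, |pot n β f 0 x| ≤ C * (1 + ‖x‖^2)^(-β) := by
  obtain ⟨C, hC, hW⟩ := WW_bound (n := n) hn hβ hβ2
  refine ⟨C, hC, fun f hfm hf x => ?_⟩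
  have := hW f hfm 1 zero_le_one hf 0 (x, 0)
  simpa [WW, sq] using this

lemma RI_trunc (hn : 1 ≤ n) (hβ : 0 < β) (hβ2 : β < (n:ℝ)/2) :
    ∃ C : ℝ, 0 < C ∧ ∀ R : ℝ, 2 ≤ R → RI n β (h0 n β) (h0 n β) - RI n β (hR n β R) (hR n β R) ≤ C * R ^ (-(2*β)) := by
  obtain ⟨C, hC, hp⟩ := pot_le (n := n) hn hβ hβ2
  have hn0 : (1:ℝ) ≤ n := by exact_mod_cast hn
  have hh : ∀ x, |h0 n β x| ≤ 1 * h0 n β x := fun x => by rw [one_mul, abs_of_pos (h0_pos n β x)]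
  have h0A : Adm n β (h0 n β) := ⟨h0_meas n β, 1, zero_le_one, hh⟩
  set K := ∫ x in (Metric.ball (0:Euc n) 1)ᶜ, ‖x‖ ^ (-(2*(n:ℝ))) with hK
  have hK0 : 0 ≤ K := integral_nonneg (fun x => by positivity)
  refine ⟨2 * (C * (K * 2 ^ (n:ℝ))) + 1, by positivity, fun R hR2 => ?_⟩
  have hRp : 0 < R := by linarith
  set d : Euc n → ℝ := fun x => h0 n β x - hR n β R x with hd
  have hd0 : ∀ x, 0 ≤ d x := fun x => sub_nonneg.2 (hR_le R x)
  have hdh : ∀ x, d x ≤ h0 n β x := fun x => sub_le_self _ (hR_nonneg R x)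
  have hdA : Adm n β d := ⟨(h0_meas n β).sub (hR_cont R).measurable, 1, zero_le_one, fun x => by
    rw [abs_of_nonneg (hd0 x), one_mul]; exact hdh x⟩
  have i1 := adm_prod_int hn hβ hβ2 le_rfl h0A h0A
  have i2 := adm_prod_int hn hβ hβ2 le_rfl (hR_adm (n := n) (β := β) R) (hR_adm R)
  have i3 := adm_prod_int hn hβ hβ2 le_rfl hdA h0A
  have i4 := adm_prod_int hn hβ hβ2 le_rfl h0A hdA
  have s1 : RI n β (h0 n β) (h0 n β) - RI n β (hR n β R) (hR n β R) ≤ RI n β d (h0 n β) + RI n β (h0 n β) d := by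
    unfold RI
    rw [← integral_sub i1 i2, ← integral_add i3 i4]
    refine integral_mono (i1.sub i2) (i3.add i4) (fun p => ?_)
    simp only [Pi.sub_apply, Pi.add_apply, hd]
    have k0 := ker_nonneg n β le_rfl (p.1 - p.2)
    have := mul_nonneg (mul_nonneg (hd0 p.1) (hd0 p.2)) k0
    simp only [hd] at this
    nlinarith
  rw [RI_symm hn hβ hβ2 (f := h0 n β) (g := d), RI_eq hn hβ hβ2 hdA h0A] at s1
  have s2 : ∫ x, d x * pot n β (h0 n β) 0 x ≤ ∫ x, (Metric.ball (0:Euc n) (R/2))ᶜ.indicator (fun x => C * ‖x‖ ^ (-(2*(n:ℝ)))) x := by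
    apply integral_mono_of_nonneg
    · refine Eventually.of_forall fun x => mul_nonneg (hd0 x) (integral_nonneg fun z => mul_nonneg (h0_pos n β z).le (ker_nonneg n β le_rfl _))
    · rw [integrable_indicator_iff measurableSet_ball.compl]
      exact (integrableOn_compl_ball_rpow n (by linarith) (by linarith)).const_mul C
    · refine Eventually.of_forall fun x => ?_
      dsimp only
      by_cases hx : x ∈ (Metric.ball (0:Euc n) (R/2))ᶜ
      · rw [indicator_of_mem hx]
        have hx' : R/2 ≤ ‖x‖ := by simpa using hx
        have hx0 : 0 < ‖x‖ := by linarith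
        have h1 := (le_abs_self _).trans (hp (h0 n β) (h0_meas n β) hh x)
        have h2 : d x * pot n β (h0 n β) 0 x ≤ h0 n β x * (C * (1 + ‖x‖^2)^(-β)) :=
          mul_le_mul (hdh x) h1 (integral_nonneg fun z => mul_nonneg (h0_pos n β z).le (ker_nonneg n β le_rfl _)) (h0_pos n β x).le
        refine h2.trans ?_
        have h3 : h0 n β x * (C * (1 + ‖x‖^2)^(-β)) = C * (1 + ‖x‖^2)^(-(n:ℝ)) := by
          unfold h0
          rw [mul_left_comm, ← Real.rpow_add (by positivity)]; congr 2; ring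
        rw [h3]
        apply mul_le_mul_of_nonneg_left _ hC.le
        have h4 : ‖x‖ ^ (-(2*(n:ℝ))) = (‖x‖^2) ^ (-(n:ℝ)) := by
          rw [← Real.rpow_natCast, ← Real.rpow_mul hx0.le]; congr 1; push_cast; ring
        rw [h4]
        exact Real.rpow_le_rpow_of_nonpos (by positivity) (by linarith) (by linarith)
      · rw [indicator_of_notMem hx]
        have hx' : ‖x‖ < R/2 := by simpa using hx
        simp only [hd, hR_eq hRp hx'.le]; simp
  rw [integral_indicator measurableSet_ball.compl, integral_const_mul,
    integral_compl_ball_rpow n _ (by linarith : 0 < R/2), ← hK] at s2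
  have e : (R/2) ^ ((n:ℝ) - 2*n) = 2 ^ (n:ℝ) * R ^ (-(n:ℝ)) := by
    rw [Real.div_rpow hRp.le (by norm_num), show (n:ℝ) - 2*n = -n by ring, Real.rpow_neg (by norm_num : (0:ℝ) ≤ 2)]
    field_simp
  rw [e] at s2
  have e2 : R ^ (-(n:ℝ)) ≤ R ^ (-(2*β)) := Real.rpow_le_rpow_of_exponent_le (by linarith) (by linarith)
  have e3 : C * (2 ^ (n:ℝ) * R ^ (-(n:ℝ)) * K) ≤ C * (K * 2^(n:ℝ)) * R ^ (-(2*β)) := by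
    have := mul_le_mul_of_nonneg_left e2 (by positivity : 0 ≤ C * (K * 2^(n:ℝ)))
    linarith
  have : 0 < R ^ (-(2*β)) := by positivity
  linarith

end IEE

namespace IEE
variable {n : ℕ} {a β : ℝ}

/-- the test function -/
def FF (n : ℕ) (β R τ : ℝ) (p : Euc n × ℝ) : ℝ := etaR n R p * WW n β (hR n β R) τ p

lemma FF_contDiff {R : ℝ} (hR' : 0 < R) {τ : ℝ} (hτ : 0 < τ) : ContDiff ℝ (⊤ : ℕ∞) (FF n β R τ) :=
  (etaR_contDiff R).mul (WW_contDiff (hR_cont R) (hR_cpt hR') hτ)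
lemma FF_cpt {R : ℝ} (hR' : 0 < R) (τ : ℝ) : HasCompactSupport (FF n β R τ) := (etaR_cpt hR').mul_right
lemma FF_supp {R : ℝ} (hR' : 0 < R) (τ : ℝ) : tsupport (FF n β R τ) ⊆ Metric.closedBall 0 (2*R) :=
  (tsupport_mul_subset_left).trans (etaR_tsupport hR')

lemma cpt_trace {F : Euc n × ℝ → ℝ} (hF : HasCompactSupport F) : HasCompactSupport (fun x : Euc n => F (x, 0)) := by
  obtain ⟨R0, hR0⟩ := hF.isCompact.isBounded.subset_closedBall (0: Euc n × ℝ)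
  apply HasCompactSupport.of_support_subset_isCompact (isCompact_closedBall (0 : Euc n) R0)
  intro x hx
  have := hR0 (subset_tsupport F hx)
  simpa using this

lemma FF_hR {R : ℝ} (hR' : 0 < R) (τ : ℝ) (x : Euc n) :
    hR n β R x * FF n β R τ (x, 0) = hR n β R x * WW n β (hR n β R) τ (x, 0) := by
  by_cases h : hR n β R x = 0
  · rw [h]; simp
  · unfold FF
    rw [etaR_one hR' (by rw [norm_x0]; exact hR_supp hR' h), one_mul]

lemma trace_lower (hn : 1 ≤ n) (hβ : 0 < β) (hβ2 : β < (n:ℝ)/2) (ha : -1 < a) (hab : (n:ℝ) + 1 + a = 2 * β + 2)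
    {R : ℝ} (hR' : 0 < R) {g : Euc n → ℝ} (hg : Continuous g) (hgc : HasCompactSupport g) :
    kap n a β * (2 * (∫ x, hR n β R x * g x) - RI n β (h0 n β) (h0 n β)) ≤
      kap n a β / Hs n β * (∫ x, |g x| ^ ((n:ℝ)/β)) ^ (2*β/n) := by
  have hn0 : (0:ℝ) < n := by exact_mod_cast hn
  have hκ := kap_pos (n := n) hβ ha hab
  have hq0 : 0 < qq n β := by linarith [qq_gt_one hβ hβ2]
  have hRI := RI_h0_pos (n := n) hn hβ hβ2
  have hp0 : 0 < (n:ℝ)/β := by positivity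
  have hnonneg : 0 ≤ ∫ x, |g x| ^ ((n:ℝ)/β) := integral_nonneg fun x => by positivity
  set r := RI n β (h0 n β) (h0 n β) with hr
  set t := ∫ x, hR n β R x * g x with ht
  set X := ∫ x, |g x| ^ ((n:ℝ)/β) with hX
  have hLq0 : 0 < Lq n β (h0 n β) := by rw [Lq_h0 hβ hβ2]; exact jbn_pos hn
  have hLL : Lq n β (hR n β R) ≤ Lq n β (h0 n β) := by
    unfold Lq
    refine integral_mono ((hR_adm R).rpow_int hn hβ hβ2) (Adm.h0.rpow_int hn hβ hβ2) fun x => ?_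
    dsimp only
    apply Real.rpow_le_rpow (abs_nonneg _) _ hq0.le
    rw [abs_of_nonneg (hR_nonneg R x), abs_of_pos (h0_pos n β x)]; exact hR_le R x
  have hmem : MemLp (fun x => |g x|) (ENNReal.ofReal ((n:ℝ)/β)) := hg.abs.memLp_of_hasCompactSupport hgc.abs
  have hh := integral_mul_le_Lp_mul_Lq_of_nonneg (qq_conj hβ hβ2) (μ := volume)
    (Eventually.of_forall fun x => hR_nonneg (n := n) (β := β) R x) (Eventually.of_forall fun x => abs_nonneg (g x))
    ((hR_adm R).memLp hn hβ hβ2) hmem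
  have ht1 : |t| ≤ (Lq n β (h0 n β)) ^ (1 / qq n β) * X ^ (β / n) := by
    calc |t| ≤ ∫ x, |hR n β R x * g x| := abs_integral_le_integral_abs
      _ = ∫ x, hR n β R x * |g x| := by
          congr 1; funext x; rw [abs_mul, abs_of_nonneg (hR_nonneg R x)]
      _ ≤ _ := hh
      _ ≤ _ := by
          rw [one_div_div]
          apply mul_le_mul_of_nonneg_right _ (by positivity)
          apply Real.rpow_le_rpow (integral_nonneg fun x => Real.rpow_nonneg (hR_nonneg R x) _) _ (by positivity)
          convert hLL using 1
          unfold Lq; congr 1; funext x; rw [abs_of_nonneg (hR_nonneg R x)]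
  have ht2 : t^2 ≤ (Lq n β (h0 n β)) ^ (2 / qq n β) * X ^ (2*β / n) := by
    rw [← sq_abs]
    refine (pow_le_pow_left₀ (abs_nonneg _) ht1 2).trans (le_of_eq ?_)
    rw [mul_pow, ← Real.rpow_natCast, ← Real.rpow_natCast, ← Real.rpow_mul hLq0.le, ← Real.rpow_mul hnonneg]
    congr 2 <;> (push_cast; ring)
  have e : kap n a β / Hs n β * X ^ (2*β/n) = kap n a β * ((Lq n β (h0 n β)) ^ (2 / qq n β) * X ^ (2*β / n) / r) := by
    unfold Hs
    rw [← hr]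
    field_simp
  rw [e]
  apply mul_le_mul_of_nonneg_left _ hκ.le
  rw [le_div_iff₀ hRI]
  nlinarith [_root_.sq_nonneg (t - r)]

lemma FF_pair_lim (hn : 1 ≤ n) (hβ : 0 < β) (hβ2 : β < (n:ℝ)/2) {R : ℝ} (hR' : 0 < R) :
    Tendsto (fun τ => ∫ x, hR n β R x * FF n β R τ (x, 0)) (𝓝[>] 0) (𝓝 (RI n β (hR n β R) (hR n β R))) := by
  obtain ⟨C, hC, hW⟩ := WW_bound (n := n) hn hβ hβ2
  rw [RI_eq hn hβ hβ2 (hR_adm R) (hR_adm R)]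
  simp only [FF_hR hR']
  apply tendsto_integral_filter_of_dominated_convergence (fun x => C * h0 n β x)
  · filter_upwards [self_mem_nhdsWithin] with τ hτ
    exact ((hR_cont R).mul ((WW_contDiff (hR_cont R) (hR_cpt hR') hτ).continuous.comp (by fun_prop))).aestronglyMeasurable
  · refine Eventually.of_forall fun τ => Eventually.of_forall fun x => ?_
    rw [Real.norm_eq_abs, abs_mul, abs_of_nonneg (hR_nonneg R x), mul_comm C]
    refine mul_le_mul (hR_le R x) ?_ (abs_nonneg _) (h0_pos n β x).le
    refine (hW _ (hR_cont R).measurable 1 zero_le_one (hR_abs R) τ (x,0)).trans ?_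
    rw [one_mul]
    apply mul_le_of_le_one_right hC.le
    apply Real.rpow_le_one_of_one_le_of_nonpos _ (by linarith)
    linarith [sq_nonneg' (n := n) (x, 0)]
  · exact (h0_int n hβ2).const_mul C
  · refine Eventually.of_forall fun x => ?_
    have := WW_lim hn hβ hβ2 (hR_cont (n := n) (β := β) R) (hR_cpt hR') x 0
    simp only [smul_zero, zero_add] at this
    exact this.const_mul _

/-- lower mass -/
def GG (n : ℕ) (β R : ℝ) : ℝ := ∫ x in Metric.ball (0 : Euc n) R, (1 + ‖x‖^2) ^ (-(2*β))

lemma jb_cont (γ : ℝ) : Continuous (fun x : Euc n => (1 + ‖x‖^2) ^ γ) := by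
  refine Continuous.rpow_const (by fun_prop) (fun x => Or.inl (by positivity))

lemma jb_ball_int (γ R : ℝ) : IntegrableOn (fun x : Euc n => (1 + ‖x‖^2) ^ γ) (Metric.ball 0 R) :=
  ((jb_cont γ).continuousOn.integrableOn_compact (isCompact_closedBall 0 R)).mono_set Metric.ball_subset_closedBall

lemma FF_mass_lim (hn : 1 ≤ n) (hβ : 0 < β) (hβ2 : β < (n:ℝ)/2) :
    ∃ c : ℝ, 0 < c ∧ ∀ R : ℝ, 2 ≤ R → ∃ L : ℝ, c * GG n β R ≤ L ∧
      Tendsto (fun τ => ∫ x, FF n β R τ (x, 0) ^ 2) (𝓝[>] 0) (𝓝 L) := by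
  obtain ⟨C, hC, hW⟩ := WW_bound (n := n) hn hβ hβ2
  obtain ⟨c, hc, hpl⟩ := pot_lower (n := n) hn hβ hβ2
  refine ⟨c^2, by positivity, fun R hR2 => ?_⟩
  have hR' : 0 < R := by linarith
  have hpl' := hpl (hR n β R) (hR_adm R) (hR_nonneg R) (fun x hx => (hR_eq hR' (by linarith)).ge)
  have etac : Continuous (fun x : Euc n => etaR n R (x, 0)) := (etaR_contDiff R).continuous.comp (by fun_prop)
  have etai : Integrable (fun x : Euc n => C^2 * etaR n R (x, 0)) :=
    (etac.integrable_of_hasCompactSupport (cpt_trace (etaR_cpt hR'))).const_mul _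
  have hdom : ∀ τ (x : Euc n), ‖FF n β R τ (x, 0) ^ 2‖ ≤ C^2 * etaR n R (x, 0) := by
    intro τ x
    have h1 : |WW n β (hR n β R) τ (x, 0)| ≤ C := by
      refine (hW _ (hR_cont R).measurable 1 zero_le_one (hR_abs R) τ (x,0)).trans ?_
      rw [one_mul]
      apply mul_le_of_le_one_right hC.le
      apply Real.rpow_le_one_of_one_le_of_nonpos _ (by linarith)
      linarith [sq_nonneg' (n := n) (x, 0)]
    have h2 : WW n β (hR n β R) τ (x, 0) ^ 2 ≤ C^2 := by
      rw [← sq_abs]; exact pow_le_pow_left₀ (abs_nonneg _) h1 2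
    rw [Real.norm_eq_abs, abs_of_nonneg (_root_.sq_nonneg _)]
    unfold FF
    rw [mul_pow, mul_comm]
    refine mul_le_mul h2 ?_ (by positivity) (by positivity)
    rw [_root_.pow_two]
    exact mul_le_of_le_one_left (etaR_nonneg _ _) (etaR_le_one _ _)
  have hlim : ∀ x : Euc n, Tendsto (fun τ => FF n β R τ (x, 0) ^ 2) (𝓝[>] 0) (𝓝 ((etaR n R (x,0) * pot n β (hR n β R) 0 x)^2)) := by
    intro x
    have := WW_lim hn hβ hβ2 (hR_cont (n := n) (β := β) R) (hR_cpt hR') x 0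
    simp only [smul_zero, zero_add] at this
    exact (this.const_mul _).pow 2
  have hT := tendsto_integral_filter_of_dominated_convergence (μ := (volume : Measure (Euc n))) (l := 𝓝[>] (0:ℝ))
    (F := fun τ x => FF n β R τ (x, 0) ^ 2)
    (fun x => C^2 * etaR n R (x, 0)) (by
      filter_upwards [self_mem_nhdsWithin] with τ hτ
      exact (((FF_contDiff hR' hτ).continuous.comp (by fun_prop)).pow 2).aestronglyMeasurable)
      (Eventually.of_forall fun τ => Eventually.of_forall (hdom τ)) etai (Eventually.of_forall hlim)
  refine ⟨_, ?_, hT⟩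
  have hbd : ∀ x : Euc n, ‖(etaR n R (x,0) * pot n β (hR n β R) 0 x)^2‖ ≤ C^2 * etaR n R (x, 0) := fun x =>
    le_of_tendsto (hlim x).norm (Eventually.of_forall fun τ => hdom τ x)
  have hmeas : AEStronglyMeasurable (fun x : Euc n => (etaR n R (x,0) * pot n β (hR n β R) 0 x)^2) volume := by
    refine aestronglyMeasurable_of_tendsto_ae (𝓝[>] (0:ℝ)) (f := fun τ x => if 0 < τ then FF n β R τ (x, 0) ^ 2 else 0) ?_ ?_
    · intro τ
      by_cases h : 0 < τ
      · simp only [h, if_true]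
        exact (((FF_contDiff hR' h).continuous.comp (by fun_prop)).pow 2).aestronglyMeasurable
      · simp only [h, if_false]; exact aestronglyMeasurable_const
    · refine Eventually.of_forall fun x => (hlim x).congr' ?_
      filter_upwards [self_mem_nhdsWithin] with τ hτ
      rw [if_pos (show (0:ℝ) < τ from hτ)]
  have hIntg : Integrable (fun x : Euc n => (etaR n R (x,0) * pot n β (hR n β R) 0 x)^2) :=
    etai.mono' hmeas (Eventually.of_forall hbd)
  unfold GG
  rw [← integral_const_mul]
  refine le_trans ?_ (setIntegral_le_integral hIntg (Eventually.of_forall fun x => _root_.sq_nonneg _) (s := Metric.ball 0 R))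
  refine setIntegral_mono_on ((jb_ball_int _ R).const_mul _) hIntg.integrableOn measurableSet_ball fun x hx => ?_
  have hx' : ‖x‖ < R := by simpa using hx
  rw [etaR_one hR' (by rw [norm_x0]; exact hx'.le), one_mul]
  have := pow_le_pow_left₀ (by positivity) (hpl' x) 2
  rw [mul_pow, ← Real.rpow_natCast ((1 + ‖x‖^2) ^ (-β)), ← Real.rpow_mul (by positivity)] at this
  convert this using 3
  push_cast; ring

end IEE

namespace IEE
variable {n : ℕ} {a β : ℝ}

lemma gip_mul_le {F G : Euc n × ℝ → ℝ} (hF : ContDiff ℝ 1 F) (hG : ContDiff ℝ 1 G) (p : Euc n × ℝ) :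
    gip (fun p => F p * G p) (fun p => F p * G p) p ≤ 2 * F p^2 * gip G G p + 2 * G p^2 * gip F F p := by
  unfold gip
  rw [Finset.mul_sum, Finset.mul_sum, ← Finset.sum_add_distrib]
  refine Finset.sum_le_sum fun k _ => ?_
  rw [gr_mul hF hG]
  nlinarith [_root_.sq_nonneg (F p * gr G p k - G p * gr F p k)]

lemma gip_mul_ge {F G : Euc n × ℝ → ℝ} (hF : ContDiff ℝ 1 F) (hG : ContDiff ℝ 1 G) (p : Euc n × ℝ) :
    F p^2 * gip G G p ≤ 2 * gip (fun p => F p * G p) (fun p => F p * G p) p + 2 * G p^2 * gip F F p := by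
  unfold gip
  rw [Finset.mul_sum, Finset.mul_sum, Finset.mul_sum, ← Finset.sum_add_distrib]
  refine Finset.sum_le_sum fun k _ => ?_
  rw [gr_mul hF hG]
  nlinarith [_root_.sq_nonneg (F p * gr G p k + 2 * (G p * gr F p k))]

def th (n : ℕ) (σ : ℝ) (p : Euc n × ℝ) : ℝ := (sq p + 1) ^ (σ/4)

lemma th_contDiff (σ : ℝ) : ContDiff ℝ (⊤ : ℕ∞) (th n σ) := rpow_sq_contDiff one_pos _

lemma th_sq (σ : ℝ) (p : Euc n × ℝ) : th n σ p ^ 2 = (1 + sq p) ^ (σ/2) := by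
  unfold th
  have := sq_nonneg' p
  rw [← Real.rpow_natCast, ← Real.rpow_mul (by positivity), add_comm]; congr 1; push_cast; ring

lemma th_gip (σ : ℝ) (p : Euc n × ℝ) : gip (th n σ) (th n σ) p ≤ (σ/2)^2 * (1 + sq p) ^ (σ/2 - 1) := by
  have hs := sq_nonneg' p
  obtain ⟨L, hL, h1, -⟩ := rpow_sq_hasFDeriv (n := n) one_pos (σ/4) p
  have e : ∀ k, gr (th n σ) p k = 2 * (σ/4) * (sq p + 1) ^ (σ/4 - 1) * crd p k := fun k => by
    unfold gr
    rw [show th n σ = fun p => (sq p + 1) ^ (σ/4) from rfl, hL.fderiv, h1]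
  unfold gip
  simp only [e]
  have e2 : ∑ k, 2 * (σ/4) * (sq p + 1) ^ (σ/4 - 1) * crd p k * (2 * (σ/4) * (sq p + 1) ^ (σ/4 - 1) * crd p k)
      = (σ/2)^2 * ((sq p + 1) ^ (σ/4 - 1))^2 * sq p := by
    rw [sq_crd, Finset.mul_sum]
    refine Finset.sum_congr rfl fun k _ => by ring
  rw [e2]
  have e3 : ((sq p + 1) ^ (σ/4 - 1))^2 * (1 + sq p) = (1 + sq p) ^ (σ/2 - 1) := by
    rw [← Real.rpow_natCast, ← Real.rpow_mul (by positivity), add_comm (sq p) 1, ← Real.rpow_add_one (by positivity)]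
    congr 1; push_cast; ring
  rw [← e3, mul_assoc]
  apply mul_le_mul_of_nonneg_left _ (by positivity)
  apply mul_le_mul_of_nonneg_left _ (by positivity)
  linarith

lemma eta_gip (n : ℕ) : ∃ C : ℝ, 0 < C ∧ ∀ R : ℝ, 1 ≤ R → ∀ p : Euc n × ℝ,
    gip (etaR n R) (etaR n R) p ≤ (Metric.closedBall 0 (2*R)).indicator (fun p => C * (1 + sq p) ^ (-1:ℝ)) p := by
  obtain ⟨D, hD, h⟩ := etaR_grad n
  refine ⟨9 * D, by positivity, fun R hR p => (h R (by linarith) p).trans ?_⟩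
  have hs := sq_nonneg' p
  by_cases hp : p ∈ Metric.closedBall (0 : Euc n × ℝ) (2*R)
  · rw [indicator_of_mem hp]
    refine (indicator_le_self' (fun _ _ => by positivity) p).trans ?_
    have hp' : ‖p‖ ≤ 2*R := by simpa using hp
    have h1 : 1 + sq p ≤ 9 * R^2 := by nlinarith [sq_le_norm_sq p, norm_nonneg p]
    rw [Real.rpow_neg_one, Real.rpow_neg (by linarith), ← div_eq_mul_inv, ← div_eq_mul_inv, div_le_div_iff₀ (by positivity) (by positivity),
      show (2:ℝ) = ((2:ℕ):ℝ) by norm_num, Real.rpow_natCast]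
    nlinarith
  · rw [indicator_of_notMem hp, indicator_of_notMem (fun h => hp h.1)]

def II (n : ℕ) (a γ R : ℝ) : ℝ := ∫ p, (Metric.closedBall (0:Euc n × ℝ) (2*R)).indicator (fun p => (1 + sq p) ^ (-γ)) p ∂(mu n a)

lemma jbp_cont (γ : ℝ) : Continuous (fun p : Euc n × ℝ => (1 + sq p) ^ γ) := by
  refine Continuous.rpow_const (by have := sq_cont (n := n); fun_prop) (fun p => Or.inl (by have := sq_nonneg' p; positivity))

lemma II_int (ha : -1 < a) (γ R : ℝ) : Integrable ((Metric.closedBall (0:Euc n × ℝ) (2*R)).indicator (fun p => (1 + sq p) ^ (-γ))) (mu n a) := by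
  rw [integrable_indicator_iff Metric.isClosed_closedBall.measurableSet]
  have hfin : mu n a (Metric.closedBall 0 (2*R)) < ⊤ :=
    (measure_mono (Metric.closedBall_subset_ball (by linarith : 2*R < 2*R+1))).trans_lt (mu_box_lt_top ha _)
  obtain ⟨M, hM⟩ := (isCompact_closedBall (0 : Euc n × ℝ) (2*R)).exists_bound_of_continuousOn (jbp_cont (n := n) (-γ)).continuousOn
  exact Measure.integrableOn_of_bounded hfin.ne (jbp_cont _).aestronglyMeasurable (M := M)
    ((ae_restrict_mem Metric.isClosed_closedBall.measurableSet).mono fun p hp => hM p hp)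

lemma II_nonneg (γ R : ℝ) : 0 ≤ II n a γ R :=
  integral_nonneg fun p => indicator_nonneg (fun p _ => by have := sq_nonneg' p; positivity) p

lemma energy_ev (hn : 1 ≤ n) (hβ : 0 < β) (hβ2 : β < (n:ℝ)/2) (ha : -1 < a) (hab : (n:ℝ) + 1 + a = 2 * β + 2) :
    ∃ C : ℝ, 0 < C ∧ ∀ R : ℝ, 2 ≤ R → ∀ δ : ℝ, 0 < δ → ∀ᶠ τ in 𝓝[>] (0:ℝ),
      ∫ p, gip (FF n β R τ) (FF n β R τ) p ∂(mu n a) ≤ kap n a β * RI n β (hR n β R) (hR n β R) + C * R ^ (-(2*β)) + δ := by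
  obtain ⟨C, hC, hcb⟩ := cut_bound (n := n) hn hβ hβ2 ha hab
  refine ⟨C, hC, fun R hR2 δ hδ => ?_⟩
  have hR' : 0 < R := by linarith
  have h1 := energy_limsup hn hβ hβ2 ha hab (hR_cont (n := n) (β := β) R) (hR_cpt hR') (θ := fun _ => 1) continuous_const hR' (fun x => hR_supp hR')
  simp only [one_mul, one_pow] at h1
  rw [← RI_eq hn hβ hβ2 (hR_adm R) (hR_adm R)] at h1
  filter_upwards [self_mem_nhdsWithin, h1.eventually_lt_const (lt_add_of_pos_right _ hδ)] with τ hτ h2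
  have h3 := energy_id ha hab ((etaR_contDiff (n := n) R).of_le (by exact_mod_cast le_top)) (etaR_cpt hR') hτ (hR_cont (n := n) (β := β) R) (hR_cpt hR')
  have h4 := hcb (hR n β R) (hR_cont R).measurable 1 zero_le_one (hR_abs R) τ R hR'
  have e : FF n β R τ = fun p => etaR n R p * WW n β (hR n β R) τ p := rfl
  rw [e, h3]
  linarith

set_option maxHeartbeats 1600000 in
lemma T_ev (hn : 1 ≤ n) (hβ : 0 < β) (hβ2 : β < (n:ℝ)/2) (ha : -1 < a) (hab : (n:ℝ) + 1 + a = 2 * β + 2)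
    {σ : ℝ} (hσ0 : 0 < σ) (hσ : σ < n) :
    ∃ C : ℝ, 0 < C ∧ ∀ R : ℝ, 2 ≤ R → ∀ᶠ τ in 𝓝[>] (0:ℝ),
      ∫ p, (1 + sq p) ^ (σ/2) * gip (FF n β R τ) (FF n β R τ) p ∂(mu n a) ≤ C * (1 + II n a (2*β + 1 - σ/2) R) := by
  obtain ⟨C, hC, hW⟩ := WW_bound (n := n) hn hβ hβ2
  obtain ⟨D, hD, hη⟩ := eta_gip n
  have hκ := kap_pos (n := n) hβ ha hab
  have hji : Integrable (fun x : Euc n => (1 + ‖x‖^2) ^ (-((n:ℝ) - σ/2))) := integrable_jb n (by linarith)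
  set J := ∫ x : Euc n, (1 + ‖x‖^2) ^ (-((n:ℝ) - σ/2)) with hJ
  have hJ0 : 0 ≤ J := integral_nonneg fun x => by positivity
  refine ⟨2 * (kap n a β * (C * J) + 1) + 2 * (C^2 * (2 * D + 2 * (σ/2)^2)) + 2 * (C^2 * (σ/2)^2), by positivity, fun R hR2 => ?_⟩
  have hR' : 0 < R := by linarith
  have h1 := energy_limsup hn hβ hβ2 ha hab (hR_cont (n := n) (β := β) R) (hR_cpt hR') (θ := th n σ) (th_contDiff σ).continuous hR' (fun x => hR_supp hR')
  have h1' : kap n a β * ∫ z, hR n β R z * (th n σ (z, 0) ^ 2 * pot n β (hR n β R) 0 z) ≤ kap n a β * (C * J) := by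
    apply mul_le_mul_of_nonneg_left _ hκ.le
    rw [hJ, ← integral_const_mul]
    have hpn : ∀ z, 0 ≤ pot n β (hR n β R) 0 z := fun z => integral_nonneg fun w => mul_nonneg (hR_nonneg _ _) (ker_nonneg n β le_rfl _)
    apply integral_mono_of_nonneg
    · exact Eventually.of_forall fun z => mul_nonneg (hR_nonneg _ _) (mul_nonneg (_root_.sq_nonneg _) (hpn z))
    · exact hji.const_mul C
    · refine Eventually.of_forall fun z => ?_
      dsimp only
      have h2 := hW _ (hR_cont R).measurable 1 zero_le_one (hR_abs (n := n) (β := β) R) 0 (z, 0)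
      have h3 : pot n β (hR n β R) 0 z ≤ C * (1 + ‖z‖^2) ^ (-β) := by
        refine (le_abs_self _).trans ?_
        simpa [WW, sq] using h2
      rw [th_sq]
      have e : sq ((z, 0) : Euc n × ℝ) = ‖z‖^2 := by simp [sq]
      rw [e]
      calc hR n β R z * ((1 + ‖z‖^2) ^ (σ/2) * pot n β (hR n β R) 0 z)
          ≤ h0 n β z * ((1 + ‖z‖^2) ^ (σ/2) * (C * (1 + ‖z‖^2) ^ (-β))) := by
            refine mul_le_mul (hR_le _ _) (mul_le_mul_of_nonneg_left h3 (by positivity)) (mul_nonneg (by positivity) (hpn z)) (h0_pos n β z).le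
        _ = C * ((1 + ‖z‖^2) ^ (-((n:ℝ) - β)) * (1 + ‖z‖^2) ^ (σ/2) * (1 + ‖z‖^2) ^ (-β)) := by unfold h0; ring
        _ = _ := by
            rw [← Real.rpow_add (by positivity), ← Real.rpow_add (by positivity)]; congr 2; ring
  filter_upwards [self_mem_nhdsWithin, h1.eventually_lt_const (lt_of_le_of_lt h1' (lt_add_one _))] with τ hτ h2
  have hτ' : 0 < τ := hτ
  have hη1 : ContDiff ℝ 1 (etaR n R) := (etaR_contDiff (n := n) R).of_le (by exact_mod_cast le_top)
  have hθ1 : ContDiff ℝ 1 (th n σ) := (th_contDiff (n := n) σ).of_le (by exact_mod_cast le_top)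
  have hF1 : ContDiff ℝ 1 (FF n β R τ) := (FF_contDiff (n := n) (β := β) hR' hτ').of_le (by exact_mod_cast le_top)
  have hζ1 : ContDiff ℝ 1 (fun p => th n σ p * etaR n R p) := hθ1.mul hη1
  have hζc : HasCompactSupport (fun p => th n σ p * etaR n R p) := (etaR_cpt hR').mul_left
  have h3 := energy_id ha hab hζ1 hζc hτ' (hR_cont (n := n) (β := β) R) (hR_cpt hR')
  set γ := 2*β + 1 - σ/2 with hγ
  set S := Metric.closedBall (0 : Euc n × ℝ) (2*R) with hS
  have hII := II_int (n := n) ha γ R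
  have hWb : ∀ p, WW n β (hR n β R) τ p ^ 2 ≤ C^2 * (1 + sq p) ^ (-(2*β)) := by
    intro p
    have hs := sq_nonneg' p
    have := hW _ (hR_cont R).measurable 1 zero_le_one (hR_abs (n := n) (β := β) R) τ p
    rw [one_mul] at this
    rw [← sq_abs]
    refine (pow_le_pow_left₀ (abs_nonneg _) this 2).trans (le_of_eq ?_)
    rw [mul_pow, ← Real.rpow_natCast ((1 + sq p) ^ _), ← Real.rpow_mul (by positivity)]
    congr 2; push_cast; ring
  have hcomb : ∀ p : Euc n × ℝ, (1 + sq p) ^ (-(2*β)) * (1 + sq p) ^ (σ/2 - 1) = (1 + sq p) ^ (-γ) := by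
    intro p
    have hs := sq_nonneg' p
    rw [← Real.rpow_add (by positivity)]; congr 1; rw [hγ]; ring
  have hη2 : ∀ p, etaR n R p ^ 2 ≤ S.indicator (fun _ => (1:ℝ)) p := by
    intro p
    by_cases hp : p ∈ S
    · rw [indicator_of_mem hp]
      exact pow_le_one₀ (etaR_nonneg _ _) (etaR_le_one _ _)
    · rw [indicator_of_notMem hp]
      have : 2*R ≤ ‖p‖ := by
        have : ¬ ‖p‖ ≤ 2*R := by simpa [hS] using hp
        linarith
      rw [etaR_zero hR' this]; norm_num
  have b1 : ∫ p, WW n β (hR n β R) τ p ^ 2 * gip (fun p => th n σ p * etaR n R p) (fun p => th n σ p * etaR n R p) p ∂(mu n a)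
      ≤ (C^2 * (2 * D + 2 * (σ/2)^2)) * II n a γ R := by
    unfold II
    rw [← integral_const_mul]
    apply integral_mono_of_nonneg
    · exact Eventually.of_forall fun p => mul_nonneg (_root_.sq_nonneg _) (gip_self_nonneg _ _)
    · exact hII.const_mul _
    · refine Eventually.of_forall fun p => ?_
      dsimp only
      have hs := sq_nonneg' p
      have q1 := gip_mul_le hθ1 hη1 p
      have q2 := hη R (by linarith) p
      have q3 := th_gip σ p
      have q4 := hη2 p
      have q0 := gip_self_nonneg (etaR n R) p
      have q5 := gip_self_nonneg (th n σ) p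
      by_cases hp : p ∈ S
      · rw [indicator_of_mem hp] at q2 q4 ⊢
        have q6 : gip (fun p => th n σ p * etaR n R p) (fun p => th n σ p * etaR n R p) p ≤
            (2 * D + 2 * (σ/2)^2) * (1 + sq p) ^ (σ/2 - 1) := by
          refine q1.trans ?_
          have r1 : th n σ p ^ 2 * gip (etaR n R) (etaR n R) p ≤ D * (1 + sq p) ^ (σ/2-1) := by
            refine (mul_le_mul_of_nonneg_left q2 (_root_.sq_nonneg _)).trans (le_of_eq ?_)
            rw [th_sq, mul_left_comm, ← Real.rpow_add (by positivity)]; congr 2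
          have r2 : etaR n R p ^ 2 * gip (th n σ) (th n σ) p ≤ (σ/2)^2 * (1 + sq p) ^ (σ/2-1) := by
            refine (mul_le_mul q4 q3 q5 zero_le_one).trans (by rw [one_mul])
          linarith
        refine (mul_le_mul (hWb p) q6 (gip_self_nonneg _ _) (by positivity)).trans (le_of_eq ?_)
        rw [← hcomb p]; ring
      · rw [indicator_of_notMem hp] at q2 q4 ⊢
        have r1 : gip (etaR n R) (etaR n R) p = 0 := le_antisymm q2 q0
        have r2 : etaR n R p ^ 2 = 0 := le_antisymm q4 (_root_.sq_nonneg _)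
        rw [r1, r2] at q1
        have r3 : gip (fun p => th n σ p * etaR n R p) (fun p => th n σ p * etaR n R p) p = 0 :=
          le_antisymm (by linarith) (gip_self_nonneg _ _)
        rw [r3]; simp
  have b2 : ∫ p, FF n β R τ p ^ 2 * gip (th n σ) (th n σ) p ∂(mu n a) ≤ (C^2 * (σ/2)^2) * II n a γ R := by
    unfold II
    rw [← integral_const_mul]
    apply integral_mono_of_nonneg
    · exact Eventually.of_forall fun p => mul_nonneg (_root_.sq_nonneg _) (gip_self_nonneg _ _)
    · exact hII.const_mul _
    · refine Eventually.of_forall fun p => ?_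
      dsimp only
      have hs := sq_nonneg' p
      have q3 := th_gip σ p
      have q4 := hη2 p
      have q5 := gip_self_nonneg (th n σ) p
      have q6 : FF n β R τ p ^ 2 = etaR n R p ^ 2 * WW n β (hR n β R) τ p ^ 2 := by unfold FF; ring
      rw [q6]
      by_cases hp : p ∈ S
      · rw [indicator_of_mem hp] at q4 ⊢
        have r1 : etaR n R p ^ 2 * WW n β (hR n β R) τ p ^ 2 ≤ C^2 * (1 + sq p) ^ (-(2*β)) := by
          refine (mul_le_mul q4 (hWb p) (_root_.sq_nonneg _) zero_le_one).trans (by rw [one_mul])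
        refine (mul_le_mul r1 q3 q5 (by positivity)).trans (le_of_eq ?_)
        rw [← hcomb p]; ring
      · rw [indicator_of_notMem hp] at q4 ⊢
        have r2 : etaR n R p ^ 2 = 0 := le_antisymm q4 (_root_.sq_nonneg _)
        rw [r2]; simp
  have hθF : ContDiff ℝ 1 (fun p => th n σ p * FF n β R τ p) := hθ1.mul hF1
  have hθFc : HasCompactSupport (fun p => th n σ p * FF n β R τ p) := (FF_cpt hR' τ).mul_left
  have hi1 : Integrable (fun p => 2 * gip (fun p => th n σ p * FF n β R τ p) (fun p => th n σ p * FF n β R τ p) p) (mu n a) :=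
    (gip_int ha hθF hθF hθFc).const_mul 2
  have hi2 : Integrable (fun p => 2 * (FF n β R τ p ^ 2 * gip (th n σ) (th n σ) p)) (mu n a) := by
    apply Integrable.const_mul
    refine mu_cpt_int ha (K := tsupport (FF n β R τ)) ((hF1.continuous.pow 2).mul (gip_cont hθ1 hθ1)) (FF_cpt hR' τ) (fun p _ hp => ?_)
    simp [image_eq_zero_of_notMem_tsupport hp]
  have b3 : ∫ p, (1 + sq p) ^ (σ/2) * gip (FF n β R τ) (FF n β R τ) p ∂(mu n a)
      ≤ ∫ p, (2 * gip (fun p => th n σ p * FF n β R τ p) (fun p => th n σ p * FF n β R τ p) p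
        + 2 * (FF n β R τ p ^ 2 * gip (th n σ) (th n σ) p)) ∂(mu n a) := by
    apply integral_mono_of_nonneg
    · exact Eventually.of_forall fun p => mul_nonneg (by have := sq_nonneg' p; positivity) (gip_self_nonneg _ _)
    · exact hi1.add hi2
    · refine Eventually.of_forall fun p => ?_
      dsimp only
      rw [← th_sq]
      have := gip_mul_ge hθ1 hF1 p
      linarith
  rw [integral_add hi1 hi2, integral_const_mul, integral_const_mul] at b3
  have e : (fun p => th n σ p * FF n β R τ p) = fun p => th n σ p * etaR n R p * WW n β (hR n β R) τ p := by
    funext p; unfold FF; ring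
  rw [e, h3] at b3
  have hII0 := II_nonneg (n := n) (a := a) γ R
  have k0 : 0 ≤ (kap n a β * (C * J) + 1) := by positivity
  have k1 : 0 ≤ C^2 * (2 * D + 2 * (σ/2)^2) := by positivity
  have k2 : 0 ≤ C^2 * (σ/2)^2 := by positivity
  have k3 := mul_nonneg k0 hII0
  generalize C^2 * (2 * D + 2 * (σ/2)^2) = X1 at *
  generalize C^2 * (σ/2)^2 = X2 at *
  generalize (kap n a β * (C * J) + 1) = X3 at *
  nlinarith

end IEE

namespace IEE
variable {n : ℕ} {a β : ℝ}

lemma GG_mono {R R' : ℝ} (h : R ≤ R') : GG n β R ≤ GG n β R' :=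
  setIntegral_mono_set (jb_ball_int _ R') (Eventually.of_forall fun x => by positivity)
    (Metric.ball_subset_ball h).eventuallyLE

lemma GG_one_pos : 0 < GG n β 1 := by
  unfold GG
  rw [setIntegral_pos_iff_support_of_nonneg_ae (Eventually.of_forall fun x => by positivity) (jb_ball_int _ _)]
  have : Function.support (fun x : Euc n => (1 + ‖x‖^2) ^ (-(2*β))) = univ := by
    ext x; simp only [Function.mem_support, mem_univ, iff_true]; positivity
  rw [this, univ_inter]
  exact Metric.measure_ball_pos _ _ one_pos

lemma GG_step (hn : 1 ≤ n) (hβ : 4 * β = n) :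
    ∃ c : ℝ, 0 < c ∧ ∀ R : ℝ, 1 ≤ R → GG n β R + c ≤ GG n β (2*R) := by
  have hn0 : (1:ℝ) ≤ n := by exact_mod_cast hn
  set V := (volume : Measure (Euc n)).real (Metric.ball 0 1) with hV
  have hVp : 0 < V := ENNReal.toReal_pos (Metric.measure_ball_pos _ _ one_pos).ne' measure_ball_lt_top.ne
  have hball : ∀ r : ℝ, 0 < r → (volume : Measure (Euc n)).real (Metric.ball 0 r) = r ^ n * V := by
    intro r hr
    rw [hV]
    unfold Measure.real
    rw [Measure.addHaar_ball_of_pos _ _ hr, ENNReal.toReal_mul, ENNReal.toReal_ofReal (by positivity)]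
    simp
  refine ⟨5 ^ (-(2*β)) * V, by positivity, fun R hR => ?_⟩
  have hR0 : 0 < R := by linarith
  have hsub : Metric.ball (0:Euc n) R ⊆ Metric.ball 0 (2*R) := Metric.ball_subset_ball (by linarith)
  have e := integral_diff (μ := volume) (f := fun x : Euc n => (1 + ‖x‖^2) ^ (-(2*β))) measurableSet_ball (jb_ball_int _ (2*R)) hsub
  have hfin : volume (Metric.ball (0:Euc n) (2*R) \ Metric.ball 0 R) ≠ ⊤ :=
    ((measure_mono diff_subset).trans_lt measure_ball_lt_top).ne
  have h1 : (5 * R^2) ^ (-(2*β)) * (volume : Measure (Euc n)).real (Metric.ball (0:Euc n) (2*R) \ Metric.ball 0 R) ≤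
      ∫ x in Metric.ball (0:Euc n) (2*R) \ Metric.ball 0 R, (1 + ‖x‖^2) ^ (-(2*β)) := by
    refine setIntegral_ge_of_const_le_real (measurableSet_ball.diff measurableSet_ball) hfin (fun x hx => ?_)
      ((jb_ball_int _ (2*R)).mono_set diff_subset)
    have hx' : ‖x‖ < 2*R := by simpa using hx.1
    refine Real.rpow_le_rpow_of_nonpos (by positivity) ?_ (by linarith)
    nlinarith [norm_nonneg x]
  rw [measureReal_diff hsub measurableSet_ball measure_ball_lt_top.ne, hball _ hR0, hball _ (by linarith)] at h1
  have h2 : (5 * R^2) ^ (-(2*β)) = 5 ^ (-(2*β)) * (R ^ n)⁻¹ := by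
    rw [Real.mul_rpow (by norm_num) (by positivity), ← Real.rpow_natCast R 2, ← Real.rpow_mul hR0.le, ← Real.rpow_natCast R n, ← Real.rpow_neg hR0.le]
    congr 2; push_cast; linarith
  have h3 : 5 ^ (-(2*β)) * V ≤ (5 * R^2) ^ (-(2*β)) * ((2*R)^n * V - R^n * V) := by
    rw [h2, mul_pow]
    have hRn : 0 < R^n := by positivity
    have : (5:ℝ) ^ (-(2*β)) * (R^n)⁻¹ * (2^n * R^n * V - R^n * V) = 5 ^ (-(2*β)) * V * (2^n - 1) := by
      field_simp
    rw [this]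
    have h4 : (2:ℝ) ≤ 2^n := by
      calc (2:ℝ) = 2^1 := by norm_num
        _ ≤ 2^n := pow_le_pow_right₀ (by norm_num) hn
    have : 0 < (5:ℝ) ^ (-(2*β)) * V := by positivity
    nlinarith
  unfold GG
  linarith

lemma GG_div (hn : 1 ≤ n) (hβ : 4 * β = n) (M : ℝ) : ∃ R : ℝ, 2 ≤ R ∧ M < GG n β R := by
  obtain ⟨c, hc, h⟩ := GG_step hn hβ
  have hk : ∀ k : ℕ, k * c < GG n β (2^k) := by
    intro k
    induction k with
    | zero => simpa using GG_one_pos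
    | succ k ih =>
      have := h (2^k) (one_le_pow₀ (by norm_num))
      rw [← pow_succ'] at this
      push_cast; linarith
  obtain ⟨k, hkM⟩ := exists_nat_gt (M / c)
  rw [div_lt_iff₀ hc] at hkM
  refine ⟨2^(k+1), ?_, ?_⟩
  · rw [pow_succ]; linarith [one_le_pow₀ (by norm_num : (1:ℝ) ≤ 2) (n := k)]
  · have := hk (k+1)
    push_cast at this
    linarith

lemma II_bdd (ha : -1 < a) {γ : ℝ} (hγ : (n:ℝ) + 1 + a < 2 * γ) : ∃ C : ℝ, 0 ≤ C ∧ ∀ R, II n a γ R ≤ C := by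
  refine ⟨∫ p, (1 + sq p) ^ (-γ) ∂(mu n a), integral_nonneg fun p => by have := sq_nonneg' p; positivity, fun R => ?_⟩
  refine integral_mono (II_int ha γ R) (mu_jb_int ha hγ) fun p => ?_
  exact indicator_le_self' (fun q _ => by have := sq_nonneg' q; positivity) p

lemma II_growth (hn : 1 ≤ n) (ha : -1 < a) {γ : ℝ} (hγ0 : 0 < γ) (hγ : 2 * γ < (n:ℝ) + 1 + a) :
    ∃ C : ℝ, 0 ≤ C ∧ ∀ R : ℝ, 0 < R → II n a γ R ≤ C * R ^ ((n:ℝ) + 1 + a - 2 * γ) := by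
  have hn0 : (1:ℝ) ≤ n := by exact_mod_cast hn
  set N : ℝ := (n:ℝ) + 1 + a with hN
  have hNp : 0 < N := by linarith
  set α1 : ℝ := 2 * γ * n / N with hα1
  set α2 : ℝ := 2 * γ * (1 + a) / N with hα2
  have hsum : α1 + α2 = 2 * γ := by rw [hα1, hα2, ← add_div, ← mul_add, show (n:ℝ) + (1 + a) = N by rw [hN]; ring]; field_simp
  have h1 : α1 < n := by rw [hα1, div_lt_iff₀ hNp]; nlinarith
  have h2 : α2 < 1 + a := by rw [hα2, div_lt_iff₀ hNp]; nlinarith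
  have h10 : 0 < α1 := by rw [hα1]; positivity
  have h20 : 0 < α2 := by rw [hα2]; have : 0 < 1 + a := by linarith
                          positivity
  set J := ∫ x in Metric.ball (0 : Euc n) 1, ‖x‖ ^ (-α1) with hJ
  have hJ0 : 0 ≤ J := integral_nonneg fun x => by positivity
  have hd : 0 < 1 + a - α2 := by linarith
  refine ⟨3 ^ (N - 2*γ) * (J / (1 + a - α2)), by positivity, fun R hR => ?_⟩
  have h3R : 0 < 3*R := by linarith
  have i1 : Integrable ((Metric.ball (0:Euc n) (3*R)).indicator fun x => ‖x‖ ^ (-α1)) := by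
    rw [integrable_indicator_iff measurableSet_ball]; exact integrableOn_ball_rpow n hn h1 _
  have i2 := nu1_Ioc_int ha h2 (3*R)
  have hle : II n a γ R ≤ ∫ p : Euc n × ℝ, (Metric.ball (0:Euc n) (3*R)).indicator (fun x => ‖x‖ ^ (-α1)) p.1 *
      (Iio (3*R)).indicator (fun y => y ^ (-α2)) p.2 ∂(mu n a) := by
    unfold II
    refine integral_mono_ae (II_int ha γ R) (i1.mul_prod i2) ?_
    have hx : ∀ᵐ p ∂(mu n a), (0 : Euc n) ≠ p.1 := Measure.quasiMeasurePreserving_fst.ae (ae_ne n hn 0)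
    filter_upwards [hx, mu_ae_pos (n := n) (a := a)] with p hp1 hp2
    have hx0 : 0 < ‖p.1‖ := norm_pos_iff.2 hp1.symm
    by_cases hp : p ∈ Metric.closedBall (0:Euc n × ℝ) (2*R)
    · rw [indicator_of_mem hp]
      have hp' : ‖p‖ ≤ 2*R := by simpa using hp
      have hpa := (norm_fst_le p).trans hp'
      have hpb := (norm_snd_le p).trans hp'
      rw [Real.norm_eq_abs, abs_of_pos hp2] at hpb
      rw [indicator_of_mem (by simp; linarith : p.1 ∈ Metric.ball (0:Euc n) (3*R)), indicator_of_mem (by simp; linarith : p.2 ∈ Iio (3*R))]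
      have hs := sq_nonneg' p
      have e : (1 + sq p) ^ (-γ) = (1 + sq p) ^ (-(α1/2)) * (1 + sq p) ^ (-(α2/2)) := by
        rw [← Real.rpow_add (by positivity)]; congr 1; linarith
      rw [e]
      have e1 : ‖p.1‖ ^ (-α1) = (‖p.1‖^2) ^ (-(α1/2)) := by
        rw [← Real.rpow_natCast, ← Real.rpow_mul hx0.le]; congr 1; push_cast; ring
      have e2 : p.2 ^ (-α2) = (p.2^2) ^ (-(α2/2)) := by
        rw [← Real.rpow_natCast, ← Real.rpow_mul hp2.le]; congr 1; push_cast; ring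
      rw [e1, e2]
      refine mul_le_mul ?_ ?_ (by positivity) (by positivity)
      · refine Real.rpow_le_rpow_of_nonpos (by positivity) ?_ (by linarith)
        unfold sq; nlinarith [_root_.sq_nonneg p.2]
      · refine Real.rpow_le_rpow_of_nonpos (by positivity) ?_ (by linarith)
        unfold sq; nlinarith [_root_.sq_nonneg ‖p.1‖]
    · rw [indicator_of_notMem hp]
      refine mul_nonneg (indicator_nonneg (fun _ _ => by positivity) _) ?_
      by_cases hy : p.2 ∈ Iio (3*R)
      · rw [indicator_of_mem hy]; positivity
      · rw [indicator_of_notMem hy]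
  refine hle.trans (le_of_eq ?_)
  unfold mu
  rw [integral_prod_mul (μ := (volume : Measure (Euc n))) (ν := nu1 a)
    (fun x => (Metric.ball (0:Euc n) (3*R)).indicator (fun x => ‖x‖ ^ (-α1)) x) (fun y => (Iio (3*R)).indicator (fun y => y ^ (-α2)) y),
    nu1_Ioc_val ha h2 h3R, integral_indicator measurableSet_ball, integral_ball_rpow n _ h3R, ← hJ]
  have e : (3*R) ^ ((n:ℝ) - α1) * (3*R) ^ (1 + a - α2) = 3 ^ (N - 2*γ) * R ^ (N - 2*γ) := by
    rw [← Real.rpow_add h3R, ← Real.mul_rpow (by norm_num) hR.le]; congr 1; linarith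
  calc _ = ((3*R) ^ ((n:ℝ) - α1) * (3*R) ^ (1 + a - α2)) * (J / (1 + a - α2)) := by ring
    _ = _ := by rw [e]; ring

lemma choose_R (hn : 1 ≤ n) {s σ : ℝ} (hs : 0 < s) (hs1 : s < 1) (hns : 2 * s < n) (hn4 : 4 * s ≤ n) (hβ : β = (n:ℝ)/2 - s)
    (ha : a = 1 - 2*s) (hσ : 2 * s < σ) (hσn : σ < n) (hσβ : 4 * s < n → σ < 2 * β) {K : ℝ} (hK : 0 < K) :
    ∃ R : ℝ, 2 ≤ R ∧ K * (R ^ (-(2*β)) + R ^ (-σ) * (1 + II n a (2*β+1-σ/2) R)) < R ^ (-(2*s)) * GG n β R := by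
  have ha1 : -1 < a := by linarith
  suffices h : ∃ R : ℝ, 2 ≤ R ∧ K * (R ^ (2*s-2*β) + R ^ (2*s-σ) * (1 + II n a (2*β+1-σ/2) R)) < GG n β R by
    obtain ⟨R, hR, h⟩ := h
    refine ⟨R, hR, ?_⟩
    have hR0 : 0 < R := by linarith
    have := mul_lt_mul_of_pos_left h (by positivity : 0 < R ^ (-(2*s)))
    have e1 : R ^ (-(2*β)) = R ^ (-(2*s)) * R ^ (2*s-2*β) := by rw [← Real.rpow_add hR0]; congr 1; ring
    have e2 : R ^ (-σ) = R ^ (-(2*s)) * R ^ (2*s-σ) := by rw [← Real.rpow_add hR0]; congr 1; ring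
    rw [e1, e2]
    refine lt_of_eq_of_lt ?_ this
    ring
  rcases hn4.lt_or_eq with h4 | h4
  · have hσβ' := hσβ h4
    obtain ⟨C, hC, hI⟩ := II_bdd (n := n) ha1 (γ := 2*β+1-σ/2) (by linarith)
    have t1 : Tendsto (fun R : ℝ => R ^ (2*s-2*β)) atTop (𝓝 0) := by
      have := tendsto_rpow_neg_atTop (y := 2*β-2*s) (by linarith)
      simpa using this
    have t2 : Tendsto (fun R : ℝ => R ^ (2*s-σ)) atTop (𝓝 0) := by
      have := tendsto_rpow_neg_atTop (y := σ-2*s) (by linarith)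
      simpa using this
    have t3 := (t1.add (t2.mul_const (1 + C))).const_mul K
    simp only [zero_mul, add_zero, mul_zero] at t3
    obtain ⟨R, hR1, hR2⟩ := ((t3.eventually_lt_const (GG_one_pos (n := n) (β := β))).and (eventually_ge_atTop 2)).exists
    refine ⟨R, hR2, lt_of_le_of_lt ?_ (hR1.trans_le (GG_mono (by linarith)))⟩
    have hR0 : 0 < R := by linarith
    have := hI R
    gcongr
  · have h2 : 2 * β = 2 * s := by linarith
    obtain ⟨C, hC, hI⟩ := II_growth (n := n) hn ha1 (γ := 2*β+1-σ/2) (by linarith) (by linarith)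
    obtain ⟨R, hR2, hR⟩ := GG_div (n := n) (β := β) hn (by linarith) (K * (2 + C))
    refine ⟨R, hR2, lt_of_le_of_lt ?_ hR⟩
    have hR0 : 0 < R := by linarith
    have h3 := hI R hR0
    apply mul_le_mul_of_nonneg_left _ hK.le
    have e1 : R ^ (2*s-2*β) = 1 := by rw [h2, sub_self, Real.rpow_zero]
    have e2 : R ^ (2*s-σ) ≤ 1 := Real.rpow_le_one_of_one_le_of_nonpos (by linarith) (by linarith)
    have e3 : R ^ (2*s-σ) * (C * R ^ ((n:ℝ) + 1 + a - 2 * (2*β+1-σ/2))) = C := by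
      rw [mul_left_comm, ← Real.rpow_add hR0]
      rw [show 2*s-σ + ((n:ℝ) + 1 + a - 2 * (2*β+1-σ/2)) = 0 by linarith, Real.rpow_zero, mul_one]
    have e4 := mul_le_mul_of_nonneg_left h3 (by positivity : 0 ≤ R ^ (2*s-σ))
    rw [e1]
    linarith

end IEE

namespace IEE
variable {n : ℕ} {a β : ℝ}

set_option maxHeartbeats 1600000 in
lemma test_fun (hn : 1 ≤ n) {s σ : ℝ} (hs : 0 < s) (hs1 : s < 1) (hns : 2 * s < n) (hn4 : 4 * s ≤ n) (hβe : β = (n:ℝ)/2 - s)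
    (hae : a = 1 - 2*s) (hσ : 2 * s < σ) (hσn : σ < n) (hσβ : 4 * s < n → σ < 2 * β) {ℓ C' δ0 : ℝ} (hℓ : 0 < ℓ) (hC' : 0 < C') (hδ0 : 0 < δ0) :
    ∃ R : ℝ, 2 ≤ R ∧ ∃ F : Euc n × ℝ → ℝ, ContDiff ℝ (⊤ : ℕ∞) F ∧ tsupport F ⊆ Metric.closedBall 0 (2*R) ∧ (∃ x, F (x, 0) ≠ 0) ∧
      (∫ p, gip F F p ∂(mu n a)) + C' * (δ0/R) ^ σ * (∫ p, (1 + sq p) ^ (σ/2) * gip F F p ∂(mu n a))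
        - ℓ * (δ0/R) ^ (2*s) * (∫ x, F (x, 0) ^ 2) < kap n a β / Hs n β * (∫ x, |F (x, 0)| ^ ((n:ℝ)/β)) ^ (2*β/n) := by
  have hβ : 0 < β := by rw [hβe]; linarith
  have hβ2 : β < (n:ℝ)/2 := by rw [hβe]; linarith
  have ha : -1 < a := by linarith
  have hab : (n:ℝ) + 1 + a = 2*β+2 := by rw [hβe, hae]; ring
  have hκ := kap_pos (n := n) hβ ha hab
  obtain ⟨C1, hC1, h1⟩ := RI_trunc (n := n) hn hβ hβ2
  obtain ⟨C2, hC2, h2⟩ := energy_ev (n := n) hn hβ hβ2 ha hab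
  obtain ⟨CT, hCT, h3⟩ := T_ev (n := n) hn hβ hβ2 ha hab (σ := σ) (by linarith) hσn
  obtain ⟨c, hc, h4⟩ := FF_mass_lim (n := n) hn hβ hβ2
  set κ := kap n a β with hκd
  set D1 := κ * C1 + C2 + C' * δ0^σ * CT with hD1
  set D2 := ℓ * δ0 ^ (2*s) * c with hD2
  have hD1p : 0 < D1 := by positivity
  have hD2p : 0 < D2 := by positivity
  obtain ⟨R, hR2, hRR⟩ := choose_R (n := n) (a := a) (β := β) hn hs hs1 hns hn4 hβe hae hσ hσn hσβ (K := D1/D2) (by positivity)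
  have hR' : 0 < R := by linarith
  obtain ⟨L, hL, hLl⟩ := h4 R hR2
  have hII := II_nonneg (n := n) (a := a) (2*β+1-σ/2) R
  set I := II n a (2*β+1-σ/2) R with hI
  set u := R ^ (-(2*β)) with hu
  set v := R ^ (-σ) with hv
  set w := R ^ (-(2*s)) with hw
  have hup : 0 < u := by positivity
  have hvp : 0 < v := by positivity
  have hwp : 0 < w := by positivity
  have hRR2 : D1 * (u + v * (1 + I)) < D2 * (w * GG n β R) := by
    rw [div_mul_eq_mul_div, div_lt_iff₀ hD2p] at hRR
    linarith
  have eσ : (δ0/R) ^ σ = δ0^σ * v := by rw [Real.div_rpow hδ0.le hR'.le, hv, Real.rpow_neg hR'.le]; rfl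
  have es : (δ0/R) ^ (2*s) = δ0^(2*s) * w := by rw [Real.div_rpow hδ0.le hR'.le, hw, Real.rpow_neg hR'.le]; rfl
  set ε1 := C' * (δ0/R) ^ σ with hε1
  set ε2 := ℓ * (δ0/R) ^ (2*s) with hε2
  have hε1p : 0 < ε1 := by positivity
  have hε2p : 0 < ε2 := by positivity
  have gap : κ * C1 * u + C2 * u + ε1 * (CT * (1 + I)) < ε2 * L := by
    have q1 : D2 * (w * GG n β R) ≤ ε2 * L := by
      have : D2 * (w * GG n β R) = ε2 * (c * GG n β R) := by rw [hε2, es, hD2]; ring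
      rw [this]; exact mul_le_mul_of_nonneg_left hL hε2p.le
    refine lt_of_le_of_lt ?_ (hRR2.trans_le q1)
    rw [hε1, eσ, hD1]
    have p1 : 0 ≤ (κ * C1 + C2) * (v * (1 + I)) := by positivity
    have p2 : 0 ≤ C' * δ0^σ * CT * u := by positivity
    linarith
  set Δ := ε2 * L - (κ * C1 * u + C2 * u + ε1 * (CT * (1 + I))) with hΔ
  have hΔp : 0 < Δ := by rw [hΔ]; linarith
  have h1R := h1 R hR2
  have hRIp : 0 < RI n β (hR n β R) (hR n β R) := by
    obtain ⟨c', hc', hp⟩ := pot_lower (n := n) hn hβ hβ2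
    have hp' := hp (hR n β R) (hR_adm R) (hR_nonneg R) (fun x hx => (hR_eq hR' (by linarith)).ge)
    rw [RI_eq hn hβ hβ2 (hR_adm R) (hR_adm R)]
    have hcont : Continuous (fun x => hR n β R x * (c' * (1 + ‖x‖^2) ^ (-β))) := (hR_cont R).mul ((jb_cont _).const_mul _)
    have hcs : HasCompactSupport (fun x => hR n β R x * (c' * (1 + ‖x‖^2) ^ (-β))) := (hR_cpt hR').mul_right
    have hpos := hcont.integral_pos_of_hasCompactSupport_nonneg_nonzero (μ := volume) hcs
      (fun x => mul_nonneg (hR_nonneg _ _) (by positivity)) (x := 0) (by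
        rw [hR_eq hR' (by simp; linarith)]
        exact (mul_pos (h0_pos n β 0) (by positivity)).ne')
    refine hpos.trans_le (integral_mono_of_nonneg (Eventually.of_forall fun x => mul_nonneg (hR_nonneg _ _) (by positivity)) ?_
      (Eventually.of_forall fun x => mul_le_mul_of_nonneg_left (hp' x) (hR_nonneg _ _)))
    have := (adm_prod_int hn hβ hβ2 le_rfl (hR_adm (n := n) (β := β) R) (hR_adm R)).integral_prod_left
    simp only [mul_assoc, integral_const_mul] at this
    exact this
  have hpair := FF_pair_lim (n := n) hn hβ hβ2 hR'
  have ev := (((((h2 R hR2 (Δ/8) (by positivity)).and (h3 R hR2)).and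
    (hLl.eventually_const_lt (sub_lt_self L (by positivity : 0 < Δ/(8*ε2))))).and
    (hpair.eventually_const_lt (sub_lt_self _ (by positivity : 0 < Δ/(8*κ))))).and (hpair.eventually_const_lt hRIp)).and
    (self_mem_nhdsWithin (s := Ioi (0:ℝ)) (a := 0))
  obtain ⟨τ, ⟨⟨⟨⟨hE, hT⟩, hM⟩, hP⟩, hP0⟩, hτ⟩ := ev.exists
  have hτ' : 0 < τ := hτ
  refine ⟨R, hR2, FF n β R τ, FF_contDiff hR' hτ', FF_supp hR' τ, ?_, ?_⟩
  · by_contra hcon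
    push Not at hcon
    simp [hcon] at hP0
  have htr := trace_lower hn hβ hβ2 ha hab hR' (g := fun x => FF n β R τ (x, 0))
    ((FF_contDiff hR' hτ').continuous.comp (by fun_prop)) (cpt_trace (FF_cpt hR' τ))
  refine lt_of_lt_of_le ?_ htr
  rw [← hκd]
  have hT' := mul_le_mul_of_nonneg_left hT hε1p.le
  have hM' := mul_lt_mul_of_pos_left hM hε2p
  have hP' := mul_lt_mul_of_pos_left hP hκ
  have h1' := mul_le_mul_of_nonneg_left h1R hκ.le
  have k1 : ε2 * (L - Δ/(8*ε2)) = ε2 * L - Δ/8 := by field_simp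
  have k2 : κ * (RI n β (hR n β R) (hR n β R) - Δ/(8*κ)) = κ * RI n β (hR n β R) (hR n β R) - Δ/8 := by field_simp
  rw [k1] at hM'
  rw [k2] at hP'
  linarith

end IEE

namespace IEE
variable {n : ℕ} {a β : ℝ}

open scoped MatrixOrder in
lemma mat_factor {A0 : Matrix (Fin n) (Fin n) ℝ} (h : A0.PosDef) :
    ∃ B : Matrix (Fin n) (Fin n) ℝ, A0 = B.transpose * B := by
  letI := Matrix.instL2OpNormedRing (n := Fin n) (𝕜 := ℝ)
  obtain ⟨B, hB⟩ := CStarAlgebra.nonneg_iff_eq_star_mul_self.mp h.posSemidef.nonneg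
  exact ⟨B, by rw [hB]; simp [Matrix.star_eq_conjTranspose]⟩

lemma lin_factor {A0 : Matrix (Fin n) (Fin n) ℝ} (h : A0.PosDef) :
    ∃ (B : Matrix (Fin n) (Fin n) ℝ) (L : Euc n ≃L[ℝ] Euc n), A0 = B.transpose * B ∧
      (∀ i, L (EuclideanSpace.single i 1) = WithLp.toLp 2 (B i)) ∧
      |LinearMap.det (L : Euc n →ₗ[ℝ] Euc n)| = A0.det ^ ((1:ℝ)/2) := by
  obtain ⟨B, hB⟩ := mat_factor h
  have hd : A0.det = B.det ^ 2 := by rw [hB, Matrix.det_mul, Matrix.det_transpose]; ring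
  have hdp := h.det_pos
  have hdet : LinearMap.det (Matrix.toLpLin 2 2 B.transpose : Euc n →ₗ[ℝ] Euc n) = B.det := by
    rw [Matrix.toLpLin_eq_toLin, LinearMap.det_toLin, Matrix.det_transpose]
  have hu : IsUnit (LinearMap.det (Matrix.toLpLin 2 2 B.transpose : Euc n →ₗ[ℝ] Euc n)) := by
    rw [hdet, isUnit_iff_ne_zero]
    intro h0
    rw [hd, h0] at hdp; simp at hdp
  refine ⟨B, (LinearMap.equivOfIsUnitDet hu).toContinuousLinearEquiv, hB, ?_, ?_⟩
  · intro i
    ext j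
    simp [Matrix.toLpLin_apply, Matrix.transpose_apply]
  · have : ((LinearMap.equivOfIsUnitDet hu).toContinuousLinearEquiv : Euc n →ₗ[ℝ] Euc n) = (Matrix.toLpLin 2 2 B.transpose : Euc n →ₗ[ℝ] Euc n) := by
      ext x; simp
    rw [this, hdet, hd, ← Real.sqrt_eq_rpow, Real.sqrt_sq_eq_abs]

lemma integral_lin (L : Euc n ≃L[ℝ] Euc n) (G : Euc n → ℝ) {D : ℝ} (hD : |LinearMap.det (L : Euc n →ₗ[ℝ] Euc n)| = D) (hD0 : 0 < D)
    (x₀ : Euc n) {ε : ℝ} (hε : 0 < ε) :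
    ∫ x, G x = ε ^ (n:ℝ) * D * ∫ X, G (x₀ + ε • L X) := by
  have h0 : LinearMap.det (L : Euc n →ₗ[ℝ] Euc n) ≠ 0 := by
    intro h; rw [h] at hD; simp at hD; linarith
  have h1 := integral_affine G x₀ hε
  have h2 : ∫ X, G (x₀ + ε • L X) = D⁻¹ * ∫ x, G (x₀ + ε • x) := by
    have hm : MeasurableEmbedding L := L.toHomeomorph.measurableEmbedding
    have := hm.integral_map (μ := volume) (fun x => G (x₀ + ε • x))
    rw [← this]
    have h3 := Measure.map_linearMap_addHaar_eq_smul_addHaar (μ := (volume : Measure (Euc n))) h0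
    have h4 : Measure.map L volume = Measure.map (L : Euc n →ₗ[ℝ] Euc n) (volume : Measure (Euc n)) := rfl
    rw [h4, h3, integral_smul_measure, abs_inv, hD, ENNReal.toReal_ofReal (by positivity), smul_eq_mul]
  rw [h2, h1]
  have : 0 < ε ^ (n:ℝ) := by positivity
  field_simp

end IEE

namespace IEE
variable {n : ℕ} {a β : ℝ}

/-- inverse rescaling -/
def inv0 (L : Euc n ≃L[ℝ] Euc n) (x₀ : Euc n) (ε : ℝ) (p : Euc n × ℝ) : Euc n × ℝ :=
  (ε⁻¹ • L.symm (p.1 - x₀), ε⁻¹ * p.2)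

lemma inv0_fwd (L : Euc n ≃L[ℝ] Euc n) (x₀ : Euc n) {ε : ℝ} (hε : 0 < ε) (P : Euc n × ℝ) :
    inv0 L x₀ ε (x₀ + ε • L P.1, ε * P.2) = P := by
  unfold inv0
  have := hε.ne'
  ext <;> simp [smul_smul, this]

lemma fwd_inv0 (L : Euc n ≃L[ℝ] Euc n) (x₀ : Euc n) {ε : ℝ} (hε : 0 < ε) (p : Euc n × ℝ) :
    (x₀ + ε • L (inv0 L x₀ ε p).1, ε * (inv0 L x₀ ε p).2) = p := by
  unfold inv0
  have := hε.ne'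
  ext <;> simp [smul_smul, this]

lemma inv0_contDiff (L : Euc n ≃L[ℝ] Euc n) (x₀ : Euc n) (ε : ℝ) : ContDiff ℝ (⊤ : ℕ∞) (inv0 L x₀ ε) := by
  unfold inv0
  refine ContDiff.prodMk ?_ ?_
  · exact (L.symm.contDiff.comp (contDiff_fst.sub contDiff_const)).const_smul _
  · exact contDiff_const.mul contDiff_snd

lemma energy_cov (ha : -1 < a) (L : Euc n ≃L[ℝ] Euc n) {D : ℝ} (hD : |LinearMap.det (L : Euc n →ₗ[ℝ] Euc n)| = D) (hD0 : 0 < D)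
    (x₀ : Euc n) {ε : ℝ} (hε : 0 < ε) {W : Euc n × ℝ → ℝ} (hW : Continuous W) (hWc : HasCompactSupport W) (hW0 : ∀ p, 0 ≤ W p)
    {Ω : Set (Euc n)} (hΩ : MeasurableSet Ω) {Q : Euc n → ℝ → ℝ} (hQ0 : ∀ x ∈ Ω, ∀ y > 0, 0 ≤ Q x y)
    (hQ : ∀ x ∈ Ω, ∀ y > 0, Q x y ≤ ε ^ (-(2:ℝ)) * W (inv0 L x₀ ε (x, y))) :
    ∫ x in Ω, ∫ y in Ioi (0:ℝ), y ^ a * Q x y ≤ ε ^ ((n:ℝ) + a - 1) * D * ∫ p, W p ∂(mu n a) := by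
  have hcont : Continuous (fun p => W (inv0 L x₀ ε p)) := hW.comp (inv0_contDiff L x₀ ε).continuous
  set φ : Euc n × ℝ → Euc n × ℝ := fun P => (x₀ + ε • L P.1, ε * P.2) with hφ
  have hφc : Continuous φ := by
    rw [hφ]
    have : Continuous (fun P : Euc n × ℝ => L P.1) := L.continuous.comp continuous_fst
    fun_prop
  have hIntg : Integrable (fun p => W (inv0 L x₀ ε p)) (mu n a) := by
    refine mu_cpt_int ha hcont (hWc.isCompact.image hφc) (fun p _ hp => ?_)
    by_contra hne
    exact hp ⟨inv0 L x₀ ε p, subset_tsupport _ hne, fwd_inv0 L x₀ hε p⟩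
  set H : Euc n → ℝ → ℝ := fun x y => ε ^ (-(2:ℝ)) * W (inv0 L x₀ ε (x, y)) with hH
  have hH0 : ∀ x y, 0 ≤ H x y := fun x y => mul_nonneg (by positivity) (hW0 _)
  have hIntg' : Integrable (fun p : Euc n × ℝ => H p.1 p.2) (mu n a) := hIntg.const_mul _
  have h1 : ∀ᵐ x : Euc n, Integrable (fun y => H x y) (nu1 a) := by
    unfold mu at hIntg'
    exact hIntg'.prod_right_ae
  have h2 : Integrable (fun x : Euc n => ∫ y in Ioi (0:ℝ), y ^ a * H x y) := by
    unfold mu at hIntg'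
    have := hIntg'.integral_prod_left
    simpa only [integral_nu1] using this
  have hpos : ∀ x, 0 ≤ ∫ y in Ioi (0:ℝ), y ^ a * H x y := fun x =>
    setIntegral_nonneg measurableSet_Ioi fun y hy => mul_nonneg (Real.rpow_nonneg (le_of_lt hy) _) (hH0 _ _)
  have h3 : ∫ x in Ω, ∫ y in Ioi (0:ℝ), y ^ a * Q x y ≤ ∫ x, ∫ y in Ioi (0:ℝ), y ^ a * H x y := by
    refine le_trans ?_ (setIntegral_le_integral (s := Ω) h2 (Eventually.of_forall hpos))
    refine integral_mono_of_nonneg ?_ h2.integrableOn ?_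
    · filter_upwards [ae_restrict_mem hΩ] with x hx
      exact setIntegral_nonneg measurableSet_Ioi fun y hy => mul_nonneg (Real.rpow_nonneg (le_of_lt hy) _) (hQ0 x hx y hy)
    · filter_upwards [ae_restrict_mem hΩ, ae_restrict_of_ae h1] with x hx hx1
      rw [integrable_nu1] at hx1
      refine integral_mono_of_nonneg ?_ hx1 ?_
      · filter_upwards [ae_restrict_mem measurableSet_Ioi] with y hy
        exact mul_nonneg (Real.rpow_nonneg (le_of_lt hy) _) (hQ0 x hx y hy)
      · filter_upwards [ae_restrict_mem measurableSet_Ioi] with y hy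
        exact mul_le_mul_of_nonneg_left (hQ x hx y hy) (Real.rpow_nonneg (le_of_lt hy) _)
  refine h3.trans (le_of_eq ?_)
  rw [integral_lin L _ hD hD0 x₀ hε]
  have hWi : Integrable W (mu n a) := mu_cpt_int ha hW hWc.isCompact (fun p _ hp => image_eq_zero_of_notMem_tsupport hp)
  rw [integral_mu hWi]
  have h4 : ∀ X : Euc n, ∫ y in Ioi (0:ℝ), y ^ a * H (x₀ + ε • L X) y = ε ^ (a - 1) * ∫ y in Ioi (0:ℝ), y ^ a * W (X, y) := by
    intro X
    have e := integral_comp_mul_left_Ioi' (fun y : ℝ => y ^ a * H (x₀ + ε • L X) y) 0 hε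
    rw [mul_zero] at e
    rw [← e, smul_eq_mul, ← integral_const_mul, ← integral_const_mul]
    refine setIntegral_congr_fun measurableSet_Ioi (fun y hy => ?_)
    have hy' : (0:ℝ) < y := hy
    simp only [hH]
    rw [inv0_fwd L x₀ hε (X, y), Real.mul_rpow hε.le hy'.le]
    have : ε ^ (a - 1) = ε * (ε ^ a * ε ^ (-(2:ℝ))) := by
      rw [← Real.rpow_add hε]
      nth_rewrite 2 [← Real.rpow_one ε]
      rw [← Real.rpow_add hε]; congr 1; ring
    rw [this]; ring
  simp only [h4, integral_const_mul]
  have : ε ^ ((n:ℝ) + a - 1) = ε ^ (n:ℝ) * ε ^ (a - 1) := by rw [← Real.rpow_add hε]; congr 1; ring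
  rw [this]; ring

lemma trace_cov (L : Euc n ≃L[ℝ] Euc n) {D : ℝ} (hD : |LinearMap.det (L : Euc n →ₗ[ℝ] Euc n)| = D) (hD0 : 0 < D)
    (x₀ : Euc n) {ε : ℝ} (hε : 0 < ε) (F : Euc n × ℝ → ℝ) (h : ℝ → ℝ) (h0 : h 0 = 0)
    {Ω : Set (Euc n)} (hsub : ∀ x, F (inv0 L x₀ ε (x, 0)) ≠ 0 → x ∈ Ω) :
    ∫ x in Ω, h (F (inv0 L x₀ ε (x, 0))) = ε ^ (n:ℝ) * D * ∫ X, h (F (X, 0)) := by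
  rw [setIntegral_eq_integral_of_forall_compl_eq_zero, integral_lin L _ hD hD0 x₀ hε]
  · congr 2
    funext X
    have := inv0_fwd L x₀ hε (X, 0)
    simp only [mul_zero] at this
    rw [this]
  · intro x hx
    by_cases hF : F (inv0 L x₀ ε (x, 0)) = 0
    · rw [hF, h0]
    · exact absurd (hsub x hF) hx

lemma gr_fwd {B : Matrix (Fin n) (Fin n) ℝ} (L : Euc n ≃L[ℝ] Euc n) (hL : ∀ i, L (EuclideanSpace.single i 1) = WithLp.toLp 2 (B i))
    (x₀ : Euc n) {ε : ℝ} (hε : 0 < ε) {F : Euc n × ℝ → ℝ} (hF : ContDiff ℝ (⊤ : ℕ∞) F) (p : Euc n × ℝ) :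
    (∀ i, gr F (inv0 L x₀ ε p) (some i) = ε * ∑ j, B i j * gr (fun p => F (inv0 L x₀ ε p)) p (some j)) ∧
    gr F (inv0 L x₀ ε p) none = ε * gr (fun p => F (inv0 L x₀ ε p)) p none := by
  set P := inv0 L x₀ ε p with hP
  set f : Euc n × ℝ → ℝ := fun p => F (inv0 L x₀ ε p) with hf
  have hfd : Differentiable ℝ f := (hF.comp (inv0_contDiff L x₀ ε)).differentiable (by simp)
  set φ' : Euc n × ℝ →L[ℝ] Euc n × ℝ := (ε • ((L : Euc n →L[ℝ] Euc n).comp (ContinuousLinearMap.fst ℝ (Euc n) ℝ))).prod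
    (ε • ContinuousLinearMap.snd ℝ (Euc n) ℝ) with hφ'
  have hφ : HasFDerivAt (fun P : Euc n × ℝ => ((x₀, 0) : Euc n × ℝ) + φ' P) φ' P := (φ'.hasFDerivAt).const_add _
  have hpt : ((x₀, 0) : Euc n × ℝ) + φ' P = p := by
    have := fwd_inv0 L x₀ hε p
    rw [← hP] at this
    rw [← this]
    simp [hφ']
  have hcomp : F = f ∘ (fun P : Euc n × ℝ => ((x₀, 0) : Euc n × ℝ) + φ' P) := by
    funext P'
    have := inv0_fwd L x₀ hε P'
    simp only [Function.comp, hf]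
    have e : ((x₀, 0) : Euc n × ℝ) + φ' P' = (x₀ + ε • L P'.1, ε * P'.2) := by simp [hφ']
    rw [e, this]
  have hd : HasFDerivAt f (fderiv ℝ f p) (((x₀, 0) : Euc n × ℝ) + φ' P) := by rw [hpt]; exact (hfd p).hasFDerivAt
  have hc := (hd.comp P hφ).fderiv
  rw [← hcomp] at hc
  refine ⟨fun i => ?_, ?_⟩
  · unfold gr
    rw [hc]
    have e : φ' (bb n (some i)) = ε • ∑ j, B i j • bb n (some j) := by
      have : (∑ j, B i j • bb n (some j)) = (WithLp.toLp 2 (B i), (0:ℝ)) := by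
        apply Prod.ext
        · rw [Prod.fst_sum]
          ext k
          simp [bb, Finset.sum_apply, PiLp.single_apply, Pi.single_apply]
        · rw [Prod.snd_sum]; simp [bb]
      rw [this]
      simp [hφ', bb, hL]
    rw [ContinuousLinearMap.comp_apply, e, map_smul, map_sum]
    simp
  · unfold gr
    rw [hc]
    have e : φ' (bb n none) = ε • bb n none := by simp [hφ', bb]
    rw [ContinuousLinearMap.comp_apply, e, map_smul]
    simp

lemma coer {B : Matrix (Fin n) (Fin n) ℝ} (L : Euc n ≃L[ℝ] Euc n) (hL : ∀ i, L (EuclideanSpace.single i 1) = WithLp.toLp 2 (B i)) :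
    ∃ Cm > 0, ∀ v : Euc n, ‖v‖ ^ 2 ≤ Cm * ∑ i, (∑ j, B i j * v j) ^ 2 := by
  refine ⟨‖(L.symm : Euc n →L[ℝ] Euc n)‖ ^ 2 + 1, by positivity, fun v => ?_⟩
  set w := ContinuousLinearMap.adjoint (L : Euc n →L[ℝ] Euc n) v with hw
  have hwi : ∀ i, w i = ∑ j, B i j * v j := by
    intro i
    have h1 : inner ℝ (EuclideanSpace.single i (1:ℝ)) w = w i := by simp [EuclideanSpace.inner_single_left]
    rw [← h1, hw, ContinuousLinearMap.adjoint_inner_right]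
    have : (L : Euc n →L[ℝ] Euc n) (EuclideanSpace.single i 1) = WithLp.toLp 2 (B i) := hL i
    rw [this, PiLp.inner_apply]
    simp [mul_comm]
  have hn2 : ∑ i, (∑ j, B i j * v j) ^ 2 = ‖w‖ ^ 2 := by
    rw [EuclideanSpace.norm_sq_eq]; simp [hwi]
  rw [hn2]
  have h2 : ‖v‖ ^ 2 ≤ ‖w‖ * (‖(L.symm : Euc n →L[ℝ] Euc n)‖ * ‖v‖) := by
    have e : inner ℝ w (L.symm v) = ‖v‖ ^ 2 := by
      rw [hw, ContinuousLinearMap.adjoint_inner_left]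
      have : (L : Euc n →L[ℝ] Euc n) (L.symm v) = v := L.apply_symm_apply v
      rw [this, real_inner_self_eq_norm_sq]
    rw [← e]
    refine (real_inner_le_norm _ _).trans ?_
    gcongr
    exact (L.symm : Euc n →L[ℝ] Euc n).le_opNorm v
  set M := ‖(L.symm : Euc n →L[ℝ] Euc n)‖
  have h3 : ‖v‖ ≤ M * ‖w‖ := by
    rcases eq_or_lt_of_le (norm_nonneg v) with h | h
    · rw [← h]; positivity
    · refine le_of_mul_le_mul_right ?_ h
      nlinarith
  have := mul_self_le_mul_self (norm_nonneg v) h3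
  nlinarith [_root_.sq_nonneg ‖w‖]

lemma quad_factor {A0 B : Matrix (Fin n) (Fin n) ℝ} (hB : A0 = B.transpose * B) (v : Fin n → ℝ) :
    ∑ i, ∑ j, A0 i j * v i * v j = ∑ i, (∑ j, B i j * v j) ^ 2 := by
  have e : ∀ k, (∑ j, B k j * v j) ^ 2 = ∑ i, ∑ j, B k i * v i * (B k j * v j) := by
    intro k; rw [_root_.pow_two, Finset.sum_mul_sum]
  have e2 : ∀ i j, A0 i j * v i * v j = ∑ k, B k i * v i * (B k j * v j) := by
    intro i j
    rw [hB, Matrix.mul_apply, Finset.sum_mul, Finset.sum_mul]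
    refine Finset.sum_congr rfl fun k _ => ?_
    rw [Matrix.transpose_apply]; ring
  simp_rw [e, e2]
  rw [Finset.sum_comm (s := Finset.univ) (f := fun k i => ∑ j, B k i * v i * (B k j * v j))]
  refine Finset.sum_congr rfl fun i _ => ?_
  rw [Finset.sum_comm]

end IEE

namespace IEE
variable {n : ℕ} {a β : ℝ}

set_option maxHeartbeats 800000 in
lemma quad_bound {M A0 B : Matrix (Fin n) (Fin n) ℝ} (hB : A0 = B.transpose * B)
    (L : Euc n ≃L[ℝ] Euc n) (hL : ∀ i, L (EuclideanSpace.single i 1) = WithLp.toLp 2 (B i))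
    {Cm : ℝ} (hCm : 0 < Cm) (hco : ∀ v : Euc n, ‖v‖ ^ 2 ≤ Cm * ∑ i, (∑ j, B i j * v j) ^ 2)
    {Λ : ℝ} (hΛ : 0 < Λ) (hLΛ : ∀ X, ‖L X‖ ≤ Λ * ‖X‖)
    {F : Euc n × ℝ → ℝ} (hF : ContDiff ℝ (⊤ : ℕ∞) F) {R δ0 : ℝ} (hR0 : 0 < R) (hδ0 : 0 < δ0)
    (hsup : tsupport F ⊆ Metric.closedBall 0 (2*R)) (hδΛ : 2 * Λ * δ0 ≤ 1)
    {C₀ σ σ' : ℝ} (hC₀ : 0 < C₀) (hσ' : 0 < σ') (hσσ : σ' ≤ σ) (x₀ x : Euc n) (y : ℝ)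
    (hub : ‖x - x₀‖ ≤ 2 * Λ * δ0 → ∀ v : Euc n, (∑ i, ∑ j, M i j * v i * v j)
        ≤ (∑ i, ∑ j, A0 i j * v i * v j) + C₀ * ‖x - x₀‖ ^ σ * ‖v‖ ^ 2) :
    quadB n M (fun x y => F (inv0 L x₀ (δ0/R) (x, y))) x y ≤ (δ0/R) ^ (-(2:ℝ)) *
      ((1 + C₀ * Cm * Λ ^ σ' * (δ0/R) ^ σ' * (1 + sq (inv0 L x₀ (δ0/R) (x, y))) ^ (σ'/2)) * gip F F (inv0 L x₀ (δ0/R) (x, y))) := by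
  set ε := δ0/R with hεd
  have hε : 0 < ε := by positivity
  set P := inv0 L x₀ ε (x, y) with hP
  set f : Euc n × ℝ → ℝ := fun p => F (inv0 L x₀ ε p) with hf
  have hfd : Differentiable ℝ f := (hF.comp (inv0_contDiff L x₀ ε)).differentiable (by simp)
  obtain ⟨hg1, hg2⟩ := gr_fwd L hL x₀ hε hF (x, y)
  rw [← hP, ← hf] at hg1 hg2
  set v : Euc n := WithLp.toLp 2 (fun i => gr f (x, y) (some i)) with hv
  set q := gr f (x, y) none with hq
  set S := ∑ i, (∑ j, B i j * v j) ^ 2 with hS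
  have hS0 : 0 ≤ S := Finset.sum_nonneg fun i _ => _root_.sq_nonneg _
  have hquad : quadB n M (fun x y => F (inv0 L x₀ ε (x, y))) x y = (∑ i, ∑ j, M i j * v i * v j) + q ^ 2 := by
    unfold quadB quadA
    rw [pdY_eq (F := f) (fun x y => rfl) (hfd _)]
    congr 1
    refine Finset.sum_congr rfl fun i _ => Finset.sum_congr rfl fun j _ => ?_
    rw [pdX_eq (F := f) (fun x y => rfl) (hfd _), pdX_eq (F := f) (fun x y => rfl) (hfd _)]
  have hgip : gip F F P = ε ^ 2 * (S + q ^ 2) := by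
    unfold gip
    rw [Fintype.sum_option, hg2]
    simp_rw [hg1]
    rw [hS, mul_add, Finset.mul_sum]
    rw [add_comm]
    congr 1
    · refine Finset.sum_congr rfl fun i _ => ?_
      simp only [hv]; ring
    · ring
  set θ := C₀ * Cm * Λ ^ σ' * ε ^ σ' * (1 + sq P) ^ (σ'/2) with hθ
  have hsqP := sq_nonneg' P
  have hθ0 : 0 ≤ θ := by positivity
  rw [hquad, hgip]
  have e1 : ε ^ (-(2:ℝ)) * ((1 + θ) * (ε ^ 2 * (S + q ^ 2))) = (1 + θ) * (S + q^2) := by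
    have : ε ^ (-(2:ℝ)) * ε ^ 2 = 1 := by
      rw [Real.rpow_neg hε.le, Real.rpow_two]; field_simp
    linear_combination ((1 + θ) * (S + q^2)) * this
  rw [e1]
  by_cases hPs : P ∈ tsupport F
  · have hPn : ‖P‖ ≤ 2 * R := by simpa using hsup hPs
    have hP1 : ‖P.1‖ ≤ 2 * R := (norm_fst_le P).trans hPn
    have hxx : x - x₀ = ε • L P.1 := by
      have := congrArg Prod.fst (fwd_inv0 L x₀ hε (x, y))
      simp only [← hP] at this
      rw [← this]; simp
    have hnx : ‖x - x₀‖ ≤ ε * Λ * ‖P.1‖ := by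
      rw [hxx, norm_smul, Real.norm_of_nonneg hε.le, mul_assoc]
      exact mul_le_mul_of_nonneg_left (hLΛ _) hε.le
    have hnx2 : ‖x - x₀‖ ≤ 2 * Λ * δ0 := by
      refine hnx.trans ?_
      calc ε * Λ * ‖P.1‖ ≤ ε * Λ * (2 * R) := by gcongr
        _ = 2 * Λ * δ0 := by rw [hεd]; field_simp
    have h1 := hub hnx2 v
    rw [quad_factor hB, ← hS] at h1
    have h2 : ‖x - x₀‖ ^ σ ≤ Λ ^ σ' * ε ^ σ' * (1 + sq P) ^ (σ'/2) := by
      calc ‖x - x₀‖ ^ σ ≤ ‖x - x₀‖ ^ σ' :=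
            Real.rpow_le_rpow_of_exponent_ge_of_imp (norm_nonneg _) (hnx2.trans hδΛ) hσσ (fun _ h => absurd h (hσ'.trans_le hσσ).ne')
        _ ≤ (ε * Λ * ‖P.1‖) ^ σ' := Real.rpow_le_rpow (norm_nonneg _) hnx hσ'.le
        _ = Λ ^ σ' * ε ^ σ' * ‖P.1‖ ^ σ' := by
            rw [Real.mul_rpow (by positivity) (norm_nonneg _), Real.mul_rpow hε.le hΛ.le]; ring
        _ ≤ Λ ^ σ' * ε ^ σ' * (1 + sq P) ^ (σ'/2) := by
            refine mul_le_mul_of_nonneg_left ?_ (by positivity)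
            have : ‖P.1‖ ^ σ' = (‖P.1‖ ^ 2) ^ (σ'/2) := by
              rw [← Real.rpow_natCast, ← Real.rpow_mul (norm_nonneg _)]; congr 1; push_cast; ring
            rw [this]
            refine Real.rpow_le_rpow (by positivity) ?_ (by positivity)
            unfold sq
            nlinarith [_root_.sq_nonneg P.2]
    have h3 : C₀ * ‖x - x₀‖ ^ σ * ‖v‖ ^ 2 ≤ θ * S := by
      calc C₀ * ‖x - x₀‖ ^ σ * ‖v‖ ^ 2 ≤ C₀ * (Λ ^ σ' * ε ^ σ' * (1 + sq P) ^ (σ'/2)) * (Cm * S) := by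
            gcongr
            exact hco v
        _ = θ * S := by rw [hθ]; ring
    nlinarith [mul_nonneg hθ0 (_root_.sq_nonneg q)]
  · have h0 := gip_zero_left (G := F) hPs
    rw [hgip] at h0
    have h1 : S + q ^ 2 = 0 := by
      rcases mul_eq_zero.mp h0 with h | h
      · exact absurd h (by positivity)
      · exact h
    have hS00 : S = 0 := by nlinarith [_root_.sq_nonneg q]
    have hv0 : v = 0 := by
      have := hco v
      rw [← hS, hS00, mul_zero] at this
      have h5 : ‖v‖ ^ 2 = 0 := le_antisymm this (by positivity)
      simpa using h5
    rw [h1, hv0]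
    simp
    nlinarith [_root_.sq_nonneg q]

lemma quadB_nonneg {M : Matrix (Fin n) (Fin n) ℝ} (hM : M.PosDef) (f : Euc n → ℝ → ℝ) (x : Euc n) (y : ℝ) :
    0 ≤ quadB n M f x y := by
  obtain ⟨B, hB⟩ := mat_factor hM
  unfold quadB quadA
  rw [quad_factor hB (fun i => pdX n f i x y)]
  positivity

/-- Lower bound of the quotients. -/
lemma S_bdd (hn : 1 ≤ n) {s : ℝ} (hs : 0 < s) (hns : 2 * s < (n:ℝ)) {cs lam : ℝ} (hcs : 0 < cs) (hlam : 0 < lam)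
    {Ω : Set (Euc n)} (hΩo : IsOpen Ω) (hΩb : Bornology.IsBounded Ω) {A : Euc n → Matrix (Fin n) (Fin n) ℝ}
    (hApos : ∀ x ∈ closure Ω, (A x).PosDef) : BddBelow (SQuotSet n s cs lam Ω A) := by
  have hn0 : (0:ℝ) < n := by exact_mod_cast hn
  set V := (volume.real Ω) ^ (2*s/n) with hV
  refine ⟨-(lam * V), ?_⟩
  rintro r ⟨f, hf, hfc, hfs, hf0, rfl⟩
  have hE : 0 ≤ ∫ x in Ω, ∫ y in Ioi (0:ℝ), y ^ (1 - 2*s) * quadB n (A x) f x y :=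
    setIntegral_nonneg hΩo.measurableSet fun x hx => setIntegral_nonneg measurableSet_Ioi fun y hy =>
      mul_nonneg (Real.rpow_nonneg (le_of_lt hy) _) (quadB_nonneg (hApos x (subset_closure hx)) _ _ _)
  set X := ∫ x in Ω, |f x 0| ^ (2*(n:ℝ) / ((n:ℝ) - 2*s)) with hX
  have hX0 : 0 ≤ X := setIntegral_nonneg hΩo.measurableSet fun x hx => by positivity
  have hfin : volume Ω < ⊤ := hΩb.measure_lt_top
  haveI : IsFiniteMeasure (volume.restrict Ω) := ⟨by simpa using hfin⟩
  have hcont : Continuous (fun x : Euc n => f x 0) := hf.continuous.comp (by fun_prop : Continuous fun x : Euc n => (x, (0:ℝ)))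
  have hcs0 : HasCompactSupport (fun x : Euc n => f x 0) := by
    refine HasCompactSupport.of_support_subset_isCompact (hfc.image continuous_fst) ?_
    intro x hx
    exact ⟨(x, 0), subset_closure ⟨le_rfl, hx⟩, rfl⟩
  have hold : ∫ x in Ω, (f x 0) ^ 2 ≤ X ^ (((n:ℝ) - 2*s)/n) * V := by
    have hpq : ((n:ℝ)/((n:ℝ) - 2*s)).HolderConjugate (n/(2*s)) := by
      rw [Real.holderConjugate_iff]
      refine ⟨?_, ?_⟩
      · rw [lt_div_iff₀ (by linarith)]; linarith
      · have : (n:ℝ) - 2*s ≠ 0 := by linarith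
        field_simp
        ring
    have hm1 : MemLp (fun x : Euc n => (f x 0)^2) (ENNReal.ofReal ((n:ℝ)/((n:ℝ) - 2*s))) (volume.restrict Ω) := by
      refine Continuous.memLp_of_hasCompactSupport (hcont.pow 2) ?_
      exact hcs0.comp_left (g := fun t : ℝ => t^2) (by simp)
    have := integral_mul_le_Lp_mul_Lq_of_nonneg (μ := volume.restrict Ω) hpq (f := fun x : Euc n => (f x 0)^2) (g := fun _ => (1:ℝ))
      (Eventually.of_forall fun x => by positivity) (Eventually.of_forall fun x => by simp) hm1 (memLp_const 1)
    simp only [mul_one, Real.one_rpow] at this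
    refine this.trans (le_of_eq ?_)
    congr 1
    · rw [hX]
      congr 1
      · congr 1
        funext x
        rw [← sq_abs, ← Real.rpow_natCast, ← Real.rpow_mul (abs_nonneg _)]
        congr 1
        push_cast; ring
      · rw [one_div_div]
    · rw [hV, one_div_div]
      simp
  set Y := X ^ (((n:ℝ) - 2*s)/n) with hY
  have hY0 : 0 ≤ Y := by positivity
  rcases eq_or_lt_of_le hY0 with h | h
  · rw [← h, div_zero]
    have : 0 ≤ lam * V := by positivity
    linarith
  · rw [le_div_iff₀ h]
    have := mul_le_mul_of_nonneg_left hold hlam.le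
    have := mul_nonneg hcs.le hE
    linarith

end IEE

set_option maxHeartbeats 1600000

/-- Proposition 3.1: the key strict energy estimate in the interior case. -/
theorem interior_energy_estimate
    (n : ℕ) (hn : 1 ≤ n) (s : ℝ) (hs : s ∈ Ioo (0:ℝ) 1) (hns : 2 * s < (n:ℝ))
    (cs : ℝ) (hcs : 0 < cs)
    (Ω : Set (Euc n)) (hΩo : IsOpen Ω) (hΩb : Bornology.IsBounded Ω)
    (A : Euc n → Matrix (Fin n) (Fin n) ℝ)
    (hAc : ∀ i j, ContinuousOn (fun x => A x i j) (closure Ω))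
    (hAsym : ∀ x ∈ closure Ω, (A x).IsSymm)
    (hApos : ∀ x ∈ closure Ω, (A x).PosDef)
    (x₀ : Euc n) (hx₀ : x₀ ∈ Ω)
    (C₀ σ r₀ : ℝ) (hC₀ : 0 < C₀) (hσ : 2 * s < σ) (hr₀ : 0 < r₀)
    (hA_ub : ∀ x ∈ closure Ω, ‖x - x₀‖ < r₀ → ∀ v : Euc n,
      (∑ i, ∑ j, A x i j * v i * v j)
        ≤ (∑ i, ∑ j, A x₀ i j * v i * v j) + C₀ * ‖x - x₀‖ ^ σ * ‖v‖ ^ 2)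
    (hn4 : 4 * s ≤ (n:ℝ))
    (lam : ℝ) (hlam : 0 < lam) :
    sInf (SQuotSet n s cs lam Ω A)
      < cs * (A x₀).det ^ (s / (n:ℝ)) * sInf (KQuotSet n s) := by
  open IEE in
  have hn0 : (0:ℝ) < n := by exact_mod_cast hn
  obtain ⟨hs0, hs1⟩ := hs
  obtain ⟨β, hβe⟩ : ∃ β : ℝ, β = (n:ℝ)/2 - s := ⟨_, rfl⟩
  obtain ⟨a, hae⟩ : ∃ a : ℝ, a = 1 - 2*s := ⟨_, rfl⟩
  have hβ : 0 < β := by rw [hβe]; linarith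
  have hβ2 : β < (n:ℝ)/2 := by rw [hβe]; linarith
  have ha : -1 < a := by linarith
  have hab : (n:ℝ) + 1 + a = 2*β+2 := by rw [hβe, hae]; ring
  obtain ⟨σ', hσ1, hσ2, hσ3, hσ4⟩ : ∃ σ' : ℝ, 2*s < σ' ∧ σ' ≤ σ ∧ σ' < n ∧ (4*s < n → σ' < 2*β) := by
    rcases lt_or_ge (4*s) (n:ℝ) with h | h
    · have hm : 2*s < min σ (min (n:ℝ) (2*β)) := by
        refine lt_min hσ (lt_min hns (by rw [hβe]; linarith))
      obtain ⟨t, ht1, ht2⟩ := exists_between hm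
      rw [lt_min_iff, lt_min_iff] at ht2
      exact ⟨t, ht1, ht2.1.le, ht2.2.1, fun _ => ht2.2.2⟩
    · have hm : 2*s < min σ (n:ℝ) := lt_min hσ hns
      obtain ⟨t, ht1, ht2⟩ := exists_between hm
      rw [lt_min_iff] at ht2
      exact ⟨t, ht1, ht2.1.le, ht2.2, fun h' => absurd h' (not_lt.mpr h)⟩
  have hA0 := hApos x₀ (subset_closure hx₀)
  have hd := hA0.det_pos
  obtain ⟨B, L, hB, hL, hdet⟩ := lin_factor hA0
  obtain ⟨Cm, hCm, hco⟩ := coer L hL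
  set d := (A x₀).det with hdd
  set D := d ^ ((1:ℝ)/2) with hD
  have hDp : 0 < D := by positivity
  set Λ := ‖(L : Euc n →L[ℝ] Euc n)‖ + 1 with hΛd
  have hΛ : 0 < Λ := by positivity
  have hLΛ : ∀ X, ‖L X‖ ≤ Λ * ‖X‖ := fun X =>
    ((L : Euc n →L[ℝ] Euc n).le_opNorm X).trans (mul_le_mul_of_nonneg_right (by rw [hΛd]; linarith) (norm_nonneg _))
  obtain ⟨r1, hr1, hball⟩ := Metric.isOpen_iff.mp hΩo x₀ hx₀
  set m0 := min r₀ (min 1 r1) with hm0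
  have hm0p : 0 < m0 := lt_min hr₀ (lt_min one_pos hr1)
  set δ0 := m0 / (4*Λ) with hδ
  have hδ0 : 0 < δ0 := by positivity
  have h2Λ : 2 * Λ * δ0 = m0 / 2 := by rw [hδ]; field_simp; ring
  set C' := C₀ * Cm * Λ ^ σ' with hC'
  have hC'p : 0 < C' := by positivity
  obtain ⟨R, hR2, F, hF, hsup, hFne, hmain⟩ := test_fun (n := n) (a := a) (β := β) hn hs0 hs1 hns hn4 hβe hae hσ1 hσ3 hσ4
    (ℓ := lam/cs) (C' := C') (δ0 := δ0) (by positivity) hC'p hδ0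
  have hRp : 0 < R := by linarith
  set ε := δ0 / R with hε'
  have hε : 0 < ε := by positivity
  have hεδ : ε * R = δ0 := by rw [hε']; field_simp
  have hF1 : ContDiff ℝ 1 F := hF.of_le (by exact_mod_cast le_top)
  have hFc : HasCompactSupport F := HasCompactSupport.of_support_subset_isCompact (isCompact_closedBall 0 (2*R)) ((subset_tsupport F).trans hsup)
  -- geometry of the support
  have hsuppt : ∀ p : Euc n × ℝ, F (inv0 L x₀ ε p) ≠ 0 → ‖p.1 - x₀‖ ≤ m0/2 ∧ |p.2| ≤ 2 * δ0 := by
    intro p hp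
    have h1 := hsup (subset_tsupport F hp)
    have h2 : ‖inv0 L x₀ ε p‖ ≤ 2*R := by simpa using h1
    have h3 := (norm_fst_le _).trans h2
    have h4 := (norm_snd_le _).trans h2
    have e := fwd_inv0 L x₀ hε p
    have e1 : p.1 = x₀ + ε • L (inv0 L x₀ ε p).1 := (congrArg Prod.fst e).symm
    have e2 : p.2 = ε * (inv0 L x₀ ε p).2 := (congrArg Prod.snd e).symm
    constructor
    · rw [e1, add_sub_cancel_left, norm_smul, Real.norm_of_nonneg hε.le, ← h2Λ, ← hεδ]
      calc ε * ‖L (inv0 L x₀ ε p).1‖ ≤ ε * (Λ * (2*R)) := by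
            refine mul_le_mul_of_nonneg_left ((hLΛ _).trans ?_) hε.le
            exact mul_le_mul_of_nonneg_left h3 hΛ.le
        _ = _ := by ring
    · rw [e2, abs_mul, abs_of_pos hε, ← hεδ]
      rw [Real.norm_eq_abs] at h4
      nlinarith
  have hmr0 : m0 ≤ r₀ := min_le_left _ _
  have hm1 : m0 ≤ 1 := (min_le_right _ _).trans (min_le_left _ _)
  have hmr1 : m0 ≤ r1 := (min_le_right _ _).trans (min_le_right _ _)
  have hinΩ : ∀ x : Euc n, ‖x - x₀‖ ≤ m0/2 → x ∈ Ω := fun x hx => hball (by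
    rw [Metric.mem_ball, dist_eq_norm]; linarith)
  set f : Euc n → ℝ → ℝ := fun x y => F (inv0 L x₀ ε (x, y)) with hf
  have hclos : closure {p : Euc n × ℝ | 0 ≤ p.2 ∧ f p.1 p.2 ≠ 0} ⊆ Metric.closedBall x₀ (m0/2) ×ˢ Icc (0:ℝ) (2*δ0) := by
    refine closure_minimal ?_ (Metric.isClosed_closedBall.prod isClosed_Icc)
    rintro p ⟨hp0, hp⟩
    obtain ⟨h1, h2⟩ := hsuppt p hp
    exact ⟨by rw [Metric.mem_closedBall, dist_eq_norm]; exact h1, hp0, (le_abs_self _).trans h2⟩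
  have hcpt : IsCompact (Metric.closedBall x₀ (m0/2) ×ˢ Icc (0:ℝ) (2*δ0)) := (isCompact_closedBall _ _).prod isCompact_Icc
  -- the weighted density
  set W : Euc n × ℝ → ℝ := fun p => (1 + C' * ε ^ σ' * (1 + sq p) ^ (σ'/2)) * gip F F p with hW
  have hWcont : Continuous W := (continuous_const.add ((jbp_cont _).const_mul _)).mul (gip_cont hF1 hF1)
  have hgc : HasCompactSupport (gip F F) := HasCompactSupport.of_support_subset_isCompact hFc.isCompact (fun p hp => by
    by_contra h; exact hp (gip_zero_left h))
  have hWc : HasCompactSupport W := hgc.mul_left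
  have hW0 : ∀ p, 0 ≤ W p := fun p => by
    have := sq_nonneg' p
    exact mul_nonneg (by positivity) (gip_self_nonneg F p)
  have hiE := gip_int (a := a) ha hF1 hF1 hFc
  have hiT : Integrable (fun p => (1 + sq p) ^ (σ'/2) * gip F F p) (mu n a) :=
    mu_cpt_int ha ((jbp_cont _).mul (gip_cont hF1 hF1)) hFc.isCompact (fun p _ hp => by rw [gip_zero_left hp, mul_zero])
  set E := ∫ p, gip F F p ∂(mu n a) with hE
  set T := ∫ p, (1 + sq p) ^ (σ'/2) * gip F F p ∂(mu n a) with hT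
  have hWint : ∫ p, W p ∂(mu n a) = E + C' * ε ^ σ' * T := by
    have e : W = fun p => gip F F p + (C' * ε ^ σ') * ((1 + sq p) ^ (σ'/2) * gip F F p) := by
      funext p; rw [hW]; ring
    rw [e, integral_add hiE (hiT.const_mul _), integral_const_mul]
  set M2 := ∫ x : Euc n, F (x, 0) ^ 2 with hM2
  set X := ∫ x : Euc n, |F (x, 0)| ^ ((n:ℝ)/β) with hX
  have henergy : ∫ x in Ω, ∫ y in Ioi (0:ℝ), y ^ (1 - 2*s) * quadB n (A x) f x y ≤ ε ^ ((n:ℝ) - 2*s) * D * (E + C' * ε ^ σ' * T) := by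
    have := energy_cov ha L hdet hDp x₀ hε hWcont hWc hW0 hΩo.measurableSet (Q := fun x y => quadB n (A x) f x y)
      (fun x hx y hy => quadB_nonneg (hApos x (subset_closure hx)) _ _ _)
      (fun x hx y hy => by
        refine quad_bound hB L hL hCm hco hΛ hLΛ hF hRp hδ0 hsup (by rw [h2Λ]; linarith) hC₀ (by linarith) hσ2 x₀ x y ?_
        intro h
        exact hA_ub x (subset_closure hx) (by rw [h2Λ] at h; linarith))
    rw [hWint] at this
    have e : (n:ℝ) + a - 1 = n - 2*s := by rw [hae]; ring
    rw [e] at this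
    rw [← hae]
    exact this
  have hsubΩ : ∀ x, F (inv0 L x₀ ε (x, 0)) ≠ 0 → x ∈ Ω := fun x hx => hinΩ x (hsuppt (x, 0) hx).1
  have hmass : ∫ x in Ω, (f x 0) ^ 2 = ε ^ (n:ℝ) * D * M2 :=
    trace_cov L hdet hDp x₀ hε F (fun t => t ^ 2) (by simp) hsubΩ
  have hpp : 2*(n:ℝ) / ((n:ℝ) - 2*s) = n/β := by
    rw [hβe]
    have : (n:ℝ) - 2*s ≠ 0 := by linarith
    have h2 : (n:ℝ)/2 - s ≠ 0 := by rw [← hβe]; exact hβ.ne'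
    rw [div_eq_div_iff this h2]; ring
  have hnorm : ∫ x in Ω, |f x 0| ^ (2*(n:ℝ) / ((n:ℝ) - 2*s)) = ε ^ (n:ℝ) * D * X := by
    rw [hpp]
    exact trace_cov L hdet hDp x₀ hε F (fun t => |t| ^ ((n:ℝ)/β)) (by
      rw [abs_zero, Real.zero_rpow (by positivity)]) hsubΩ
  have hXpos : 0 < X := by
    obtain ⟨x1, hx1⟩ := hFne
    have hc0 : Continuous (fun x : Euc n => F (x, 0)) := hF.continuous.comp (by fun_prop)
    have hc : Continuous (fun x : Euc n => |F (x, 0)| ^ ((n:ℝ)/β)) :=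
      hc0.abs.rpow_const (fun x => Or.inr (by positivity))
    refine hc.integral_pos_of_hasCompactSupport_nonneg_nonzero (μ := volume) ?_ (fun x => by positivity) (x := x1) ?_
    · exact (cpt_trace hFc).comp_left (g := fun t : ℝ => |t| ^ ((n:ℝ)/β)) (by rw [abs_zero, Real.zero_rpow (by positivity)])
    · have := abs_pos.mpr hx1
      positivity
  have hββ : ((n:ℝ) - 2*s)/n = 2*β/n := by rw [hβe]; ring
  have hden : (∫ x in Ω, |f x 0| ^ (2*(n:ℝ) / ((n:ℝ) - 2*s))) ^ (((n:ℝ) - 2*s) / (n:ℝ))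
      = ε ^ ((n:ℝ) - 2*s) * D ^ (((n:ℝ) - 2*s) / (n:ℝ)) * X ^ (2*β/n) := by
    rw [hnorm, Real.mul_rpow (by positivity) hXpos.le, Real.mul_rpow (by positivity) hDp.le, ← Real.rpow_mul hε.le, hββ]
    congr 3
    rw [← hββ]; field_simp
  have hDD : d ^ (s/n) * D ^ (((n:ℝ) - 2*s) / (n:ℝ)) = D := by
    rw [hD, ← Real.rpow_mul hd.le, ← Real.rpow_add hd]
    congr 1
    field_simp
    ring
  have hmem : (cs * (∫ x in Ω, ∫ y in Ioi (0:ℝ), y ^ (1 - 2*s) * quadB n (A x) f x y)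
              - lam * (∫ x in Ω, (f x 0) ^ 2))
            / (∫ x in Ω, |f x 0| ^ (2*(n:ℝ) / ((n:ℝ) - 2*s))) ^ (((n:ℝ) - 2*s) / (n:ℝ)) ∈ SQuotSet n s cs lam Ω A := by
    refine ⟨f, ?_, ?_, ?_, ?_, rfl⟩
    · exact hF.comp (inv0_contDiff L x₀ ε)
    · exact hcpt.of_isClosed_subset isClosed_closure hclos
    · intro p hp
      obtain ⟨h1, h2⟩ := hclos hp
      refine ⟨hinΩ p.1 ?_, h2.1⟩
      rw [← dist_eq_norm]; exact h1
    · obtain ⟨x1, hx1⟩ := hFne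
      refine ⟨x₀ + ε • L x1, ?_⟩
      have := inv0_fwd L x₀ hε (x1, 0)
      simp only [mul_zero] at this
      rw [hf]
      simp only [this]
      exact hx1
  refine lt_of_le_of_lt (csInf_le (S_bdd hn hs0 hns hcs hlam hΩo hΩb hApos) hmem) ?_
  have hK := K_lower hn ⟨hs0, hs1⟩ hns
  rw [← hae, ← hβe] at hK
  refine lt_of_lt_of_le ?_ (mul_le_mul_of_nonneg_left hK (by positivity))
  rw [hden, hmass, div_lt_iff₀ (by positivity)]
  set κ := kap n a β / Hs n β with hκ
  have e1 : cs * d ^ (s/n) * κ * (ε ^ ((n:ℝ) - 2*s) * D ^ (((n:ℝ) - 2*s) / (n:ℝ)) * X ^ (2*β/n))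
      = (cs * ε ^ ((n:ℝ) - 2*s) * D) * (κ * X ^ (2*β/n)) := by
    linear_combination (cs * κ * ε ^ ((n:ℝ) - 2*s) * X ^ (2*β/n)) * hDD
  rw [e1]
  have h1 := mul_le_mul_of_nonneg_left henergy hcs.le
  have h2 := mul_lt_mul_of_pos_left hmain (by positivity : 0 < cs * ε ^ ((n:ℝ) - 2*s) * D)
  refine lt_of_le_of_lt ?_ h2
  have e2 : ε ^ (n:ℝ) = ε ^ ((n:ℝ) - 2*s) * ε ^ (2*s) := by rw [← Real.rpow_add hε]; congr 1; ring
  have e3 : (cs * ε ^ ((n:ℝ) - 2*s) * D) * (lam/cs * ε ^ (2*s) * M2) = lam * (ε ^ (n:ℝ) * D * M2) := by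
    rw [e2]; field_simp
  rw [mul_sub, e3]
  linarith
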